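/- Let $(M,g)$ be a smooth real 4-dimensional Lorentzian manifold of signature $(+,-,-,-)$, and let $(o^A,\iota^A)$, $o_A\iota^A=1$, be a smooth spin dyad over an open set $U\subseteq M$, with null tetrad $l=o\bar o$, $n=\iota\bar\iota$, $m=o\bar\iota$, $\bar m=\iota\bar o$ (so $g(l,n)=1$, $g(m,\bar m)=-1$, all other products zero). Conventions: $\psi_B=\psi^A\epsilon_{AB}$, $\psi^A=\epsilon^{AB}\psi_B$, $g_{ab}=\epsilon_{AB}\bar\epsilon_{A'B'}$, $(\nabla_a\nabla_b-\nabla_b\nabla_a)V^d=R_{abc}{}^dV^c$, $R_{ac}=R_{abc}{}^b$; $\Psi_{ABCD}$ is the totally symmetric part of $\frac14R_{AX'B}{}^{X'}{}_{CY'D}{}^{Y'}$, and for a totally symmetric spinor the component with subscript $i$ is its contraction with $4-i$ factors $o$ and $i$ factors $\iota$. Assume that on $U$ the metric is Einstein, i.e. $R_{ab}=\frac14Rg_{ab}$ with $R=24\Lambda$, $\Lambda$ a real constant, and that it is of Petrov type II with repeated principal spinor $o^A$, i.e. $\Psi_0=\Psi_1=0$ and $\Psi_2\neq0$ (type D is not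 excluded; $\kappa=\sigma=0$ then follows). Let $\Psi_2^{1/3}$ be a smooth cube root of $\Psi_2$ on $U$. The GHP derivative on scalars of weight $\{p,q\}$ is $\Theta_a\eta=\nabla_a\eta-p(\iota^B\nabla_ao_B)\eta-q(\bar\iota^{B'}\nabla_a\bar o_{B'})\eta$, and $\text{þ}=l^a\Theta_a$, $\text{þ}'=n^a\Theta_a$, $\text{ð}=m^a\Theta_a$, $\text{ð}'=\bar m^a\Theta_a$ change the weight by $\{1,1\},\{-1,-1\},\{1,-1\},\{-1,1\}$ respectively. With $\nabla_X=X^a\nabla_a$, the spin coefficients are $\rho=o^A\nabla_{\bar m}o_A$, $\tau=o^A\nabla_no_A$, $\rho'=-\iota^A\nabla_m\iota_A$, $\tau'=-\iota^A\nabla_l\iota_A$, $\sigma'=-\iota^A\nabla_{\bar m}\iota_A$. Let $\chi$ be any smooth complex scalar of GHP weight $\{-4,0\}$ on $U$ (not assumed to satisfy any equation). Put $$\mathcal O^\dagger\chi=2\big[(\text{þ}'-\bar\rho')(\text{þ}+3\rho)-(\text{ð}'-\bar\tau)(\text{ð}+3\tau)-3\Psi_2\big]\chi,$$ which again has weight $\{-4,0\}$,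 and let $h_{ab}=\mathcal S^\dagger(\chi)_{ab}=h_{nn}l_al_b-2h_{n\bar m}l_{(a}m_{b)}+h_{\bar m\bar m}m_am_b$ with $$h_{nn}=-(\text{ð}+2\tau)\text{ð}\chi-\bar\sigma'\text{þ}\chi,\quad h_{n\bar m}=-(\text{þ}+\rho)\text{ð}\chi-(\tau+\bar\tau')\text{þ}\chi,\quad h_{\bar m\bar m}=-(\text{þ}+2\rho)\text{þ}\chi.$$ Let $\dot\Psi_{ABCD}=\frac12\nabla_{(A}{}^{A'}\nabla_B{}^{B'}h_{CD)A'B'}+\frac14g^{ef}h_{ef}\Psi_{ABCD}$ be the anti-self-dual linearized Weyl spinor of $h$, and let $\xi_{AA'}=\nabla^B{}_{A'}K_{AB}$ be the projected Killing vector, where $K_{AB}=\Psi_2^{-1/3}o_{(A}\iota_{B)}-\frac13\Psi_2^{-4/3}\Psi_3o_Ao_B$. Then on $U$ $$\dot\Psi_0=\dot\Psi_1=\dot\Psi_2=0,\qquad \dot\Psi_3=-\tfrac14(\tau\text{þ}-\rho\text{ð})\mathcal O^\dagger\chi,$$ $$\dot\Psi_4=-\big(\Psi_2^{4/3}\xi^a\Theta_a+3\Psi_2^2+6\Psi_2\Lambda\big)\chi-\big(\tfrac18\mathcal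 O^\dagger-\rho\text{þ}'+\tau\text{ð}'+2\Psi_2+\tfrac52\Lambda\big)\mathcal O^\dagger\chi.$$ -/

import Mathlib

open scoped Manifold ContDiff

noncomputable section

namespace Debye

/-! ### Lorentzian metrics and complex vector fields on a real 4-manifold -/

section Geometry

variable {M : Type*} [TopologicalSpace M] [ChartedSpace (EuclideanSpace ℝ (Fin 4)) M]

/-- A smooth Lorentzian metric of signature `(+,-,-,-)` on a smooth 4-manifold. -/
structure LorentzianMetric (M : Type*) [TopologicalSpace M]
    [ChartedSpace (EuclideanSpace ℝ (Fin 4)) M] [IsManifold (𝓡 4) ∞ M] where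
  /-- the bilinear form on each tangent space -/
  val : ∀ x : M, TangentSpace (𝓡 4) x →L[ℝ] TangentSpace (𝓡 4) x →L[ℝ] ℝ
  symm : ∀ (x : M) (v w : TangentSpace (𝓡 4) x), val x v w = val x w v
  signature : ∀ x : M, ∃ b : Module.Basis (Fin 4) ℝ (TangentSpace (𝓡 4) x),
    ∀ i j, val x (b i) (b j) = if i = j then (if i = 0 then 1 else -1) else 0
  contMDiff : ContMDiff (𝓡 4)
    ((𝓡 4).prod 𝓘(ℝ, EuclideanSpace ℝ (Fin 4) →L[ℝ] EuclideanSpace ℝ (Fin 4) →L[ℝ] ℝ)) ∞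
    (fun x => Bundle.TotalSpace.mk'
      (EuclideanSpace ℝ (Fin 4) →L[ℝ] EuclideanSpace ℝ (Fin 4) →L[ℝ] ℝ)
      (E := fun x : M => TangentSpace (𝓡 4) x →L[ℝ] TangentSpace (𝓡 4) x →L[ℝ] ℝ) x (val x))

/-- A complex vector field `re + i im`, i.e. a section of the complexified tangent bundle. -/
structure CVectorField (M : Type*) [TopologicalSpace M]
    [ChartedSpace (EuclideanSpace ℝ (Fin 4)) M] where
  re : ∀ x : M, TangentSpace (𝓡 4) x
  im : ∀ x : M, TangentSpace (𝓡 4) x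

namespace CVectorField

/-- A real vector field regarded as a complex one. -/
def ofReal (V : ∀ x : M, TangentSpace (𝓡 4) x) : CVectorField M := ⟨V, 0⟩

/-- Complex conjugate vector field. -/
def conj (X : CVectorField M) : CVectorField M := ⟨X.re, -X.im⟩

/-- The derivative `X f` of a complex function along a complex vector field. -/
def deriv (X : CVectorField M) (f : M → ℂ) : M → ℂ := fun x =>
  mvfderiv (𝓡 4) f x (X.re x) + Complex.I * mvfderiv (𝓡 4) f x (X.im x)

/-- The complex bilinear extension of the Lie bracket of vector fields. -/
def bracket (X Y : CVectorField M) : CVectorField M where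
  re := VectorField.mlieBracket (𝓡 4) X.re Y.re - VectorField.mlieBracket (𝓡 4) X.im Y.im
  im := VectorField.mlieBracket (𝓡 4) X.re Y.im + VectorField.mlieBracket (𝓡 4) X.im Y.re

end CVectorField

variable [IsManifold (𝓡 4) ∞ M]

namespace LorentzianMetric

/-- The complex bilinear extension of the metric. -/
def inner (g : LorentzianMetric M) (X Y : CVectorField M) : M → ℂ := fun x =>
  ((g.val x (X.re x) (Y.re x) - g.val x (X.im x) (Y.im x) : ℝ) : ℂ) +
    Complex.I * ((g.val x (X.re x) (Y.im x) + g.val x (X.im x) (Y.re x) : ℝ) : ℂ)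

/-- `g(∇_X Y, Z)` for the Levi-Civita connection `∇` of `g`, by the Koszul formula. -/
def nablaInner (g : LorentzianMetric M) (X Y Z : CVectorField M) : M → ℂ :=
  (1 / 2 : ℂ) • (X.deriv (g.inner Y Z) + Y.deriv (g.inner X Z) - Z.deriv (g.inner X Y)
    + g.inner (X.bracket Y) Z - g.inner (X.bracket Z) Y - g.inner (Y.bracket Z) X)

end LorentzianMetric

/-! ### Spin dyads -/

/-- The dyad components of the spin metric, `ε₀₁ = 1 = -ε₁₀`. These are numerically the components
of all of `ε_{AB}`, `ε^{AB}`, `ε_{A'B'}`, `ε^{A'B'}`. Indices are raised and lowered by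
`ψ^A = ε^{AB} ψ_B` and `ψ_B = ψ^A ε_{AB}`. -/
def eps (A B : Fin 2) : ℂ := (!![0, 1; -1, 0] : Matrix (Fin 2) (Fin 2) ℂ) A B

/-- A spin dyad `(o^A, ι^A)`, given by its null tetrad `l = o ō`, `n = ι ῑ`, `m = o ῑ`
(`l`, `n` real vector fields, `m` a complex one, `m̄ = ι ō`). The dyad trivialises the spin bundle
`S`: spinor fields are represented by their dyad components, the dyad index `0` standing for `o`
and `1` for `ι`, and likewise for the complex conjugate bundle `S'` with its dyad `(ō, ῑ)`. -/
structure SpinDyad (M : Type*) [TopologicalSpace M]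
    [ChartedSpace (EuclideanSpace ℝ (Fin 4)) M] where
  l : ∀ x : M, TangentSpace (𝓡 4) x
  n : ∀ x : M, TangentSpace (𝓡 4) x
  m : CVectorField M

namespace SpinDyad

/-- The tetrad vector `e_{AA'}`, the image of the basis element `A ⊗ A'` of `S ⊗ S'` under the
isomorphism of `S ⊗ S'` with the complexified tangent bundle:
`e₀₀ = l`, `e₀₁ = m`, `e₁₀ = m̄`, `e₁₁ = n`. -/
def leg (D : SpinDyad M) (A A' : Fin 2) : CVectorField M :=
  (!![CVectorField.ofReal D.l, D.m; D.m.conj, CVectorField.ofReal D.n] :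
    Matrix (Fin 2) (Fin 2) (CVectorField M)) A A'

/-- The dyad is smooth on `U` and normalised there by `o_A ι^A = 1`. Since `g_{ab} = ε_{AB} ε_{A'B'}`
the latter says `g(l,n) = 1`, `g(m,m̄) = -1`, all other products of tetrad vectors being zero. -/
structure IsNormalizedOn (D : SpinDyad M) (g : LorentzianMetric M) (U : Set M) : Prop where
  contMDiffOn_l : ContMDiffOn (𝓡 4) (𝓡 4).tangent ∞
    (fun x => (⟨x, D.l x⟩ : TangentBundle (𝓡 4) M)) U
  contMDiffOn_n : ContMDiffOn (𝓡 4) (𝓡 4).tangent ∞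
    (fun x => (⟨x, D.n x⟩ : TangentBundle (𝓡 4) M)) U
  contMDiffOn_m_re : ContMDiffOn (𝓡 4) (𝓡 4).tangent ∞
    (fun x => (⟨x, D.m.re x⟩ : TangentBundle (𝓡 4) M)) U
  contMDiffOn_m_im : ContMDiffOn (𝓡 4) (𝓡 4).tangent ∞
    (fun x => (⟨x, D.m.im x⟩ : TangentBundle (𝓡 4) M)) U
  inner_leg : ∀ x ∈ U, ∀ A A' B B' : Fin 2,
    g.inner (D.leg A A') (D.leg B B') x = eps A B * eps A' B'

variable (D : SpinDyad M) (g : LorentzianMetric M)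

/-! ### Levi-Civita connection, spin connection and curvature in the dyad -/

/-- Components `ω_{AA' BB'}{}^{CC'}` of the Levi-Civita connection in the tetrad:
`∇_{e_{AA'}} e_{BB'} = ω_{AA' BB'}{}^{CC'} e_{CC'}`. -/
def omega (A A' B B' C C' : Fin 2) : M → ℂ :=
  ∑ E : Fin 2, ∑ E' : Fin 2,
    (eps C E * eps C' E') • g.nablaInner (D.leg A A') (D.leg B B') (D.leg E E')

/-- Structure functions of the tetrad, `[e_{AA'}, e_{BB'}] = c_{AA' BB'}{}^{CC'} e_{CC'}`. -/
def structureFun (A A' B B' C C' : Fin 2) : M → ℂ :=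
  ∑ E : Fin 2, ∑ E' : Fin 2,
    (eps C E * eps C' E') • g.inner ((D.leg A A').bracket (D.leg B B')) (D.leg E E')

/-- Components `Γ_{AA' B}{}^C` of the spin connection on `S`: with `ε_0 = o`, `ε_1 = ι`,
`∇_{AA'} ε_B = Γ_{AA' B}{}^C ε_C`. It is the connection on `S` that annihilates `ε_{AB}` (so that
`Γ_{AA' B}{}^B = 0`) and, together with its complex conjugate on `S'`, induces the Levi-Civita
connection on `S ⊗ S'`:
`ω_{AA' BB'}{}^{CC'} = Γ_{AA' B}{}^C δ_{B'}{}^{C'} + δ_B{}^C Γ̄_{AA' B'}{}^{C'}`.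
Taking the trace over the primed pair gives the formula below. -/
def Gam (A A' B C : Fin 2) : M → ℂ :=
  (1 / 2 : ℂ) • ∑ B' : Fin 2, D.omega g A A' B B' C B'

/-- Components `Γ̄_{AA' B'}{}^{C'}` of the complex conjugate connection on `S'`,
`∇_X ψ̄ = conj (∇_{X̄} ψ)`; conjugation interchanges the two indices of `e_{AA'}`. -/
def Gam' (A A' B' C' : Fin 2) : M → ℂ := star (D.Gam g A' A B' C')

/-- Riemann tensor `R_{abc}{}^d`, with the convention
`(∇_a ∇_b - ∇_b ∇_a) V^d = R_{abc}{}^d V^c`, in tetrad components with `a = AA'` etc. -/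
def riemann (A A' B B' C C' E E' : Fin 2) : M → ℂ :=
  (D.leg A A').deriv (D.omega g B B' C C' E E') - (D.leg B B').deriv (D.omega g A A' C C' E E')
    + ∑ F : Fin 2, ∑ F' : Fin 2,
      (D.omega g B B' C C' F F' * D.omega g A A' F F' E E'
        - D.omega g A A' C C' F F' * D.omega g B B' F F' E E'
        - D.structureFun g A A' B B' F F' * D.omega g F F' C C' E E')

/-- The Riemann tensor with all indices lowered, `R_{abcd} = R_{abc}{}^e g_{ed}`. -/
def riemannLow (A A' B B' C C' E E' : Fin 2) : M → ℂ :=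
  ∑ F : Fin 2, ∑ F' : Fin 2, (eps F E * eps F' E') • D.riemann g A A' B B' C C' F F'

/-- Ricci tensor `R_{ac} = R_{abc}{}^b`. -/
def ricci (A A' C C' : Fin 2) : M → ℂ :=
  ∑ B : Fin 2, ∑ B' : Fin 2, D.riemann g A A' B B' C C' B B'

/-- Scalar curvature `R = g^{ac} R_{ac}`. -/
def scalarCurv : M → ℂ :=
  ∑ A : Fin 2, ∑ A' : Fin 2, ∑ C : Fin 2, ∑ C' : Fin 2,
    (eps A C * eps A' C') • D.ricci g A A' C C'

/-- The trace-free Ricci spinor `Φ_{ab} = -½ (R_{ab} - ¼ R g_{ab})`. -/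
def PhiRicci (A A' C C' : Fin 2) : M → ℂ :=
  (-(1 / 2) : ℂ) • (D.ricci g A A' C C' - ((1 / 4 : ℂ) * (eps A C * eps A' C')) • D.scalarCurv g)

/-- The metric is Einstein on `U` with constant `Λ`: the trace-free Ricci spinor vanishes and
`R = 24 Λ` (the cosmological constant is `6 Λ`). -/
def IsEinsteinOn (U : Set M) (Lam : ℝ) : Prop :=
  ∀ x ∈ U, (∀ A A' C C' : Fin 2, D.PhiRicci g A A' C C' x = 0) ∧
    D.scalarCurv g x = 24 * (Lam : ℂ)

end SpinDyad

/-- Total symmetrisation over four spinor indices. -/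
def symm4 (T : (Fin 4 → Fin 2) → M → ℂ) (k : Fin 4 → Fin 2) : M → ℂ :=
  (1 / 24 : ℂ) • ∑ s : Equiv.Perm (Fin 4), T (fun i => k (s i))

/-- The four dyad indices with `i` entries `1` and `4 - i` entries `0`; for a totally symmetric
spinor `T_{ABCD}` this gives the component `T_i`. -/
def dyadIdx (i : ℕ) : Fin 4 → Fin 2 := fun j => if (j : ℕ) < i then 1 else 0

namespace SpinDyad

variable (D : SpinDyad M) (g : LorentzianMetric M)

/-- The (anti-self-dual) Weyl spinor `Ψ_{ABCD}`, the total symmetrisation of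
`¼ R_{AX'B}{}^{X'}{}_{CY'D}{}^{Y'}`. -/
def weyl : (Fin 4 → Fin 2) → M → ℂ :=
  symm4 fun k => (1 / 4 : ℂ) •
    ∑ X' : Fin 2, ∑ Z' : Fin 2, ∑ Y' : Fin 2, ∑ W' : Fin 2,
      (eps X' Z' * eps Y' W') • D.riemannLow g (k 0) X' (k 1) Z' (k 2) Y' (k 3) W'

/-- The Weyl scalars `Ψ_i`, `i = 0, …, 4`. -/
def Psi (i : ℕ) : M → ℂ := D.weyl g (dyadIdx i)

/-- `o^A` is a repeated principal spinor on `U` and the Petrov type there is II (or its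
specialisation D). -/
def IsTypeIIOn (U : Set M) : Prop :=
  ∀ x ∈ U, D.Psi g 0 x = 0 ∧ D.Psi g 1 x = 0 ∧ D.Psi g 2 x ≠ 0

/-! ### GHP formalism -/

/-- Spin coefficient `ρ = o^A ð' o_A` (derivative along `m̄`). -/
def rho : M → ℂ := -D.Gam g 1 0 0 1

/-- Spin coefficient `τ = o^A þ' o_A` (derivative along `n`). -/
def tau : M → ℂ := -D.Gam g 1 1 0 1

/-- Spin coefficient `ρ' = -ι^A ð ι_A` (derivative along `m`). -/
def rho' : M → ℂ := -D.Gam g 0 1 1 0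

/-- Spin coefficient `τ' = -ι^A þ ι_A` (derivative along `l`). -/
def tau' : M → ℂ := -D.Gam g 0 0 1 0

/-- Spin coefficient `σ' = -ι^A ð' ι_A` (derivative along `m̄`). -/
def sigma' : M → ℂ := -D.Gam g 1 0 1 0

/-- The GHP covariant derivative `Θ_{AA'}` on scalars of weight `{p,q}`, which scale as
`η ↦ λ^p λ̄^q η` under `(o, ι) ↦ (λ o, λ⁻¹ ι)`:
`Θ_a η = ∇_a η - p (ι^B ∇_a o_B) η - q (ῑ^{B'} ∇_a ō_{B'}) η`. -/
def Theta (A A' : Fin 2) (p q : ℤ) (f : M → ℂ) : M → ℂ :=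
  (D.leg A A').deriv f - ((p : ℂ) • D.Gam g A A' 0 0 + (q : ℂ) • D.Gam' g A A' 0 0) * f

/-- `þ = l^a Θ_a` on weight `{p,q}`; the result has weight `{p+1,q+1}`. -/
def tho (p q : ℤ) (f : M → ℂ) : M → ℂ := D.Theta g 0 0 p q f

/-- `ð = m^a Θ_a` on weight `{p,q}`; the result has weight `{p+1,q-1}`. -/
def edt (p q : ℤ) (f : M → ℂ) : M → ℂ := D.Theta g 0 1 p q f

/-- `ð' = m̄^a Θ_a` on weight `{p,q}`; the result has weight `{p-1,q+1}`. -/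
def edt' (p q : ℤ) (f : M → ℂ) : M → ℂ := D.Theta g 1 0 p q f

/-- `þ' = n^a Θ_a` on weight `{p,q}`; the result has weight `{p-1,q-1}`. -/
def tho' (p q : ℤ) (f : M → ℂ) : M → ℂ := D.Theta g 1 1 p q f

/-- `O†χ = 2[(þ' - ρ̄')(þ + 3ρ) - (ð' - τ̄)(ð + 3τ) - 3Ψ₂]χ` for `χ` of weight `{-4,0}`; the result
has weight `{-4,0}`. -/
def Odag (χ : M → ℂ) : M → ℂ :=
  let u := D.tho g (-4) 0 χ + 3 * D.rho g * χ
  let v := D.edt g (-4) 0 χ + 3 * D.tau g * χ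
  2 * ((D.tho' g (-3) 1 u - star (D.rho' g) * u)
    - (D.edt' g (-3) (-1) v - star (D.tau g) * v) - 3 * D.Psi g 2 * χ)

/-! ### Spinor fields and their covariant derivative -/

/-- Dyad components of a spinor field `T_{B₁…B_r B'₁…B'_s}`. Since a vector index `a` is a pair
`AA'`, tensors are spinor fields with `r = s`. -/
abbrev SpinorField (M : Type*) (r s : ℕ) := (Fin r → Fin 2) → (Fin s → Fin 2) → M → ℂ

/-- The covariant derivative `∇_{AA'} T_{B₁…B_r B'₁…B'_s}`; the indices `A`, `A'` of the derivative
come first in the two lists. -/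
def nabla {r s : ℕ} (T : SpinorField M r s) : SpinorField M (r + 1) (s + 1) := fun K K' =>
  let A := K 0
  let A' := K' 0
  let B := Fin.tail K
  let B' := Fin.tail K'
  (D.leg A A').deriv (T B B')
    - (∑ i : Fin r, ∑ C : Fin 2, D.Gam g A A' (B i) C * T (Function.update B i C) B')
    - (∑ i : Fin s, ∑ C' : Fin 2, D.Gam' g A A' (B' i) C' * T B (Function.update B' i C'))

/-- Components `o_A` of the lowered spinor: `o_B = o^A ε_{AB}`. -/
def oLow (A : Fin 2) : ℂ := eps 0 A

/-- Components `ι_A` of the lowered spinor: `ι_B = ι^A ε_{AB}`. -/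
def iotaLow (A : Fin 2) : ℂ := eps 1 A

/-! ### The metric perturbation generated by a potential and its curvature -/

/-- `h_{nn} = -(ð + 2τ)ðχ - σ̄'þχ`. -/
def hnn (χ : M → ℂ) : M → ℂ :=
  -(D.edt g (-3) (-1) (D.edt g (-4) 0 χ) + 2 * D.tau g * D.edt g (-4) 0 χ)
    - star (D.sigma' g) * D.tho g (-4) 0 χ

/-- `h_{nm̄} = -(þ + ρ)ðχ - (τ + τ̄')þχ`. -/
def hnmb (χ : M → ℂ) : M → ℂ :=
  -(D.tho g (-3) (-1) (D.edt g (-4) 0 χ) + D.rho g * D.edt g (-4) 0 χ)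
    - (D.tau g + star (D.tau' g)) * D.tho g (-4) 0 χ

/-- `h_{m̄m̄} = -(þ + 2ρ)þχ`. -/
def hmbmb (χ : M → ℂ) : M → ℂ :=
  -(D.tho g (-3) 1 (D.tho g (-4) 0 χ) + 2 * D.rho g * D.tho g (-4) 0 χ)

/-- The complex metric perturbation
`h_{ab} = S†(χ)_{ab} = h_{nn} l_a l_b - 2 h_{nm̄} l_{(a} m_{b)} + h_{m̄m̄} m_a m_b` as the spinor field
`h_{CD C'D'}` with `a = CC'`, `b = DD'`. -/
def hDebye (χ : M → ℂ) : SpinorField M 2 2 := fun K K' =>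
  let l : Fin 2 → ℂ := fun i => oLow (K i) * oLow (K' i)
  let m : Fin 2 → ℂ := fun i => oLow (K i) * iotaLow (K' i)
  (l 0 * l 1) • D.hnn g χ - (l 0 * m 1 + m 0 * l 1) • D.hnmb g χ + (m 0 * m 1) • D.hmbmb g χ

/-- The trace `g^{ef} h_{ef}`. -/
def trace (h : SpinorField M 2 2) : M → ℂ :=
  ∑ A : Fin 2, ∑ A' : Fin 2, ∑ B : Fin 2, ∑ B' : Fin 2,
    (eps A B * eps A' B') • h ![A, B] ![A', B']

/-- The anti-self-dual linearized Weyl spinor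
`Ψ̇_{ABCD} = ½ ∇_{(A}{}^{A'} ∇_B{}^{B'} h_{CD)A'B'} + ¼ g^{ef} h_{ef} Ψ_{ABCD}`. -/
def linWeyl (h : SpinorField M 2 2) (k : Fin 4 → Fin 2) : M → ℂ :=
  (1 / 2 : ℂ) • symm4 (fun k =>
      ∑ A' : Fin 2, ∑ X' : Fin 2, ∑ B' : Fin 2, ∑ Y' : Fin 2,
        (eps A' X' * eps B' Y') • D.nabla g (D.nabla g h) k ![X', Y', A', B']) k
    + (1 / 4 : ℂ) • (trace h * D.weyl g k)

/-- The dyad components `Ψ̇_i`, `i = 0, …, 4`, of the linearized Weyl spinor of `h = S†(χ)`. -/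
def dotPsi (χ : M → ℂ) (i : ℕ) : M → ℂ := D.linWeyl g (D.hDebye g χ) (dyadIdx i)

/-! ### The projected Killing vector -/

/-- `K_{AB} = Ψ₂^{-1/3} o_{(A} ι_{B)} - ⅓ Ψ₂^{-4/3} Ψ₃ o_A o_B`, where `φ = Ψ₂^{1/3}`. -/
def killingSpinor (φ : M → ℂ) : SpinorField M 2 0 := fun K _ =>
  ((1 / 2 : ℂ) * (oLow (K 0) * iotaLow (K 1) + oLow (K 1) * iotaLow (K 0))) • φ⁻¹
    - ((1 / 3 : ℂ) * (oLow (K 0) * oLow (K 1))) • ((φ ^ 4)⁻¹ * D.Psi g 3)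

/-- `ξ_{AA'} = ∇^B{}_{A'} K_{AB}`. -/
def xi (φ : M → ℂ) (A A' : Fin 2) : M → ℂ :=
  ∑ B : Fin 2, ∑ X : Fin 2, eps B X • D.nabla g (D.killingSpinor g φ) ![X, A, B] ![A']

/-- `ξ^a Θ_a χ` for `χ` of weight `{-4,0}`. -/
def xiTheta (φ χ : M → ℂ) : M → ℂ :=
  ∑ A : Fin 2, ∑ A' : Fin 2, ∑ B : Fin 2, ∑ B' : Fin 2,
    (eps A B * eps A' B') • (D.xi g φ A A' * D.Theta g B B' (-4) 0 χ)

end SpinDyad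

end Geometry

end Debye

end

noncomputable section

namespace Debye

/-! ### Smooth vector fields and functions on an open set -/

section Smooth

variable {M : Type*} [TopologicalSpace M] [ChartedSpace (EuclideanSpace ℝ (Fin 4)) M]

/-- A real function is smooth on `U`. -/
abbrev SmoothRealOn (U : Set M) (f : M → ℝ) : Prop := ContMDiffOn (𝓡 4) 𝓘(ℝ, ℝ) ∞ f U

/-- A complex function is smooth on `U`. -/
abbrev SmoothOn (U : Set M) (f : M → ℂ) : Prop := ContMDiffOn (𝓡 4) 𝓘(ℝ, ℂ) ∞ f U

/-- A (rough) real vector field is smooth on `U`. -/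
abbrev SmoothVecOn [IsManifold (𝓡 4) ∞ M] (U : Set M) (V : ∀ x : M, TangentSpace (𝓡 4) x) : Prop :=
  ContMDiffOn (𝓡 4) (𝓡 4).tangent ∞ (fun x => (⟨x, V x⟩ : TangentBundle (𝓡 4) M)) U

variable {U : Set M}

lemma SmoothOn.re {f : M → ℂ} (hf : SmoothOn U f) : SmoothRealOn U (fun x => (f x).re) :=
  Complex.reCLM.contDiff.contMDiff.comp_contMDiffOn hf

lemma SmoothOn.im {f : M → ℂ} (hf : SmoothOn U f) : SmoothRealOn U (fun x => (f x).im) :=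
  Complex.imCLM.contDiff.contMDiff.comp_contMDiffOn hf

lemma SmoothRealOn.ofReal {f : M → ℝ} (hf : SmoothRealOn U f) :
    SmoothOn U (fun x => (f x : ℂ)) :=
  Complex.ofRealCLM.contDiff.contMDiff.comp_contMDiffOn hf

lemma SmoothOn.conj {f : M → ℂ} (hf : SmoothOn U f) : SmoothOn U (star f) :=
  Complex.conjCLE.contDiff.contMDiff.comp_contMDiffOn hf

lemma SmoothOn.add' {f g : M → ℂ} (hf : SmoothOn U f) (hg : SmoothOn U g) : SmoothOn U (f + g) :=
  ContMDiffOn.add hf hg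

lemma SmoothOn.mul' {f g : M → ℂ} (hf : SmoothOn U f) (hg : SmoothOn U g) : SmoothOn U (f * g) :=
  (contDiff_mul (𝕜 := ℝ) (𝔸 := ℂ)).contMDiff.comp_contMDiffOn (hf.prodMk_space hg)

lemma smoothOn_const (c : ℂ) : SmoothOn U (fun _ => c) := contMDiffOn_const

lemma SmoothOn.mdifferentiableAt {f : M → ℂ} (hf : SmoothOn U f) (hU : IsOpen U) {x : M}
    (hx : x ∈ U) : MDifferentiableAt (𝓡 4) 𝓘(ℝ, ℂ) f x :=
  (hf.contMDiffAt (hU.mem_nhds hx)).mdifferentiableAt (by simp)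

lemma SmoothRealOn.mdifferentiableAt {f : M → ℝ} (hf : SmoothRealOn U f) (hU : IsOpen U) {x : M}
    (hx : x ∈ U) : MDifferentiableAt (𝓡 4) 𝓘(ℝ, ℝ) f x :=
  (hf.contMDiffAt (hU.mem_nhds hx)).mdifferentiableAt (by simp)

lemma mvfderiv_clm_comp {F G : Type*} [NormedAddCommGroup F] [NormedSpace ℝ F]
    [NormedAddCommGroup G] [NormedSpace ℝ G] (L : F →L[ℝ] G) {f : M → F} {x : M}
    (hf : MDifferentiableAt (𝓡 4) 𝓘(ℝ, F) f x) (v : TangentSpace (𝓡 4) x) :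
    mvfderiv (𝓡 4) (fun y => L (f y)) x v = L (mvfderiv (𝓡 4) f x v) := by
  have h := mfderiv_comp_apply (I := 𝓡 4) (I' := 𝓘(ℝ, F)) (I'' := 𝓘(ℝ, G)) x
    (g := L) (f := f) L.differentiableAt.mdifferentiableAt hf v
  rw [mfderiv_eq_fderiv, L.fderiv] at h
  exact h

lemma mvfderiv_re {f : M → ℂ} {x : M} (hf : MDifferentiableAt (𝓡 4) 𝓘(ℝ, ℂ) f x)
    (v : TangentSpace (𝓡 4) x) :
    mvfderiv (𝓡 4) (fun y => (f y).re) x v = (mvfderiv (𝓡 4) f x v).re :=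
  mvfderiv_clm_comp Complex.reCLM hf v

lemma mvfderiv_im {f : M → ℂ} {x : M} (hf : MDifferentiableAt (𝓡 4) 𝓘(ℝ, ℂ) f x)
    (v : TangentSpace (𝓡 4) x) :
    mvfderiv (𝓡 4) (fun y => (f y).im) x v = (mvfderiv (𝓡 4) f x v).im :=
  mvfderiv_clm_comp Complex.imCLM hf v

lemma mvfderiv_star {f : M → ℂ} {x : M} (hf : MDifferentiableAt (𝓡 4) 𝓘(ℝ, ℂ) f x)
    (v : TangentSpace (𝓡 4) x) :
    mvfderiv (𝓡 4) (star f) x v = star (mvfderiv (𝓡 4) f x v) :=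
  mvfderiv_clm_comp (Complex.conjCLE : ℂ →L[ℝ] ℂ) hf v

lemma mvfderiv_congr_of_eqOn {F : Type*} [NormedAddCommGroup F] [NormedSpace ℝ F]
    {f g : M → F} (hU : IsOpen U) (h : Set.EqOn f g U) {x : M} (hx : x ∈ U)
    (v : TangentSpace (𝓡 4) x) :
    mvfderiv (𝓡 4) f x v = mvfderiv (𝓡 4) g x v := by
  have h1 : f =ᶠ[nhds x] g := h.eventuallyEq_of_mem (hU.mem_nhds hx)
  have := h1.mfderiv_eq (I := 𝓡 4) (I' := 𝓘(ℝ, F))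
  exact congrArg (fun L => L v) this

lemma mvfderiv_mul_complex {f g : M → ℂ} {x : M} (hf : MDifferentiableAt (𝓡 4) 𝓘(ℝ, ℂ) f x)
    (hg : MDifferentiableAt (𝓡 4) 𝓘(ℝ, ℂ) g x) (v : TangentSpace (𝓡 4) x) :
    mvfderiv (𝓡 4) (f * g) x v = f x * mvfderiv (𝓡 4) g x v + g x * mvfderiv (𝓡 4) f x v := by
  have h := (hf.hasMFDerivAt.mul' hg.hasMFDerivAt).mfderiv
  have h2 := congrArg (fun L => L v) h
  refine h2.trans ?_
  change f x * mvfderiv (𝓡 4) g x v + mvfderiv (𝓡 4) f x v * g x = _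
  ring

lemma minSmoothness_natCast_le (n : ℕ) : minSmoothness ℝ n ≤ ∞ := by
  simpa using mod_cast le_top

variable [IsManifold (𝓡 4) ∞ M]

lemma isManifold_minSmoothness (n : ℕ) : IsManifold (𝓡 4) (minSmoothness ℝ n) M :=
  IsManifold.of_le (n := ∞) (minSmoothness_natCast_le n)

instance : IsManifold (𝓡 4) (minSmoothness ℝ 2) M := isManifold_minSmoothness 2

instance : IsManifold (𝓡 4) (minSmoothness ℝ 3) M := isManifold_minSmoothness 3

lemma SmoothVecOn.mlieBracket {V W : ∀ x : M, TangentSpace (𝓡 4) x} (hU : IsOpen U)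
    (hV : SmoothVecOn U V) (hW : SmoothVecOn U W) :
    SmoothVecOn U (VectorField.mlieBracket (𝓡 4) V W) := by
  intro x hx
  have hV' := hV.contMDiffAt (hU.mem_nhds hx)
  have hW' := hW.contMDiffAt (hU.mem_nhds hx)
  have : IsManifold (𝓡 4) (((⊤ : ℕ∞) : ℕ∞ω) + 1) M := by simpa using ‹IsManifold (𝓡 4) ∞ M›
  exact (ContMDiffAt.mlieBracket_vectorField (m := ⊤) (n := ⊤) hV' hW' (by simp)).contMDiffWithinAt

lemma SmoothVecOn.smul {V : ∀ x : M, TangentSpace (𝓡 4) x} {f : M → ℝ}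
    (hf : SmoothRealOn U f) (hV : SmoothVecOn U V) : SmoothVecOn U (f • V) := by
  exact ContMDiffOn.smul_section hf hV

lemma LorentzianMetric.smooth_val (g : LorentzianMetric M) {V W : ∀ x : M, TangentSpace (𝓡 4) x}
    (hV : SmoothVecOn U V) (hW : SmoothVecOn U W) :
    SmoothRealOn U (fun x => g.val x (V x) (W x)) := by
  have h := ContMDiffOn.clm_bundle_apply₂ (F₁ := EuclideanSpace ℝ (Fin 4))
    (F₂ := EuclideanSpace ℝ (Fin 4)) (F₃ := ℝ) (E₁ := fun x : M => TangentSpace (𝓡 4) x)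
    (E₂ := fun x : M => TangentSpace (𝓡 4) x) (E₃ := Bundle.Trivial M ℝ) (b := fun x : M => x)
    (ψ := fun x => g.val x) (g.contMDiff.contMDiffOn (s := U)) hV hW
  intro x hx
  exact ((Bundle.contMDiffWithinAt_totalSpace).1 (h x hx)).2

lemma SmoothVecOn.mdifferentiableAt {V : ∀ x : M, TangentSpace (𝓡 4) x} (hV : SmoothVecOn U V)
    (hU : IsOpen U) {x : M} (hx : x ∈ U) :
    MDifferentiableAt (𝓡 4) (𝓡 4).tangent (fun x => (⟨x, V x⟩ : TangentBundle (𝓡 4) M)) x :=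
  (hV.contMDiffAt (hU.mem_nhds hx)).mdifferentiableAt (by simp)

lemma mlieBracket_smul_on {V W : ∀ x : M, TangentSpace (𝓡 4) x} {f : M → ℝ} (hU : IsOpen U)
    (hf : SmoothRealOn U f) (hW : SmoothVecOn U W) {x : M} (hx : x ∈ U) :
    VectorField.mlieBracket (𝓡 4) V (f • W) x =
      mvfderiv (𝓡 4) f x (V x) • W x + f x • VectorField.mlieBracket (𝓡 4) V W x :=
  VectorField.mlieBracket_smul_right (hf.mdifferentiableAt hU hx) (hW.mdifferentiableAt hU hx)

/-- The derivative of a smooth function along a smooth vector field is smooth. -/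
lemma SmoothRealOn.mvfderiv_apply (g : LorentzianMetric M) {Z W : ∀ x : M, TangentSpace (𝓡 4) x}
    (hU : IsOpen U) (hZ : SmoothVecOn U Z) (hW : SmoothVecOn U W)
    (hZW : ∀ x ∈ U, g.val x (Z x) (W x) = 1) {V : ∀ x : M, TangentSpace (𝓡 4) x} {f : M → ℝ}
    (hf : SmoothRealOn U f) (hV : SmoothVecOn U V) :
    SmoothRealOn U (fun x => mvfderiv (𝓡 4) f x (V x)) := by
  have h1 := g.smooth_val ((hV.mlieBracket hU (hZ.smul hf))) hW
  have h2 := g.smooth_val ((hV.mlieBracket hU hZ)) hW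
  have h3 : SmoothRealOn U (fun x => g.val x (VectorField.mlieBracket (𝓡 4) V (f • Z) x) (W x)
      - f x * g.val x (VectorField.mlieBracket (𝓡 4) V Z x) (W x)) := h1.sub (hf.mul h2)
  refine h3.congr fun x hx => ?_
  rw [mlieBracket_smul_on hU hf hZ hx]
  simp [hZW x hx]

/-- Smooth vector fields act on functions compatibly with the Lie bracket. -/
lemma mvfderiv_mlieBracket (g : LorentzianMetric M) {Z W : ∀ x : M, TangentSpace (𝓡 4) x}
    (hU : IsOpen U) (hZ : SmoothVecOn U Z) (hW : SmoothVecOn U W)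
    (hZW : ∀ x ∈ U, g.val x (Z x) (W x) = 1) {X Y : ∀ x : M, TangentSpace (𝓡 4) x} {f : M → ℝ}
    (hf : SmoothRealOn U f) (hX : SmoothVecOn U X) (hY : SmoothVecOn U Y) {x : M} (hx : x ∈ U) :
    mvfderiv (𝓡 4) f x (VectorField.mlieBracket (𝓡 4) X Y x) =
      mvfderiv (𝓡 4) (fun y => mvfderiv (𝓡 4) f y (Y y)) x (X x)
        - mvfderiv (𝓡 4) (fun y => mvfderiv (𝓡 4) f y (X y)) x (Y x) := by
  have key : ∀ {X Y : ∀ x : M, TangentSpace (𝓡 4) x}, SmoothVecOn U X → SmoothVecOn U Y →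
      VectorField.mlieBracket (𝓡 4) X (VectorField.mlieBracket (𝓡 4) Y (f • Z)) x =
        mvfderiv (𝓡 4) (fun y => mvfderiv (𝓡 4) f y (Y y)) x (X x) • Z x
          + mvfderiv (𝓡 4) f x (Y x) • VectorField.mlieBracket (𝓡 4) X Z x
          + (mvfderiv (𝓡 4) f x (X x) • VectorField.mlieBracket (𝓡 4) Y Z x
          + f x • VectorField.mlieBracket (𝓡 4) X (VectorField.mlieBracket (𝓡 4) Y Z) x) := by
    intro X Y hX hY
    have hYf := hf.mvfderiv_apply g hU hZ hW hZW hY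
    have hev : VectorField.mlieBracket (𝓡 4) Y (f • Z) =ᶠ[nhds x]
        (((fun y => mvfderiv (𝓡 4) f y (Y y)) • Z : ∀ x : M, TangentSpace (𝓡 4) x)
          + (f • VectorField.mlieBracket (𝓡 4) Y Z : ∀ x : M, TangentSpace (𝓡 4) x)) := by
      filter_upwards [hU.mem_nhds hx] with y hy
      exact mlieBracket_smul_on hU hf hZ hy
    rw [Filter.EventuallyEq.mlieBracket_vectorField_eq (Filter.EventuallyEq.refl _ X) hev,
      VectorField.mlieBracket_add_right ((hZ.smul hYf).mdifferentiableAt hU hx)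
        (((hY.mlieBracket hU hZ).smul hf).mdifferentiableAt hU hx),
      mlieBracket_smul_on hU hYf hZ hx, mlieBracket_smul_on hU hf (hY.mlieBracket hU hZ) hx]
  have two : minSmoothness ℝ 2 ≤ ∞ := minSmoothness_natCast_le 2
  have at2 : ∀ {X : ∀ x : M, TangentSpace (𝓡 4) x}, SmoothVecOn U X →
      ContMDiffAt (𝓡 4) (𝓡 4).tangent (minSmoothness ℝ 2)
        (fun x => (⟨x, X x⟩ : TangentBundle (𝓡 4) M)) x :=
    fun h => (h.contMDiffAt (hU.mem_nhds hx)).of_le two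
  have J1 := VectorField.leibniz_identity_mlieBracket_apply (at2 hX) (at2 hY) (at2 (hZ.smul hf))
  have J2 := VectorField.leibniz_identity_mlieBracket_apply (at2 hX) (at2 hY) (at2 hZ)
  rw [key hX hY, key hY hX, mlieBracket_smul_on hU hf hZ hx, J2] at J1
  have J3 := congrArg (fun v => g.val x v (W x)) J1
  simp only [map_add, map_smul, add_apply, smul_apply,
    smul_eq_mul, hZW x hx] at J3
  linarith

end Smooth

section Complex

variable {M : Type*} [TopologicalSpace M] [ChartedSpace (EuclideanSpace ℝ (Fin 4)) M]
  {U : Set M}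

namespace CVectorField

lemma deriv_congr {f g : M → ℂ} (X : CVectorField M) (hU : IsOpen U) (h : Set.EqOn f g U) {x : M}
    (hx : x ∈ U) : X.deriv f x = X.deriv g x := by
  simp only [deriv, mvfderiv_congr_of_eqOn hU h hx]

lemma deriv_add {f g : M → ℂ} (X : CVectorField M) (hU : IsOpen U) (hf : SmoothOn U f)
    (hg : SmoothOn U g) {x : M} (hx : x ∈ U) :
    X.deriv (f + g) x = X.deriv f x + X.deriv g x := by
  simp only [deriv, mvfderiv_add (hf.mdifferentiableAt hU hx) (hg.mdifferentiableAt hU hx),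
    add_apply]
  ring

lemma deriv_mul {f g : M → ℂ} (X : CVectorField M) (hU : IsOpen U) (hf : SmoothOn U f)
    (hg : SmoothOn U g) {x : M} (hx : x ∈ U) :
    X.deriv (f * g) x = f x * X.deriv g x + g x * X.deriv f x := by
  simp only [deriv, mvfderiv_mul_complex (hf.mdifferentiableAt hU hx)
    (hg.mdifferentiableAt hU hx)]
  ring

lemma deriv_const (X : CVectorField M) (c : ℂ) (x : M) : X.deriv (fun _ => c) x = 0 := by
  simp [deriv, mvfderiv_const]

lemma deriv_star {f : M → ℂ} (X : CVectorField M) (hU : IsOpen U) (hf : SmoothOn U f) {x : M}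
    (hx : x ∈ U) : star (X.deriv f x) = X.conj.deriv (star f) x := by
  simp only [deriv, conj, mvfderiv_star (hf.mdifferentiableAt hU hx), Pi.neg_apply, map_neg]
  simp

end CVectorField

lemma CVectorField.bracket_swap (X Y : CVectorField M) (x : M) :
    (X.bracket Y).re x = -(Y.bracket X).re x ∧ (X.bracket Y).im x = -(Y.bracket X).im x := by
  simp only [bracket, Pi.sub_apply, Pi.add_apply]
  rw [VectorField.mlieBracket_swap_apply (V := X.re) (W := Y.re),
    VectorField.mlieBracket_swap_apply (V := X.im) (W := Y.im),
    VectorField.mlieBracket_swap_apply (V := X.re) (W := Y.im),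
    VectorField.mlieBracket_swap_apply (V := X.im) (W := Y.re)]
  constructor <;> abel

lemma SpinDyad.leg_conj (D : SpinDyad M) (A A' : Fin 2) : (D.leg A A').conj = D.leg A' A := by
  fin_cases A <;> fin_cases A' <;> simp [leg, CVectorField.conj, CVectorField.ofReal]

variable [IsManifold (𝓡 4) ∞ M]

/-- A complex vector field is smooth on `U`. -/
structure SmoothCVecOn (U : Set M) (X : CVectorField M) : Prop where
  re : SmoothVecOn U X.re
  im : SmoothVecOn U X.im

lemma smoothVecOn_zero : SmoothVecOn U (0 : ∀ x : M, TangentSpace (𝓡 4) x) :=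
  (Bundle.contMDiff_zeroSection ℝ (fun x : M => TangentSpace (𝓡 4) x)).contMDiffOn

lemma SmoothCVecOn.ofReal {V : ∀ x : M, TangentSpace (𝓡 4) x} (hV : SmoothVecOn U V) :
    SmoothCVecOn U (CVectorField.ofReal V) := ⟨hV, smoothVecOn_zero⟩

lemma SmoothCVecOn.conj {X : CVectorField M} (hX : SmoothCVecOn U X) : SmoothCVecOn U X.conj :=
  ⟨hX.re, hX.im.neg_section⟩

lemma SmoothCVecOn.bracket {X Y : CVectorField M} (hU : IsOpen U) (hX : SmoothCVecOn U X)
    (hY : SmoothCVecOn U Y) : SmoothCVecOn U (X.bracket Y) :=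
  ⟨(hX.re.mlieBracket hU hY.re).sub_section (hX.im.mlieBracket hU hY.im),
    (hX.re.mlieBracket hU hY.im).add_section (hX.im.mlieBracket hU hY.re)⟩

lemma LorentzianMetric.smooth_inner (g : LorentzianMetric M) {X Y : CVectorField M}
    (hX : SmoothCVecOn U X) (hY : SmoothCVecOn U Y) : SmoothOn U (g.inner X Y) :=
  (SmoothRealOn.ofReal ((g.smooth_val hX.re hY.re).sub (g.smooth_val hX.im hY.im))).add' <|
    (smoothOn_const Complex.I).mul'
      (SmoothRealOn.ofReal ((g.smooth_val hX.re hY.im).add (g.smooth_val hX.im hY.re)))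

lemma LorentzianMetric.star_inner (g : LorentzianMetric M) (X Y : CVectorField M) (x : M) :
    star (g.inner X Y x) = g.inner X.conj Y.conj x := by
  simp [LorentzianMetric.inner, CVectorField.conj]
  ring

lemma CVectorField.bracket_conj {X Y : CVectorField M} (hU : IsOpen U) (hX : SmoothCVecOn U X)
    (hY : SmoothCVecOn U Y) {x : M} (hx : x ∈ U) :
    (X.conj.bracket Y.conj).re x = (X.bracket Y).conj.re x ∧
      (X.conj.bracket Y.conj).im x = (X.bracket Y).conj.im x := by
  have hl : ∀ {V W : ∀ x : M, TangentSpace (𝓡 4) x}, SmoothVecOn U V →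
      VectorField.mlieBracket (𝓡 4) (-V) W x = -VectorField.mlieBracket (𝓡 4) V W x := by
    intro V W hV
    simpa using VectorField.mlieBracket_const_smul_left (I := 𝓡 4) (c := (-1 : ℝ)) (W := W)
      (hV.mdifferentiableAt hU hx)
  have hr : ∀ {V W : ∀ x : M, TangentSpace (𝓡 4) x}, SmoothVecOn U W →
      VectorField.mlieBracket (𝓡 4) V (-W) x = -VectorField.mlieBracket (𝓡 4) V W x := by
    intro V W hW
    simpa using VectorField.mlieBracket_const_smul_right (I := 𝓡 4) (c := (-1 : ℝ)) (V := V)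
      (hW.mdifferentiableAt hU hx)
  simp only [bracket, conj, Pi.sub_apply, Pi.add_apply, Pi.neg_apply]
  rw [hl hX.im, hr hY.im, hr hY.im, hl hX.im]
  constructor
  · simp
  · abel

namespace SpinDyad

variable {D : SpinDyad M} {g : LorentzianMetric M}

namespace IsNormalizedOn

lemma smooth_leg (hD : D.IsNormalizedOn g U) (A A' : Fin 2) : SmoothCVecOn U (D.leg A A') := by
  have hm : SmoothCVecOn U D.m := ⟨hD.contMDiffOn_m_re, hD.contMDiffOn_m_im⟩
  fin_cases A <;> fin_cases A'
  · exact .ofReal hD.contMDiffOn_l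
  · exact hm
  · exact hm.conj
  · exact .ofReal hD.contMDiffOn_n

lemma val_l_n (hD : D.IsNormalizedOn g U) {x : M} (hx : x ∈ U) :
    g.val x (D.l x) (D.n x) = 1 := by
  have h := congrArg Complex.re (hD.inner_leg x hx 0 0 1 1)
  simpa [LorentzianMetric.inner, leg, CVectorField.ofReal, eps] using h

lemma smooth_deriv (hD : D.IsNormalizedOn g U) (hU : IsOpen U) {X : CVectorField M}
    (hX : SmoothCVecOn U X) {f : M → ℂ} (hf : SmoothOn U f) : SmoothOn U (X.deriv f) := by
  have h : ∀ {V : ∀ x : M, TangentSpace (𝓡 4) x}, SmoothVecOn U V →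
      SmoothOn U (fun x => mvfderiv (𝓡 4) f x (V x)) := by
    intro V hV
    have hr := hf.re.mvfderiv_apply g hU hD.contMDiffOn_l hD.contMDiffOn_n
      (fun x hx => hD.val_l_n hx) hV
    have hi := hf.im.mvfderiv_apply g hU hD.contMDiffOn_l hD.contMDiffOn_n
      (fun x hx => hD.val_l_n hx) hV
    refine (hr.ofReal.add' ((smoothOn_const Complex.I).mul' hi.ofReal)).congr fun x hx => ?_
    simp only [Pi.add_apply, Pi.mul_apply, mvfderiv_re (hf.mdifferentiableAt hU hx),
      mvfderiv_im (hf.mdifferentiableAt hU hx)]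
    rw [mul_comm, Complex.re_add_im]
  exact (h hX.re).add' ((smoothOn_const Complex.I).mul' (h hX.im))

lemma mvfderiv_bracket (hD : D.IsNormalizedOn g U) (hU : IsOpen U)
    {V W : ∀ x : M, TangentSpace (𝓡 4) x} (hV : SmoothVecOn U V) (hW : SmoothVecOn U W)
    {f : M → ℂ} (hf : SmoothOn U f) {x : M} (hx : x ∈ U) :
    mvfderiv (𝓡 4) f x (VectorField.mlieBracket (𝓡 4) V W x) =
      mvfderiv (𝓡 4) (fun y => mvfderiv (𝓡 4) f y (W y)) x (V x)
        - mvfderiv (𝓡 4) (fun y => mvfderiv (𝓡 4) f y (V y)) x (W x) := by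
  have hs : ∀ {V : ∀ x : M, TangentSpace (𝓡 4) x}, SmoothVecOn U V →
      SmoothOn U (fun x => mvfderiv (𝓡 4) f x (V x)) := by
    intro V hV
    refine (hD.smooth_deriv hU (.ofReal hV) hf).congr fun x hx => ?_
    simp [CVectorField.deriv, CVectorField.ofReal]
  have hre : ∀ V : ∀ x : M, TangentSpace (𝓡 4) x, Set.EqOn
      (fun y => mvfderiv (𝓡 4) (fun y => (f y).re) y (V y))
      (fun y => (mvfderiv (𝓡 4) f y (V y)).re) U :=
    fun V y hy => mvfderiv_re (hf.mdifferentiableAt hU hy) _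
  have him : ∀ V : ∀ x : M, TangentSpace (𝓡 4) x, Set.EqOn
      (fun y => mvfderiv (𝓡 4) (fun y => (f y).im) y (V y))
      (fun y => (mvfderiv (𝓡 4) f y (V y)).im) U :=
    fun V y hy => mvfderiv_im (hf.mdifferentiableAt hU hy) _
  apply Complex.ext
  · have h := mvfderiv_mlieBracket g hU hD.contMDiffOn_l hD.contMDiffOn_n
      (fun x hx => hD.val_l_n hx) hf.re hV hW hx
    rw [mvfderiv_re (hf.mdifferentiableAt hU hx), mvfderiv_congr_of_eqOn hU (hre _) hx,
      mvfderiv_congr_of_eqOn hU (hre _) hx, mvfderiv_re ((hs hV).mdifferentiableAt hU hx),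
      mvfderiv_re ((hs hW).mdifferentiableAt hU hx)] at h
    exact h
  · have h := mvfderiv_mlieBracket g hU hD.contMDiffOn_l hD.contMDiffOn_n
      (fun x hx => hD.val_l_n hx) hf.im hV hW hx
    rw [mvfderiv_im (hf.mdifferentiableAt hU hx), mvfderiv_congr_of_eqOn hU (him _) hx,
      mvfderiv_congr_of_eqOn hU (him _) hx, mvfderiv_im ((hs hV).mdifferentiableAt hU hx),
      mvfderiv_im ((hs hW).mdifferentiableAt hU hx)] at h
    exact h

lemma deriv_bracket (hD : D.IsNormalizedOn g U) (hU : IsOpen U) {X Y : CVectorField M}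
    (hX : SmoothCVecOn U X) (hY : SmoothCVecOn U Y) {f : M → ℂ} (hf : SmoothOn U f) {x : M}
    (hx : x ∈ U) :
    (X.bracket Y).deriv f x = X.deriv (Y.deriv f) x - Y.deriv (X.deriv f) x := by
  have hs : ∀ {V : ∀ x : M, TangentSpace (𝓡 4) x}, SmoothVecOn U V →
      SmoothOn U (fun x => mvfderiv (𝓡 4) f x (V x)) := by
    intro V hV
    refine (hD.smooth_deriv hU (.ofReal hV) hf).congr fun x hx => ?_
    simp [CVectorField.deriv, CVectorField.ofReal]
  have hexp : ∀ {Y : CVectorField M}, SmoothCVecOn U Y → ∀ v : TangentSpace (𝓡 4) x,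
      mvfderiv (𝓡 4) (Y.deriv f) x v = mvfderiv (𝓡 4) (fun y => mvfderiv (𝓡 4) f y (Y.re y)) x v
        + Complex.I * mvfderiv (𝓡 4) (fun y => mvfderiv (𝓡 4) f y (Y.im y)) x v := by
    intro Y hY v
    have e : Y.deriv f = (fun y => mvfderiv (𝓡 4) f y (Y.re y))
        + (fun _ => Complex.I) * (fun y => mvfderiv (𝓡 4) f y (Y.im y)) := rfl
    rw [e, mvfderiv_add ((hs hY.re).mdifferentiableAt hU hx)
      (((smoothOn_const Complex.I).mul' (hs hY.im)).mdifferentiableAt hU hx), add_apply,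
      mvfderiv_mul_complex ((smoothOn_const Complex.I).mdifferentiableAt hU hx)
      ((hs hY.im).mdifferentiableAt hU hx), mvfderiv_const]
    simp
  have e1 : ∀ Z : CVectorField M, ∀ h : M → ℂ,
      Z.deriv h x = mvfderiv (𝓡 4) h x (Z.re x) + Complex.I * mvfderiv (𝓡 4) h x (Z.im x) :=
    fun _ _ => rfl
  rw [e1 (X.bracket Y), e1 X, e1 Y, hexp hX, hexp hX, hexp hY, hexp hY]
  simp only [CVectorField.bracket, Pi.sub_apply, Pi.add_apply, map_sub, map_add,
    hD.mvfderiv_bracket hU hX.re hY.re hf hx, hD.mvfderiv_bracket hU hX.im hY.im hf hx,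
    hD.mvfderiv_bracket hU hX.re hY.im hf hx, hD.mvfderiv_bracket hU hX.im hY.re hf hx]
  linear_combination (-(mvfderiv (𝓡 4) (fun y => mvfderiv (𝓡 4) f y (Y.im y)) x (X.im x)) +
    mvfderiv (𝓡 4) (fun y => mvfderiv (𝓡 4) f y (X.im y)) x (Y.im x)) * Complex.I_mul_I

end IsNormalizedOn
end SpinDyad
end Complex

section Frame

variable {M : Type*} [TopologicalSpace M] [ChartedSpace (EuclideanSpace ℝ (Fin 4)) M]
  {U : Set M} [IsManifold (𝓡 4) ∞ M]

namespace SpinDyad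

variable {D : SpinDyad M} {g : LorentzianMetric M}

namespace IsNormalizedOn

/-- Expansion of a real tangent vector in the frame `l, n, Re m, Im m`. -/
lemma vector_expansion (hD : D.IsNormalizedOn g U) {x : M} (hx : x ∈ U)
    (v : TangentSpace (𝓡 4) x) :
    v = g.val x v (D.n x) • D.l x + g.val x v (D.l x) • D.n x
      - (2 * g.val x v (D.m.re x)) • D.m.re x - (2 * g.val x v (D.m.im x)) • D.m.im x := by
  have h := hD.inner_leg x hx
  have ll := congrArg Complex.re (h 0 0 0 0)
  have nn := congrArg Complex.re (h 1 1 1 1)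
  have ln := hD.val_l_n hx
  have lm := h 0 0 0 1
  have nm := h 1 1 0 1
  have mm := h 0 1 0 1
  have mb := congrArg Complex.re (h 0 1 1 0)
  have lr := congrArg Complex.re lm
  have li := congrArg Complex.im lm
  have nr := congrArg Complex.re nm
  have ni := congrArg Complex.im nm
  have mr := congrArg Complex.re mm
  have mi := congrArg Complex.im mm
  simp [LorentzianMetric.inner, leg, CVectorField.ofReal, CVectorField.conj, eps] at ll nn lr li nr ni mr mi mb
  rw [g.symm x (D.m.im x) (D.m.re x)] at mi
  have nl := g.symm x (D.n x) (D.l x)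
  have rl := g.symm x (D.m.re x) (D.l x)
  have il := g.symm x (D.m.im x) (D.l x)
  have rn := g.symm x (D.m.re x) (D.n x)
  have im_n := g.symm x (D.m.im x) (D.n x)
  have ir := g.symm x (D.m.im x) (D.m.re x)
  have ri : g.val x (D.m.re x) (D.m.im x) = 0 := by linarith
  have rr : g.val x (D.m.re x) (D.m.re x) = -1 / 2 := by linarith
  have ii : g.val x (D.m.im x) (D.m.im x) = -1 / 2 := by linarith
  have pair : ∀ c : Fin 4 → ℝ, ∀ w, g.val x (∑ i, c i • ![D.l x, D.n x, D.m.re x, D.m.im x] i) w =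
      c 0 * g.val x (D.l x) w + c 1 * g.val x (D.n x) w + c 2 * g.val x (D.m.re x) w
        + c 3 * g.val x (D.m.im x) w := by
    intro c w
    simp [Fin.sum_univ_four]
  have hli : LinearIndependent ℝ ![D.l x, D.n x, D.m.re x, D.m.im x] := by
    rw [Fintype.linearIndependent_iff]
    intro c hc
    have e : ∀ w, g.val x (∑ i, c i • ![D.l x, D.n x, D.m.re x, D.m.im x] i) w = 0 := by
      intro w; rw [hc]; simp
    have e0 := e (D.n x)
    have e1 := e (D.l x)
    have e2 := e (D.m.re x)
    have e3 := e (D.m.im x)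
    simp only [pair, nl, rl, il, rn, im_n, ir, ll, nn, ln, lr, li, nr, ni, ri, rr, ii] at e0 e1 e2 e3
    intro i
    fin_cases i <;> simp <;> linarith
  have hspan : v ∈ Submodule.span ℝ (Set.range ![D.l x, D.n x, D.m.re x, D.m.im x]) := by
    have hfin : Fintype.card (Fin 4) = Module.finrank ℝ (TangentSpace (𝓡 4) x) := by
      change _ = Module.finrank ℝ (EuclideanSpace ℝ (Fin 4))
      simp
    have : FiniteDimensional ℝ (TangentSpace (𝓡 4) x) :=
      inferInstanceAs (FiniteDimensional ℝ (EuclideanSpace ℝ (Fin 4)))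
    rw [hli.span_eq_top_of_card_eq_finrank hfin]
    trivial
  obtain ⟨c, rfl⟩ := (Submodule.mem_span_range_iff_exists_fun ℝ).1 hspan
  simp only [pair, nl, rl, il, rn, im_n, ir, ll, nn, ln, lr, li, nr, ni, ri, rr, ii]
  simp only [Fin.sum_univ_four, Matrix.cons_val]
  module

/-- Expansion of a complex vector field in the tetrad, as a derivation. -/
lemma deriv_expansion (hD : D.IsNormalizedOn g U) {x : M} (hx : x ∈ U) (X : CVectorField M)
    (f : M → ℂ) :
    X.deriv f x = ∑ C : Fin 2, ∑ C' : Fin 2,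
      (∑ E : Fin 2, ∑ E' : Fin 2, eps C E * eps C' E' * g.inner X (D.leg E E') x)
        * (D.leg C C').deriv f x := by
  have key : ∀ v : TangentSpace (𝓡 4) x, mvfderiv (𝓡 4) f x v =
      g.val x v (D.n x) * mvfderiv (𝓡 4) f x (D.l x)
      + g.val x v (D.l x) * mvfderiv (𝓡 4) f x (D.n x)
      - (2 * g.val x v (D.m.re x)) * mvfderiv (𝓡 4) f x (D.m.re x)
      - (2 * g.val x v (D.m.im x)) * mvfderiv (𝓡 4) f x (D.m.im x) := by
    intro v
    conv_lhs => rw [hD.vector_expansion hx v]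
    simp
  rw [CVectorField.deriv, key (X.re x), key (X.im x)]
  simp only [Fin.sum_univ_two, eps, leg, CVectorField.deriv, LorentzianMetric.inner,
    CVectorField.ofReal, CVectorField.conj, Matrix.cons_val', Matrix.cons_val_zero,
    Matrix.cons_val_one, Matrix.of_apply, Matrix.cons_val_fin_one, Pi.neg_apply, Pi.zero_apply,
    map_neg, map_zero, Complex.ofReal_add, Complex.ofReal_sub, Complex.ofReal_neg,
    Complex.ofReal_zero]
  ring_nf
  simp only [Complex.I_sq]
  ring

/-! ### Structure functions and connection components at a point -/

/-- `g([e_a, e_b], e_c)` is antisymmetric in `a`, `b`. -/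
lemma _root_.Debye.LorentzianMetric.inner_bracket_swap (g : LorentzianMetric M)
    (X Y Z : CVectorField M) (x : M) :
    g.inner (X.bracket Y) Z x = -g.inner (Y.bracket X) Z x := by
  obtain ⟨h1, h2⟩ := CVectorField.bracket_swap X Y x
  simp only [LorentzianMetric.inner, h1, h2, map_neg, neg_apply]
  push_cast
  ring

lemma star_inner_bracket (hD : D.IsNormalizedOn g U) (hU : IsOpen U) {x : M} (hx : x ∈ U)
    (A A' B B' C C' : Fin 2) :
    star (g.inner ((D.leg A A').bracket (D.leg B B')) (D.leg C C') x) =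
      g.inner ((D.leg A' A).bracket (D.leg B' B)) (D.leg C' C) x := by
  obtain ⟨h1, h2⟩ := CVectorField.bracket_conj hU (hD.smooth_leg A A') (hD.smooth_leg B B') hx
  rw [LorentzianMetric.star_inner, ← D.leg_conj A A', ← D.leg_conj B B', ← D.leg_conj C C']
  simp only [LorentzianMetric.inner, h1, h2]

/-- In a normalised tetrad the Koszul formula involves brackets only. -/
lemma nablaInner_leg (hD : D.IsNormalizedOn g U) (hU : IsOpen U) {x : M} (hx : x ∈ U)
    (A A' B B' C C' : Fin 2) :
    g.nablaInner (D.leg A A') (D.leg B B') (D.leg C C') x = 1 / 2 *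
      (g.inner ((D.leg A A').bracket (D.leg B B')) (D.leg C C') x
        - g.inner ((D.leg A A').bracket (D.leg C C')) (D.leg B B') x
        - g.inner ((D.leg B B').bracket (D.leg C C')) (D.leg A A') x) := by
  have h0 : ∀ (X : CVectorField M) (A A' B B' : Fin 2),
      X.deriv (g.inner (D.leg A A') (D.leg B B')) x = 0 := by
    intro X A A' B B'
    rw [X.deriv_congr (g := fun _ => eps A B * eps A' B') hU
      (fun y hy => hD.inner_leg y hy A A' B B') hx, X.deriv_const]
  simp [LorentzianMetric.nablaInner, h0]

lemma nablaInner_antisymm (hD : D.IsNormalizedOn g U) (hU : IsOpen U) {x : M} (hx : x ∈ U)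
    (A A' B B' C C' : Fin 2) :
    g.nablaInner (D.leg A A') (D.leg B B') (D.leg C C') x =
      -g.nablaInner (D.leg A A') (D.leg C C') (D.leg B B') x := by
  rw [hD.nablaInner_leg hU hx, hD.nablaInner_leg hU hx,
    g.inner_bracket_swap (D.leg B B') (D.leg C C')]
  ring

lemma nablaInner_torsion (hD : D.IsNormalizedOn g U) (hU : IsOpen U) {x : M} (hx : x ∈ U)
    (A A' B B' C C' : Fin 2) :
    g.nablaInner (D.leg A A') (D.leg B B') (D.leg C C') x
      - g.nablaInner (D.leg B B') (D.leg A A') (D.leg C C') x =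
      g.inner ((D.leg A A').bracket (D.leg B B')) (D.leg C C') x := by
  rw [hD.nablaInner_leg hU hx, hD.nablaInner_leg hU hx,
    g.inner_bracket_swap (D.leg B B') (D.leg A A')]
  ring

lemma star_nablaInner (hD : D.IsNormalizedOn g U) (hU : IsOpen U) {x : M} (hx : x ∈ U)
    (A A' B B' C C' : Fin 2) :
    star (g.nablaInner (D.leg A A') (D.leg B B') (D.leg C C') x) =
      g.nablaInner (D.leg A' A) (D.leg B' B) (D.leg C' C) x := by
  rw [hD.nablaInner_leg hU hx, hD.nablaInner_leg hU hx]
  simp only [star_mul', star_sub, hD.star_inner_bracket hU hx]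
  simp

lemma structureFun_eq (hD : D.IsNormalizedOn g U) (hU : IsOpen U) {x : M} (hx : x ∈ U)
    (A A' B B' C C' : Fin 2) :
    D.structureFun g A A' B B' C C' x = D.omega g A A' B B' C C' x
      - D.omega g B B' A A' C C' x := by
  simp only [structureFun, omega, Finset.sum_apply, Pi.smul_apply, ← Finset.sum_sub_distrib,
    ← smul_sub, hD.nablaInner_torsion hU hx]

lemma omega_eq (hD : D.IsNormalizedOn g U) (hU : IsOpen U) {x : M} (hx : x ∈ U)
    (A A' B B' C C' : Fin 2) :
    D.omega g A A' B B' C C' x = (if B' = C' then D.Gam g A A' B C x else 0)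
      + (if B = C then D.Gam' g A A' B' C' x else 0) := by
  have hs := hD.star_nablaInner hU hx
  have ha := hD.nablaInner_antisymm hU hx A A'
  have hz : ∀ B B', g.nablaInner (D.leg A A') (D.leg B B') (D.leg B B') x = 0 := by
    intro B B'
    have := ha B B' B B'
    linear_combination (1 / 2) * this
  have h1 := ha 0 1 0 0
  have h2 := ha 1 0 0 0
  have h3 := ha 1 1 0 0
  have h4 := ha 1 0 0 1
  have h5 := ha 1 1 0 1
  have h6 := ha 1 1 1 0
  fin_cases B <;> fin_cases B' <;> fin_cases C <;> fin_cases C' <;>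
    simp [omega, Gam, Gam', Fin.sum_univ_two, eps, hs, hz, h1, h2, h3, h4, h5, h6,
      -RCLike.star_def] <;> ring

lemma Gam_trace (hD : D.IsNormalizedOn g U) (hU : IsOpen U) {x : M} (hx : x ∈ U)
    (A A' : Fin 2) : D.Gam g A A' 0 0 x + D.Gam g A A' 1 1 x = 0 := by
  have ha := hD.nablaInner_antisymm hU hx A A'
  have h3 := ha 1 1 0 0
  have h4 := ha 1 0 0 1
  simp [omega, Gam, Fin.sum_univ_two, eps, h3, h4]
  ring

end IsNormalizedOn
end SpinDyad
end Frame

/-! ### Spin frames over a commutative ring -/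

/-- The algebraic data of a tetrad with its spin connection over a ring of functions: the
derivations `e_{AA'}` and the components of the connections on `S` and on `S'`, the latter not
assumed to be conjugate to the former. -/
structure SpinFrame (R : Type*) [CommRing R] [Algebra ℂ R] where
  d : Fin 2 → Fin 2 → Derivation ℂ R R
  Γ : Fin 2 → Fin 2 → Fin 2 → Fin 2 → R
  Γ' : Fin 2 → Fin 2 → Fin 2 → Fin 2 → R

namespace SpinFrame

variable {R : Type*} [CommRing R] [Algebra ℂ R] (S : SpinFrame R)

/-- The connection induced on `S ⊗ S'`. -/
def conn (A A' B B' C C' : Fin 2) : R :=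
  (if B' = C' then S.Γ A A' B C else 0) + (if B = C then S.Γ' A A' B' C' else 0)

/-- The structure functions of a torsion-free frame. -/
def c (A A' B B' C C' : Fin 2) : R := S.conn A A' B B' C C' - S.conn B B' A A' C C'

/-- The commutators of the derivations are given by the structure functions. -/
def IsTorsionFree : Prop := ∀ (A A' B B' : Fin 2) (f : R),
  S.d A A' (S.d B B' f) - S.d B B' (S.d A A' f) =
    ∑ C : Fin 2, ∑ C' : Fin 2, S.c A A' B B' C C' * S.d C C' f

/-- The component `e` of `[e_a, [e_b, e_c]]`, where `[e_b, e_c]` is expanded in the frame. -/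
def doubleBracket (A A' B B' C C' E E' : Fin 2) : R :=
  S.d A A' (S.c B B' C C' E E') +
    ∑ F : Fin 2, ∑ F' : Fin 2, S.c B B' C C' F F' * S.c A A' F F' E E'

/-- The left-hand side of the Jacobi identity. -/
def jacobiator (A A' B B' C C' E E' : Fin 2) : R :=
  S.doubleBracket A A' B B' C C' E E' + S.doubleBracket B B' C C' A A' E E'
    + S.doubleBracket C C' A A' B B' E E'

variable {S}

lemma IsTorsionFree.sum_doubleBracket_mul (hS : S.IsTorsionFree) (A A' B B' C C' : Fin 2)
    (f : R) :
    ∑ E : Fin 2, ∑ E' : Fin 2, S.doubleBracket A A' B B' C C' E E' * S.d E E' f =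
      S.d A A' (S.d B B' (S.d C C' f)) - S.d A A' (S.d C C' (S.d B B' f))
        - (S.d B B' (S.d C C' (S.d A A' f)) - S.d C C' (S.d B B' (S.d A A' f))) := by
  rw [hS B B' C C' (S.d A A' f), ← map_sub, hS B B' C C' f]
  simp only [doubleBracket, Fin.sum_univ_two, map_add, Derivation.leibniz, smul_eq_mul]
  have h := fun E E' => hS A A' E E' f
  simp only [Fin.sum_univ_two] at h
  linear_combination -S.c B B' C C' 0 0 * h 0 0 - S.c B B' C C' 0 1 * h 0 1
    - S.c B B' C C' 1 0 * h 1 0 - S.c B B' C C' 1 1 * h 1 1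

lemma IsTorsionFree.sum_jacobiator_mul (hS : S.IsTorsionFree) (A A' B B' C C' : Fin 2)
    (f : R) : ∑ E : Fin 2, ∑ E' : Fin 2, S.jacobiator A A' B B' C C' E E' * S.d E E' f = 0 := by
  simp only [jacobiator, add_mul, Finset.sum_add_distrib, hS.sum_doubleBracket_mul]
  ring

end SpinFrame

section ExtendZero

variable {M : Type*} {U : Set M}

/-- Extension by zero. -/
def extendZero (f : U → ℂ) : M → ℂ := Function.extend Subtype.val f 0

lemma extendZero_of_mem (f : U → ℂ) {x : M} (hx : x ∈ U) : extendZero f x = f ⟨x, hx⟩ :=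
  Subtype.val_injective.extend_apply f 0 ⟨x, hx⟩

end ExtendZero

section Concrete

variable {M : Type*} [TopologicalSpace M] [ChartedSpace (EuclideanSpace ℝ (Fin 4)) M]
  {U : Set M}

/-- The algebra of smooth complex functions on `U`. -/
def smoothAlg (U : Set M) : Subalgebra ℂ (U → ℂ) where
  carrier := {f | SmoothOn U (extendZero f)}
  mul_mem' {f g} hf hg := (hf.mul' hg).congr fun x hx => by
    simp [extendZero_of_mem _ hx]
  add_mem' {f g} hf hg := (hf.add' hg).congr fun x hx => by
    simp [extendZero_of_mem _ hx]
  algebraMap_mem' c := (smoothOn_const c).congr fun x hx =>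
    extendZero_of_mem _ hx

/-- The element of `smoothAlg U` given by a function smooth on `U`. -/
def SmoothOn.toAlg {F : M → ℂ} (hF : SmoothOn U F) : smoothAlg U :=
  ⟨fun x => F x, hF.congr fun _ hx => extendZero_of_mem _ hx⟩

@[simp] lemma SmoothOn.toAlg_apply {F : M → ℂ} (hF : SmoothOn U F) (x : U) :
    hF.toAlg.1 x = F x := rfl

/-- Complex conjugation on `smoothAlg U`. -/
def conjAlg : smoothAlg U →+* smoothAlg U where
  toFun f := ⟨star f.1, f.2.conj.congr fun x hx => by
    simp [extendZero_of_mem _ hx]⟩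
  map_one' := Subtype.ext (by simp)
  map_zero' := Subtype.ext (by simp)
  map_mul' f g := Subtype.ext (by simp)
  map_add' f g := Subtype.ext (by simp)

@[simp] lemma conjAlg_apply (f : smoothAlg U) (x : U) : (conjAlg f).1 x = star (f.1 x) := rfl

variable [IsManifold (𝓡 4) ∞ M] {D : SpinDyad M} {g : LorentzianMetric M}

namespace SpinDyad.IsNormalizedOn

/-- A smooth complex vector field as a derivation of `smoothAlg U`. -/
def derivation (hD : D.IsNormalizedOn g U) (hU : IsOpen U) {X : CVectorField M}
    (hX : SmoothCVecOn U X) : Derivation ℂ (smoothAlg U) (smoothAlg U) :=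
  Derivation.mk'
    { toFun := fun f => (hD.smooth_deriv hU hX f.2).toAlg
      map_add' := fun f h => by
        ext x
        have e : Set.EqOn (extendZero (f + h).1) (extendZero f.1 + extendZero h.1) U :=
          fun y hy => by simp [extendZero_of_mem _ hy]
        exact (X.deriv_congr hU e x.2).trans (X.deriv_add hU f.2 h.2 x.2)
      map_smul' := fun c f => by
        ext x
        have e : Set.EqOn (extendZero (c • f).1) ((fun _ => c) * extendZero f.1) U :=
          fun y hy => by simp [extendZero_of_mem _ hy]
        refine (X.deriv_congr hU e x.2).trans ?_
        simp [X.deriv_mul hU (smoothOn_const c) f.2 x.2, X.deriv_const] }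
    (fun f h => by
      ext x
      have e : Set.EqOn (extendZero (f * h).1) (extendZero f.1 * extendZero h.1) U :=
          fun y hy => by simp [extendZero_of_mem _ hy]
      refine (X.deriv_congr hU e x.2).trans ?_
      simp [X.deriv_mul hU f.2 h.2 x.2, extendZero_of_mem _ x.2])

lemma derivation_eq (hD : D.IsNormalizedOn g U) (hU : IsOpen U) {X : CVectorField M}
    (hX : SmoothCVecOn U X) {F : M → ℂ} {f : smoothAlg U} (h : ∀ x : U, F x = f.1 x) (x : U) :
    X.deriv F x = (hD.derivation hU hX f).1 x :=
  X.deriv_congr hU (fun y hy => (h ⟨y, hy⟩).trans (extendZero_of_mem f.1 hy).symm) x.2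

lemma smooth_omega (hD : D.IsNormalizedOn g U) (hU : IsOpen U) (A A' B B' C C' : Fin 2) :
    SmoothOn U (D.omega g A A' B B' C C') := by
  have hb : ∀ A A' B B' C C', SmoothOn U
      (g.inner ((D.leg A A').bracket (D.leg B B')) (D.leg C C')) := fun A A' B B' C C' =>
    g.smooth_inner ((hD.smooth_leg A A').bracket hU (hD.smooth_leg B B')) (hD.smooth_leg C C')
  have hn : ∀ A A' B B' C C', SmoothOn U
      (g.nablaInner (D.leg A A') (D.leg B B') (D.leg C C')) := fun A A' B B' C C' =>
    ((smoothOn_const (1 / 2)).mul' ((hb A A' B B' C C').sub (hb A A' C C' B B') |>.sub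
      (hb B B' C C' A A'))).congr fun x hx => hD.nablaInner_leg hU hx A A' B B' C C'
  have hs : ∀ E E', SmoothOn U ((eps C E * eps C' E') •
      g.nablaInner (D.leg A A') (D.leg B B') (D.leg E E')) :=
    fun E E' => (smoothOn_const _).mul' (hn A A' B B' E E')
  simp only [omega, Fin.sum_univ_two]
  exact ((hs 0 0).add' (hs 0 1)).add' ((hs 1 0).add' (hs 1 1))

lemma smooth_Gam (hD : D.IsNormalizedOn g U) (hU : IsOpen U) (A A' B C : Fin 2) :
    SmoothOn U (D.Gam g A A' B C) := by
  simp only [Gam, Fin.sum_univ_two]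
  exact (smoothOn_const _).mul'
    ((hD.smooth_omega hU A A' B 0 C 0).add' (hD.smooth_omega hU A A' B 1 C 1))

/-- The spin frame over `smoothAlg U` of a normalised dyad. -/
def spinFrame (hD : D.IsNormalizedOn g U) (hU : IsOpen U) : SpinFrame (smoothAlg U) where
  d A A' := hD.derivation hU (hD.smooth_leg A A')
  Γ A A' B C := (hD.smooth_Gam hU A A' B C).toAlg
  Γ' A A' B C := conjAlg (hD.smooth_Gam hU A' A B C).toAlg

variable (hD : D.IsNormalizedOn g U) (hU : IsOpen U)

lemma spinFrame_d_apply (A A' : Fin 2) (f : smoothAlg U) (x : U) :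
    ((hD.spinFrame hU).d A A' f).1 x = (D.leg A A').deriv (extendZero f.1) x := rfl

lemma spinFrame_Γ_apply (A A' B C : Fin 2) (x : U) :
    ((hD.spinFrame hU).Γ A A' B C).1 x = D.Gam g A A' B C x := rfl

lemma spinFrame_Γ'_apply (A A' B C : Fin 2) (x : U) :
    ((hD.spinFrame hU).Γ' A A' B C).1 x = D.Gam' g A A' B C x := rfl

lemma spinFrame_conn_apply (A A' B B' C C' : Fin 2) (x : U) :
    ((hD.spinFrame hU).conn A A' B B' C C').1 x = D.omega g A A' B B' C C' x := by
  rw [hD.omega_eq hU x.2, SpinFrame.conn, ← hD.spinFrame_Γ_apply hU, ← hD.spinFrame_Γ'_apply hU]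
  split_ifs <;> simp

lemma spinFrame_c_apply (A A' B B' C C' : Fin 2) (x : U) :
    ((hD.spinFrame hU).c A A' B B' C C').1 x = D.structureFun g A A' B B' C C' x := by
  rw [hD.structureFun_eq hU x.2, ← hD.spinFrame_conn_apply hU, ← hD.spinFrame_conn_apply hU]
  rfl

lemma spinFrame_trace (A A' : Fin 2) :
    (hD.spinFrame hU).Γ A A' 0 0 + (hD.spinFrame hU).Γ A A' 1 1 = 0 :=
  Subtype.ext (funext fun x => hD.Gam_trace hU x.2 A A')

lemma spinFrame_trace' (A A' : Fin 2) :
    (hD.spinFrame hU).Γ' A A' 0 0 + (hD.spinFrame hU).Γ' A A' 1 1 = 0 := by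
  have h := congrArg conjAlg (hD.spinFrame_trace hU A' A)
  rwa [map_add, map_zero] at h

lemma spinFrame_isTorsionFree : (hD.spinFrame hU).IsTorsionFree := by
  intro A A' B B' f
  ext x
  have h := hD.deriv_bracket hU (hD.smooth_leg A A') (hD.smooth_leg B B') f.2 x.2
  rw [hD.deriv_expansion x.2] at h
  have e : ∀ A A' B B', (D.leg A A').deriv ((D.leg B B').deriv (extendZero f.1)) x =
      ((hD.spinFrame hU).d A A' ((hD.spinFrame hU).d B B' f)).1 x := fun A A' B B' =>
    hD.derivation_eq hU (hD.smooth_leg A A') (fun y => rfl) x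
  rw [e, e] at h
  refine Eq.trans h.symm ?_
  simp only [Fin.sum_univ_two]
  simp [spinFrame_c_apply, structureFun, Fin.sum_univ_two, spinFrame_d_apply]

lemma conjAlg_d (A A' : Fin 2) (f : smoothAlg U) :
    conjAlg ((hD.spinFrame hU).d A A' f) = (hD.spinFrame hU).d A' A (conjAlg f) := by
  ext x
  rw [conjAlg_apply, spinFrame_d_apply, CVectorField.deriv_star _ hU f.2 x.2, leg_conj]
  refine CVectorField.deriv_congr _ hU (fun y hy => ?_) x.2
  simp [extendZero_of_mem _ hy]

/-- Every real-linear functional on a tangent space is the differential of a smooth function, if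
`U` lies in the domain of a chart. -/
lemma _root_.Debye.exists_smooth_mvfderiv_eq {x₀ : M}
    (hsrc : U ⊆ (chartAt (EuclideanSpace ℝ (Fin 4)) x₀).source) (hU : IsOpen U) {x : M}
    (hx : x ∈ U) (L : TangentSpace (𝓡 4) x →L[ℝ] ℂ) :
    ∃ f : M → ℂ, SmoothOn U f ∧ ∀ v, mvfderiv (𝓡 4) f x v = L v := by
  obtain ⟨e, he⟩ := isInvertible_mfderiv_extChartAt (I := 𝓡 4) (x := x₀) (y := x)
    (by simpa using hsrc hx)
  have hφ : ContMDiffOn (𝓡 4) 𝓘(ℝ, EuclideanSpace ℝ (Fin 4)) ∞ (extChartAt (𝓡 4) x₀) U :=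
    (contMDiffOn_extChartAt (I := 𝓡 4) (n := ∞) (x := x₀)).mono hsrc
  let K : EuclideanSpace ℝ (Fin 4) →L[ℝ] ℂ := L.comp e.symm.toContinuousLinearMap
  refine ⟨fun y => K (extChartAt (𝓡 4) x₀ y), K.contDiff.contMDiff.comp_contMDiffOn hφ, fun v => ?_⟩
  rw [mvfderiv_clm_comp K ((hφ.contMDiffAt (hU.mem_nhds hx)).mdifferentiableAt (by simp)) v]
  have h : mvfderiv (𝓡 4) (extChartAt (𝓡 4) x₀) x v = e v := by
    have := congrArg (fun T => T v) he
    exact this.symm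
  rw [h]
  exact congrArg L (e.symm_apply_apply v)

/-- A combination of the tetrad that annihilates all smooth functions has vanishing
coefficients. -/
lemma coeff_eq_zero {x₀ : M} (hsrc : U ⊆ (chartAt (EuclideanSpace ℝ (Fin 4)) x₀).source)
    (j : Fin 2 → Fin 2 → smoothAlg U)
    (h : ∀ f, ∑ E : Fin 2, ∑ E' : Fin 2, j E E' * (hD.spinFrame hU).d E E' f = 0)
    (E E' : Fin 2) : j E E' = 0 := by
  ext x
  have key : ∀ B B' : Fin 2, ∑ C : Fin 2, ∑ C' : Fin 2, (j C C').1 x * (eps B C * eps B' C') = 0 := by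
    intro B B'
    obtain ⟨f, hf, hL⟩ := exists_smooth_mvfderiv_eq hsrc hU x.2
      (Complex.ofRealCLM.comp (g.val x ((D.leg B B').re x)) +
        Complex.I • Complex.ofRealCLM.comp (g.val x ((D.leg B B').im x)))
    have e : ∀ C C', ((hD.spinFrame hU).d C C' hf.toAlg).1 x = eps B C * eps B' C' := by
      intro C C'
      rw [← hD.inner_leg x x.2, spinFrame_d_apply,
        CVectorField.deriv_congr (g := f) _ hU (fun y hy => extendZero_of_mem _ hy) x.2,
        CVectorField.deriv, hL, hL]
      simp [LorentzianMetric.inner]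
      linear_combination (g.val x ((D.leg B B').im x) ((D.leg C C').im x) : ℂ) * Complex.I_mul_I
    have h1 := congrArg (fun f => f.1 x) (h hf.toAlg)
    simp only [Fin.sum_univ_two] at h1 ⊢
    simpa [e] using h1
  have k1 := key 0 0
  have k2 := key 0 1
  have k3 := key 1 0
  have k4 := key 1 1
  simp [Fin.sum_univ_two, eps] at k1 k2 k3 k4
  fin_cases E <;> fin_cases E' <;> simp [k1, k2, k3, k4]

lemma jacobiator_eq_zero {x₀ : M} (hsrc : U ⊆ (chartAt (EuclideanSpace ℝ (Fin 4)) x₀).source)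
    (A A' B B' C C' E E' : Fin 2) : (hD.spinFrame hU).jacobiator A A' B B' C C' E E' = 0 :=
  hD.coeff_eq_zero hU hsrc _
    ((hD.spinFrame_isTorsionFree hU).sum_jacobiator_mul A A' B B' C C') E E'

end SpinDyad.IsNormalizedOn
end Concrete

namespace SpinFrame

variable {R : Type*} [CommRing R] [Algebra ℂ R] (S : SpinFrame R)

/-! ### Curvature of a spin frame -/

/-- The connection annihilates the spin metrics and is torsion-free, and the tetrad satisfies the
Jacobi identity. -/
structure IsLeviCivita : Prop where
  trace : ∀ A A', S.Γ A A' 0 0 + S.Γ A A' 1 1 = 0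
  trace' : ∀ A A', S.Γ' A A' 0 0 + S.Γ' A A' 1 1 = 0
  torsionFree : S.IsTorsionFree
  jacobi : ∀ A A' B B' C C' E E', S.jacobiator A A' B B' C C' E E' = 0

/-- Curvature `(∇_a ∇_b - ∇_b ∇_a) ε_C = curv_{ab C}{}^E ε_E` of the connection on `S`. -/
def curv (A A' B B' C E : Fin 2) : R :=
  S.d A A' (S.Γ B B' C E) - S.d B B' (S.Γ A A' C E)
    + ∑ F : Fin 2, (S.Γ B B' C F * S.Γ A A' F E - S.Γ A A' C F * S.Γ B B' F E)
    - ∑ F : Fin 2, ∑ F' : Fin 2, S.c A A' B B' F F' * S.Γ F F' C E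

/-- Exchange of the roles of `S` and `S'`. -/
def swap : SpinFrame R where
  d A A' := S.d A' A
  Γ A A' B C := S.Γ' A' A B C
  Γ' A A' B C := S.Γ A' A B C

/-- Curvature of the connection on `S'`. -/
def curv' (A A' B B' C E : Fin 2) : R := S.swap.curv A' A B' B C E

/-- The Riemann tensor of the connection on `S ⊗ S'`. -/
def riem (A A' B B' C C' E E' : Fin 2) : R :=
  (if C' = E' then S.curv A A' B B' C E else 0) + (if C = E then S.curv' A A' B B' C' E' else 0)

lemma swap_conn (A A' B B' C C' : Fin 2) :
    S.swap.conn A A' B B' C C' = S.conn A' A B' B C' C := by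
  simp only [conn, swap]
  ring

lemma swap_c (A A' B B' C C' : Fin 2) : S.swap.c A A' B B' C C' = S.c A' A B' B C' C := by
  simp only [c, swap_conn]

lemma curv'_eq (A A' B B' C E : Fin 2) : S.curv' A A' B B' C E =
    S.d A A' (S.Γ' B B' C E) - S.d B B' (S.Γ' A A' C E)
    + ∑ F : Fin 2, (S.Γ' B B' C F * S.Γ' A A' F E - S.Γ' A A' C F * S.Γ' B B' F E)
    - ∑ F : Fin 2, ∑ F' : Fin 2, S.c A A' B B' F F' * S.Γ' F F' C E := by
  rw [curv', curv]
  simp only [swap_c]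
  rw [Finset.sum_comm (f := fun F F' => S.c A A' B B' F' F * S.swap.Γ F F' C E)]
  rfl

lemma swap_riem (A A' B B' C C' E E' : Fin 2) :
    S.swap.riem A A' B B' C C' E E' = S.riem A' A B' B C' C E' E := by
  simp only [riem, curv']
  rw [add_comm]
  rfl

lemma riem_eq (A A' B B' C C' E E' : Fin 2) : S.riem A A' B B' C C' E E' =
    S.d A A' (S.conn B B' C C' E E') - S.d B B' (S.conn A A' C C' E E')
    + ∑ F : Fin 2, ∑ F' : Fin 2,
      (S.conn B B' C C' F F' * S.conn A A' F F' E E'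
        - S.conn A A' C C' F F' * S.conn B B' F F' E E'
        - S.c A A' B B' F F' * S.conn F F' C C' E E') := by
  rw [riem, curv'_eq, curv]
  fin_cases C <;> fin_cases C' <;> fin_cases E <;> fin_cases E' <;>
    simp [conn, Fin.sum_univ_two] <;> ring

lemma c_swap (A A' B B' C C' : Fin 2) : S.c A A' B B' C C' = -S.c B B' A A' C C' := by
  simp only [c]
  ring

lemma curv_swap (A A' B B' C E : Fin 2) : S.curv A A' B B' C E = -S.curv B B' A A' C E := by
  simp only [curv, Fin.sum_univ_two]
  rw [S.c_swap A A' B B', S.c_swap A A' B B', S.c_swap A A' B B', S.c_swap A A' B B']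
  ring

lemma curv_self (A A' C E : Fin 2) : S.curv A A' A A' C E = 0 := by
  simp [curv, c]

variable {S}

lemma IsLeviCivita.curv_trace (hS : S.IsLeviCivita) (A A' B B' : Fin 2) :
    S.curv A A' B B' 1 1 = -S.curv A A' B B' 0 0 := by
  have h : ∀ A A', S.Γ A A' 1 1 = -S.Γ A A' 0 0 := fun A A' => by
    linear_combination hS.trace A A'
  simp only [curv, Fin.sum_univ_two, h, map_neg]
  ring

lemma IsLeviCivita.swap (hS : S.IsLeviCivita) : S.swap.IsLeviCivita where
  trace A A' := hS.trace' A' A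
  trace' A A' := hS.trace A' A
  torsionFree A A' B B' f := by
    simp only [swap_c]
    rw [Finset.sum_comm]
    exact hS.torsionFree A' A B' B f
  jacobi A A' B B' C C' E E' := by
    have h := hS.jacobi A' A B' B C' C E' E
    simp only [jacobiator, doubleBracket, swap_c, Fin.sum_univ_two] at h ⊢
    simp only [SpinFrame.swap]
    linear_combination h

/-- The first Bianchi identity. -/
lemma IsLeviCivita.firstBianchi (hS : S.IsLeviCivita) (A A' B B' C C' E E' : Fin 2) :
    S.riem A A' B B' C C' E E' + S.riem B B' C C' A A' E E' + S.riem C C' A A' B B' E E' = 0 := by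
  have h := hS.jacobi A A' B B' C C' E E'
  simp only [jacobiator, doubleBracket, c, map_sub, Fin.sum_univ_two] at h
  simp only [riem_eq, c, Fin.sum_univ_two]
  linear_combination h

/-- The second Bianchi identity for the curvature of the connection on `S`. -/
lemma IsLeviCivita.secondBianchi (hS : S.IsLeviCivita) (A A' B B' C C' X Y : Fin 2) :
    S.d A A' (S.curv B B' C C' X Y) + S.d B B' (S.curv C C' A A' X Y)
      + S.d C C' (S.curv A A' B B' X Y)
      + ∑ F : Fin 2, (S.curv B B' C C' X F * S.Γ A A' F Y - S.Γ A A' X F * S.curv B B' C C' F Y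
        + S.curv C C' A A' X F * S.Γ B B' F Y - S.Γ B B' X F * S.curv C C' A A' F Y
        + S.curv A A' B B' X F * S.Γ C C' F Y - S.Γ C C' X F * S.curv A A' B B' F Y)
      - ∑ F : Fin 2, ∑ F' : Fin 2, (S.c A A' B B' F F' * S.curv F F' C C' X Y
        + S.c B B' C C' F F' * S.curv F F' A A' X Y
        + S.c C C' A A' F F' * S.curv F F' B B' X Y) = 0 := by
  have t1 := hS.torsionFree A A' B B' (S.Γ C C' X Y)
  have t2 := hS.torsionFree B B' C C' (S.Γ A A' X Y)
  have t3 := hS.torsionFree C C' A A' (S.Γ B B' X Y)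
  have j := fun E E' => hS.jacobi A A' B B' C C' E E'
  have s1 := fun F F' E E' => S.c_swap F F' A A' E E'
  have s2 := fun F F' E E' => S.c_swap F F' B B' E E'
  have s3 := fun F F' E E' => S.c_swap F F' C C' E E'
  simp only [jacobiator, doubleBracket, Fin.sum_univ_two] at j t1 t2 t3
  simp only [curv, Fin.sum_univ_two, map_add, map_sub, Derivation.leibniz, smul_eq_mul,
    s1 0 0, s1 0 1, s1 1 0, s1 1 1, s2 0 0, s2 0 1, s2 1 0, s2 1 1, s3 0 0, s3 0 1, s3 1 0, s3 1 1]
  linear_combination t1 + t2 + t3 - S.Γ 0 0 X Y * j 0 0 - S.Γ 0 1 X Y * j 0 1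
    - S.Γ 1 0 X Y * j 1 0 - S.Γ 1 1 X Y * j 1 1

end SpinFrame

lemma eps_zero_zero : eps 0 0 = 0 := by simp [eps]
lemma eps_zero_one : eps 0 1 = 1 := by simp [eps]
lemma eps_one_zero : eps 1 0 = -1 := by simp [eps]
lemma eps_one_one : eps 1 1 = 0 := by simp [eps]

lemma eq_of_natCast_mul_eq {R : Type*} [CommRing R] [Algebra ℂ R] {n : ℕ} (hn : n ≠ 0) {x y : R}
    (h : (n : R) * x = n * y) : x = y := by
  have hu : algebraMap ℂ R (n : ℂ)⁻¹ * (n : R) = 1 := by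
    rw [← map_natCast (algebraMap ℂ R), ← map_mul, inv_mul_cancel₀ (by exact_mod_cast hn), map_one]
  linear_combination -(x - y) * hu + algebraMap ℂ R (n : ℂ)⁻¹ * h

namespace SpinFrame

variable {R : Type*} [CommRing R] [Algebra ℂ R] (S : SpinFrame R)

/-! ### Curvature of an Einstein spin frame -/

/-- The Ricci tensor is `6 Λ g` with constant `Λ`. -/
structure IsEinstein (Lam : R) : Prop where
  const : ∀ A A', S.d A A' Lam = 0
  ricci : ∀ A A' C C', ∑ B : Fin 2, ∑ B' : Fin 2, S.riem A A' B B' C C' B B' =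
    6 * Lam * algebraMap ℂ R (eps A C * eps A' C')

/-- The Weyl scalar `Ψ₀`. -/
def Ψ₀ : R := -S.curv 0 0 0 1 0 1
/-- The Weyl scalar `Ψ₁`. -/
def Ψ₁ : R := S.curv 0 0 0 1 0 0
/-- The Weyl scalar `Ψ₂`. -/
def Ψ₂ (Lam : R) : R := S.curv 0 0 0 1 1 0 - 2 * Lam
/-- The Weyl scalar `Ψ₃`. -/
def Ψ₃ : R := S.curv 1 0 1 1 0 0
/-- The Weyl scalar `Ψ₄`. -/
def Ψ₄ : R := S.curv 1 0 1 1 1 0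

/-- The curvature components of an Einstein spin frame in terms of `Ψ` and `Λ`; the letters
`l`, `m`, `b`, `n` stand for the tetrad vectors `l`, `m`, `m̄`, `n`. -/
structure EinsteinCurvature (Lam : R) : Prop where
  lb01 : S.curv 0 0 1 0 0 1 = 0
  lb00 : S.curv 0 0 1 0 0 0 = 0
  lb10 : S.curv 0 0 1 0 1 0 = 0
  mn01 : S.curv 0 1 1 1 0 1 = 0
  mn00 : S.curv 0 1 1 1 0 0 = 0
  mn10 : S.curv 0 1 1 1 1 0 = 0
  ln01 : S.curv 0 0 1 1 0 1 = -S.Ψ₁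
  ln00 : S.curv 0 0 1 1 0 0 = S.Ψ₂ Lam - Lam
  ln10 : S.curv 0 0 1 1 1 0 = S.Ψ₃
  mb01 : S.curv 0 1 1 0 0 1 = S.Ψ₁
  mb00 : S.curv 0 1 1 0 0 0 = Lam - S.Ψ₂ Lam
  mb10 : S.curv 0 1 1 0 1 0 = -S.Ψ₃
  bn01 : S.curv 1 0 1 1 0 1 = -(S.Ψ₂ Lam + 2 * Lam)

variable {S}

lemma curv'_self (S : SpinFrame R) (A A' C E : Fin 2) : S.curv' A A' A A' C E = 0 :=
  S.swap.curv_self A' A C E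

lemma IsLeviCivita.curv'_trace (hS : S.IsLeviCivita) (A A' B B' : Fin 2) :
    S.curv' A A' B B' 1 1 = -S.curv' A A' B B' 0 0 := hS.swap.curv_trace A' A B' B

lemma IsEinstein.swap {Lam : R} (hE : S.IsEinstein Lam) : S.swap.IsEinstein Lam where
  const A A' := hE.const A' A
  ricci A A' C C' := by
    simp only [swap_riem]
    rw [Finset.sum_comm, hE.ricci A' A C' C, mul_comm (eps A C)]

theorem IsEinstein.einsteinCurvature {Lam : R} (hE : S.IsEinstein Lam) (hS : S.IsLeviCivita) :
    S.EinsteinCurvature Lam := by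
  have sw₁ := S.curv_swap 0 1 0 0
  have sw₂ := S.curv_swap 1 0 0 0
  have sw₃ := S.curv_swap 1 1 0 0
  have sw₄ := S.curv_swap 1 0 0 1
  have sw₅ := S.curv_swap 1 1 0 1
  have sw' : ∀ A A' B B' C E, S.curv' A A' B B' C E = -S.curv' B B' A A' C E :=
    fun A A' B B' C E => S.swap.curv_swap A' A B' B C E
  have sw₁' := sw' 0 1 0 0
  have sw₂' := sw' 1 0 0 0
  have sw₃' := sw' 1 1 0 0
  have sw₅' := sw' 1 1 0 1
  have sw₆' := sw' 1 1 1 0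
  have Blbnb := hS.firstBianchi 0 0 1 0 1 1 1 0
  have Blbnl := hS.firstBianchi 0 0 1 0 1 1 0 0
  have Blbnm := hS.firstBianchi 0 0 1 0 1 1 0 1
  have Blbnn := hS.firstBianchi 0 0 1 0 1 1 1 1
  have Blmbb := hS.firstBianchi 0 0 0 1 1 0 1 0
  have Blmbl := hS.firstBianchi 0 0 0 1 1 0 0 0
  have Blmbn := hS.firstBianchi 0 0 0 1 1 0 1 1
  have Blmnb := hS.firstBianchi 0 0 0 1 1 1 1 0
  have Blmnm := hS.firstBianchi 0 0 0 1 1 1 0 1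
  have Blmnn := hS.firstBianchi 0 0 0 1 1 1 1 1
  have Bmbnb := hS.firstBianchi 0 1 1 0 1 1 1 0
  have Bmbnl := hS.firstBianchi 0 1 1 0 1 1 0 0
  have Bmbnm := hS.firstBianchi 0 1 1 0 1 1 0 1
  have Bmbnn := hS.firstBianchi 0 1 1 0 1 1 1 1
  have Ebb := hE.ricci 1 0 1 0
  have Ebn := hE.ricci 1 0 1 1
  have Elb := hE.ricci 0 0 1 0
  have Ell := hE.ricci 0 0 0 0
  have Elm := hE.ricci 0 0 0 1
  have Eln := hE.ricci 0 0 1 1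
  have Emb := hE.ricci 0 1 1 0
  have Emm := hE.ricci 0 1 0 1
  have Emn := hE.ricci 0 1 1 1
  have Enn := hE.ricci 1 1 1 1
  simp only [riem, Fin.sum_univ_two, eps_zero_zero, eps_zero_one, eps_one_zero, eps_one_one,
    Fin.isValue, zero_ne_one, one_ne_zero, ↓reduceIte, add_zero, zero_add, sw₁, sw₂, sw₃, sw₄,
    sw₅, sw₁', sw₂', sw₃', sw₅', sw₆', S.curv_self, S.curv'_self, hS.curv_trace,
    hS.curv'_trace, mul_zero, mul_one, mul_neg, map_zero, map_one, map_neg, neg_neg]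
    at Blbnb Blbnl Blbnm Blbnn Blmbb
      Blmbl Blmbn Blmnb Blmnm Blmnn Bmbnb Bmbnl Bmbnm Bmbnn Ebb Ebn
      Elb Ell Elm Eln Emb Emm Emn Enn
  exact {
    lb01 := eq_of_natCast_mul_eq (n := 2) (by norm_num) <| by
      push_cast; linear_combination -Blmbn + Ell
    lb00 := eq_of_natCast_mul_eq (n := 2) (by norm_num) <| by
      push_cast; linear_combination -Blbnn - Elb
    lb10 := eq_of_natCast_mul_eq (n := 2) (by norm_num) <| by
      push_cast; linear_combination Blbnm - Ebb
    mn01 := eq_of_natCast_mul_eq (n := 2) (by norm_num) <| by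
      push_cast; linear_combination Blmnb + Emm
    mn00 := eq_of_natCast_mul_eq (n := 2) (by norm_num) <| by
      push_cast; linear_combination Bmbnb - Emn
    mn10 := eq_of_natCast_mul_eq (n := 2) (by norm_num) <| by
      push_cast; linear_combination -Bmbnl - Enn
    ln01 := eq_of_natCast_mul_eq (n := 2) (by norm_num) <| by
      simp only [Ψ₁]; push_cast; linear_combination -Blmnn + Elm
    ln00 := eq_of_natCast_mul_eq (n := 4) (by norm_num) <| by
      simp only [Ψ₂]; push_cast; linear_combination -Blmbl - Blmnm + Blbnb - Bmbnn - 2 * Eln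
    ln10 := eq_of_natCast_mul_eq (n := 2) (by norm_num) <| by
      simp only [Ψ₃]; push_cast; linear_combination -2 * Blbnl - Bmbnm - Ebn
    mb01 := eq_of_natCast_mul_eq (n := 2) (by norm_num) <| by
      simp only [Ψ₁]; push_cast; linear_combination 2 * Blmbb + Blmnn + Elm
    mb00 := eq_of_natCast_mul_eq (n := 4) (by norm_num) <| by
      simp only [Ψ₂]; push_cast; linear_combination Blmbl + Blmnm + Blbnb - Bmbnn - 2 * Emb
    mb10 := eq_of_natCast_mul_eq (n := 2) (by norm_num) <| by
      simp only [Ψ₃]; push_cast; linear_combination Bmbnm - Ebn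
    bn01 := eq_of_natCast_mul_eq (n := 2) (by norm_num) <| by
      simp only [Ψ₂]; push_cast; linear_combination Blmbl + Blmnm + Blbnb + Bmbnn }

end SpinFrame

/-! ### The ring of weighted scalars -/

/-- Finite sums of scalars of various GHP weights. -/
def Weighted (R : Type*) [CommRing R] : Type _ := AddMonoidAlgebra R (ℤ × ℤ)

instance (R : Type*) [CommRing R] : CommRing (Weighted R) :=
  inferInstanceAs (CommRing (AddMonoidAlgebra R (ℤ × ℤ)))

section Weighted

variable {R : Type*} [CommRing R]

/-- The element `f` of `R` regarded as a scalar of weight `{p,q}`. -/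
def wt (p q : ℤ) (f : R) : Weighted R := AddMonoidAlgebra.single (p, q) f

lemma wt_zero (p q : ℤ) : wt p q (0 : R) = 0 := AddMonoidAlgebra.single_zero _

lemma wt_add (p q : ℤ) (f g : R) : wt p q (f + g) = wt p q f + wt p q g :=
  AddMonoidAlgebra.single_add _ _ _

lemma wt_neg (p q : ℤ) (f : R) : wt p q (-f) = -wt p q f := by
  rw [eq_neg_iff_add_eq_zero, ← wt_add, neg_add_cancel, wt_zero]

lemma wt_sub (p q : ℤ) (f g : R) : wt p q (f - g) = wt p q f - wt p q g := by
  rw [sub_eq_add_neg, sub_eq_add_neg, wt_add, wt_neg]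

lemma wt_mul_wt (p q p' q' : ℤ) (f g : R) :
    wt p q f * wt p' q' g = wt (p + p') (q + q') (f * g) :=
  AddMonoidAlgebra.single_mul_single _ _ _ _

lemma wt_injective (p q : ℤ) : Function.Injective (wt p q : R → Weighted R) :=
  AddMonoidAlgebra.single_right_injective

lemma ofNat_eq_wt (n : ℕ) [n.AtLeastTwo] : (ofNat(n) : Weighted R) = wt 0 0 (ofNat(n) : R) := by
  rw [← Nat.cast_ofNat (R := Weighted R), ← Nat.cast_ofNat (R := R)]
  exact AddMonoidAlgebra.natCast_def _

lemma weighted_induction {motive : Weighted R → Prop} (hwt : ∀ p q f, motive (wt p q f))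
    (hadd : ∀ x y, motive x → motive y → motive (x + y)) (x : Weighted R) : motive x := by
  obtain ⟨x⟩ := x
  induction x using Finsupp.induction_linear with
  | zero =>
    have h := hwt 0 0 0
    rwa [wt_zero] at h
  | add f g hf hg => exact hadd _ _ hf hg
  | single k a => exact hwt k.1 k.2 a

variable [Algebra ℂ R]

/-- The derivation `f ↦ δ f - (p a + q b) f` on scalars of weight `{p,q}`, which changes the weight
by `{s,t}`. -/
def weightedDerivation (s t : ℤ) (δ : Derivation ℂ R R) (a b : R) :
    Derivation ℤ (Weighted R) (Weighted R) :=
  let T : Weighted R →+ Weighted R :=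
    (Finsupp.liftAddHom fun k : ℤ × ℤ => AddMonoidHom.mk' (fun f : R =>
      wt (s + k.1) (t + k.2) (δ f - (k.1 * a + k.2 * b) * f)) fun f g => by
        rw [← wt_add, map_add]; congr 1; ring).comp
      (AddMonoidAlgebra.coeffAddEquiv (R := R) (M := ℤ × ℤ)).toAddMonoidHom
  have hT : ∀ p q f, T (wt p q f) = wt (s + p) (t + q) (δ f - (p * a + q * b) * f) :=
    fun p q f => Finsupp.liftAddHom_apply_single _ _ _
  Derivation.mk' T.toIntLinearMap fun x y => by
    induction x using weighted_induction with
    | hadd x x' hx hx' =>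
      simp only [AddMonoidHom.coe_toIntLinearMap, smul_eq_mul, add_mul, map_add, mul_add]
        at hx hx' ⊢
      rw [hx, hx']
      ring
    | hwt p q f =>
      induction y using weighted_induction with
      | hadd y y' hy hy' =>
        simp only [AddMonoidHom.coe_toIntLinearMap, smul_eq_mul, add_mul, map_add, mul_add]
          at hy hy' ⊢
        rw [hy, hy']
        ring
      | hwt p' q' f' =>
        simp only [AddMonoidHom.coe_toIntLinearMap, smul_eq_mul, wt_mul_wt, hT, Derivation.leibniz]
        rw [show p + (s + p') = s + (p + p') by ring, show q + (t + q') = t + (q + q') by ring,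
          show p' + (s + p) = s + (p + p') by ring, show q' + (t + q) = t + (q + q') by ring,
          ← wt_add]
        congr 1
        push_cast
        ring

lemma weightedDerivation_wt (s t : ℤ) (δ : Derivation ℂ R R) (a b : R) (p q : ℤ) (f : R) :
    weightedDerivation s t δ a b (wt p q f) =
      wt (s + p) (t + q) (δ f - (p * a + q * b) * f) :=
  Finsupp.liftAddHom_apply_single _ _ _

end Weighted

/-- The sign of a dyad index: a component with `i` indices `0` and `j` indices `1` has weight
`i - j`. -/
def sgn (A : Fin 2) : ℤ := if A = 0 then 1 else -1

namespace SpinFrame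

variable {R : Type*} [CommRing R] [Algebra ℂ R] (S : SpinFrame R)

/-! ### The GHP operators of a spin frame -/

/-- The GHP derivatives. -/
def Θ (A A' : Fin 2) : Derivation ℤ (Weighted R) (Weighted R) :=
  weightedDerivation (sgn A) (sgn A') (S.d A A') (S.Γ A A' 0 0) (S.Γ' A A' 0 0)

/-- The Bianchi identities for `Ψ₂` when `Ψ₀ = Ψ₁ = 0`. -/
structure WeylBianchi (Lam : R) : Prop where
  kappa : 3 * S.Ψ₂ Lam * S.Γ 0 0 0 1 = 0
  sigma : 3 * S.Ψ₂ Lam * S.Γ 0 1 0 1 = 0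
  d00 : S.d 0 0 (S.Ψ₂ Lam) = 2 * S.Γ 0 0 0 1 * S.Ψ₃ - 3 * S.Γ 1 0 0 1 * S.Ψ₂ Lam
  d01 : S.d 0 1 (S.Ψ₂ Lam) = 2 * S.Γ 0 1 0 1 * S.Ψ₃ - 3 * S.Γ 1 1 0 1 * S.Ψ₂ Lam
  d10 : S.d 1 0 (S.Ψ₂ Lam) = S.d 0 0 S.Ψ₃ + 2 * S.Γ 0 0 0 0 * S.Ψ₃ + 2 * S.Γ 1 0 0 1 * S.Ψ₃
    - 3 * S.Γ 0 0 1 0 * S.Ψ₂ Lam - S.Γ 0 0 0 1 * S.Ψ₄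
  d11 : S.d 1 1 (S.Ψ₂ Lam) = S.d 0 1 S.Ψ₃ + 2 * S.Γ 0 1 0 0 * S.Ψ₃ + 2 * S.Γ 1 1 0 1 * S.Ψ₃
    - 3 * S.Γ 0 1 1 0 * S.Ψ₂ Lam - S.Γ 0 1 0 1 * S.Ψ₄

variable {S} in
lemma IsLeviCivita.Γ_one_one (hS : S.IsLeviCivita) (A A' : Fin 2) :
    S.Γ A A' 1 1 = -S.Γ A A' 0 0 := by
  linear_combination hS.trace A A'

variable {S} in
lemma IsLeviCivita.Γ'_one_one (hS : S.IsLeviCivita) (A A' : Fin 2) :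
    S.Γ' A A' 1 1 = -S.Γ' A A' 0 0 := by
  linear_combination hS.trace' A A'

variable {S} in
lemma IsEinstein.weylBianchi {Lam : R} (hE : S.IsEinstein Lam) (hS : S.IsLeviCivita)
    (h₀ : S.Ψ₀ = 0) (h₁ : S.Ψ₁ = 0) : S.WeylBianchi Lam := by
  have hc := hE.einsteinCurvature hS
  have lm01 : S.curv 0 0 0 1 0 1 = 0 := by rw [Ψ₀] at h₀; linear_combination -h₀
  have lm00 : S.curv 0 0 0 1 0 0 = 0 := h₁
  have lm10 : S.curv 0 0 0 1 1 0 = S.Ψ₂ Lam + 2 * Lam := by rw [Ψ₂]; ring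
  have bn00 : S.curv 1 0 1 1 0 0 = S.Ψ₃ := rfl
  have bn10 : S.curv 1 0 1 1 1 0 = S.Ψ₄ := rfl
  have sw₁ := S.curv_swap 0 1 0 0
  have sw₂ := S.curv_swap 1 0 0 0
  have sw₃ := S.curv_swap 1 1 0 0
  have sw₄ := S.curv_swap 1 0 0 1
  have sw₅ := S.curv_swap 1 1 0 1
  have sw₆ := S.curv_swap 1 1 1 0
  have d_two : ∀ A A', S.d A A' 2 = 0 := fun A A' => by simpa using (S.d A A').map_natCast 2
  have lmb01 := hS.secondBianchi 0 0 0 1 1 0 0 1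
  have lmb00 := hS.secondBianchi 0 0 0 1 1 0 0 0
  have lmb10 := hS.secondBianchi 0 0 0 1 1 0 1 0
  have lmn01 := hS.secondBianchi 0 0 0 1 1 1 0 1
  have lmn00 := hS.secondBianchi 0 0 0 1 1 1 0 0
  have lmn10 := hS.secondBianchi 0 0 0 1 1 1 1 0
  simp [sw₁, sw₂, sw₃, sw₄, sw₅, sw₆, hS.curv_trace, hc.lb01, hc.lb00, hc.lb10, hc.mn01, hc.mn00,
    hc.mn10, hc.ln01, hc.ln00, hc.ln10, hc.mb01, hc.mb00, hc.mb10, hc.bn01, lm01, lm00, lm10, bn00,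
    bn10, h₁, c, conn, hS.Γ_one_one, hS.Γ'_one_one, hE.const, S.curv_self, d_two]
    at lmb01 lmb00 lmb10 lmn01 lmn00 lmn10
  exact {
    kappa := by linear_combination -lmb01
    sigma := by linear_combination -lmn01
    d00 := by linear_combination -lmb00
    d01 := by linear_combination -lmn00
    d10 := by linear_combination lmb10
    d11 := by linear_combination lmn10 }

/-- The frame is adapted to a repeated principal spinor of an Einstein spacetime, and `κ = σ = 0`;
the same holds for the exchanged frame. -/
structure IsTypeII (Lam : R) : Prop where
  isLeviCivita : S.IsLeviCivita
  isEinstein : S.IsEinstein Lam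
  Ψ₀_eq_zero : S.Ψ₀ = 0
  Ψ₁_eq_zero : S.Ψ₁ = 0
  kappa : S.Γ 0 0 0 1 = 0
  sigma : S.Γ 0 1 0 1 = 0
  swap_Ψ₀_eq_zero : S.swap.Ψ₀ = 0
  swap_Ψ₁_eq_zero : S.swap.Ψ₁ = 0
  swap_kappa : S.swap.Γ 0 0 0 1 = 0
  swap_sigma : S.swap.Γ 0 1 0 1 = 0

variable {S}

lemma IsTypeII.swap {Lam : R} (h : S.IsTypeII Lam) : S.swap.IsTypeII Lam :=
  ⟨h.isLeviCivita.swap, h.isEinstein.swap, h.swap_Ψ₀_eq_zero, h.swap_Ψ₁_eq_zero, h.swap_kappa,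
    h.swap_sigma, h.Ψ₀_eq_zero, h.Ψ₁_eq_zero, h.kappa, h.sigma⟩

end SpinFrame

lemma derivation_ofNat {B : Type*} [CommRing B] (D : Derivation ℤ B B) (n : ℕ) [n.AtLeastTwo] :
    D (ofNat(n) : B) = 0 := by
  rw [← Nat.cast_ofNat (R := B) (n := n)]
  exact D.map_natCast n

/-- The GHP calculus of an Einstein spacetime of Petrov type II, in a principal dyad. Weighted
scalars are elements of a commutative ring, on which the GHP operators `þ`, `ð`, `ð'`, `þ'` are the
derivations `th`, `ed`, `edp`, `thp`; the derivations `P`, `Q` multiply a scalar of weight `{p,q}` by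
`p` and `q`. A final `p` of a name stands for a prime, a final `b` for complex conjugation. -/
structure TypeIICalculus (B : Type*) [CommRing B] where
  (th ed edp thp P Q : Derivation ℤ B B)
  (r t rb tb rp tp sp kp rpb tpb spb kpb Ψ₂ Ψ₃ Ψ₂b Ψ₃b Λ : B)
  th_thp : ∀ x, th (thp x) = thp (th x) + (tb - tp) * ed x + (t - tpb) * edp x
    - (Ψ₂ - t * tp - Λ) * P x - (Ψ₂b - tb * tpb - Λ) * Q x
  th_ed : ∀ x, th (ed x) = ed (th x) + rb * ed x - tpb * th x + rb * tpb * Q x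
  th_edp : ∀ x, th (edp x) = edp (th x) + r * edp x - tp * th x + r * tp * P x
  ed_edp : ∀ x, ed (edp x) = edp (ed x) + (rpb - rp) * th x + (r - rb) * thp x
    + (r * rp + Ψ₂ - Λ) * P x - (rb * rpb + Ψ₂b - Λ) * Q x
  edp_thp : ∀ x, edp (thp x) = thp (edp x) - rpb * edp x - sp * ed x + tb * thp x + kp * th x
    - (r * kp - t * sp + Ψ₃) * P x + rpb * tb * Q x
  ed_thp : ∀ x, ed (thp x) = thp (ed x) - rp * ed x - spb * edp x + t * thp x + kpb * th x
    - (rb * kpb - tb * spb + Ψ₃b) * Q x + rp * t * P x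
  P_th : ∀ x, P (th x) = th (P x) + th x
  P_ed : ∀ x, P (ed x) = ed (P x) + ed x
  Q_th : ∀ x, Q (th x) = th (Q x) + th x
  Q_ed : ∀ x, Q (ed x) = ed (Q x) - ed x
  P_r : P r = r
  Q_r : Q r = r
  P_t : P t = t
  Q_t : Q t = -t
  P_rb : P rb = rb
  Q_rb : Q rb = rb
  Q_tb : Q tb = tb
  P_tpb : P tpb = tpb
  Q_tpb : Q tpb = -tpb
  P_spb : P spb = spb
  th_Λ : th Λ = 0
  ed_Λ : ed Λ = 0
  edp_Λ : edp Λ = 0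
  thp_Λ : thp Λ = 0
  th_r : th r = r * r
  ed_r : ed r = t * (r - rb)
  thp_r : thp r = edp t + r * rpb - t * tb - Ψ₂ - 2 * Λ
  th_t : th t = r * (t - tpb)
  ed_t : ed t = t * t - spb * r
  th_rb : th rb = rb * rb
  edp_rb : edp rb = tb * (rb - r)
  thp_rb : thp rb = ed tb + rb * rp - t * tb - Ψ₂b - 2 * Λ
  th_tb : th tb = rb * (tb - tp)
  edp_tb : edp tb = tb * tb - sp * rb
  ed_rpb : ed rpb = edp spb + (rpb - rp) * tpb + (r - rb) * kpb - Ψ₃b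
  th_rp : th rp = ed tp + rp * rb - tp * tpb - Ψ₂ - 2 * Λ
  th_rpb : th rpb = edp tpb + rpb * r - tp * tpb - Ψ₂b - 2 * Λ
  thp_rpb : thp rpb = edp kpb + rpb * rpb + sp * spb - kp * tpb - tb * kpb
  th_spb : th spb = ed tpb + rb * spb - tpb * tpb
  thp_tpb : thp tpb = th kpb + (tpb - t) * rpb + (tp - tb) * spb + Ψ₃b
  th_Ψ₂ : th Ψ₂ = 3 * r * Ψ₂
  ed_Ψ₂ : ed Ψ₂ = 3 * t * Ψ₂
  edp_Ψ₂ : edp Ψ₂ = th Ψ₃ + 3 * tp * Ψ₂ - 2 * r * Ψ₃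
  thp_Ψ₂ : thp Ψ₂ = ed Ψ₃ + 3 * rp * Ψ₂ - 2 * t * Ψ₃
  th_Ψ₂b : th Ψ₂b = 3 * rb * Ψ₂b
  edp_Ψ₂b : edp Ψ₂b = 3 * tb * Ψ₂b

namespace TypeIICalculus

variable {B : Type*} [CommRing B] (G : TypeIICalculus B)

/-- The operator `O†`. -/
def Odag (x : B) : B :=
  2 * ((G.thp (G.th x + 3 * G.r * x) - G.rpb * (G.th x + 3 * G.r * x))
    - (G.edp (G.ed x + 3 * G.t * x) - G.tb * (G.ed x + 3 * G.t * x)) - 3 * G.Ψ₂ * x)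

/-- The component `h_{nn}` of `S†χ`. -/
def hnn (x : B) : B := -(G.ed (G.ed x) + 2 * G.t * G.ed x) - G.spb * G.th x

/-- The component `h_{nm̄}` of `S†χ`. -/
def hnmb (x : B) : B := -(G.th (G.ed x) + G.r * G.ed x) - (G.t + G.tpb) * G.th x

/-- The component `h_{m̄m̄}` of `S†χ`. -/
def hmbmb (x : B) : B := -(G.th (G.th x) + 2 * G.r * G.th x)

lemma Odag_eq (x : B) : G.Odag x = 2 * (G.thp (G.th x) - G.edp (G.ed x) - G.rpb * G.th x
    + G.tb * G.ed x + 3 * G.r * G.thp x - 3 * G.t * G.edp x - 6 * (G.Ψ₂ + G.Λ) * x) := by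
  simp only [Odag, map_add, Derivation.leibniz, smul_eq_mul, derivation_ofNat, G.thp_r]
  ring

lemma thp_edp_r : G.thp (G.edp G.r) = G.edp (G.edp G.t) + G.r * G.edp G.rpb
    + 2 * G.rpb * G.edp G.r - 2 * G.tb * G.edp G.t - G.th G.Ψ₃ - 3 * G.tp * G.Ψ₂ + 3 * G.r * G.Ψ₃
    - 2 * G.r * G.rpb * G.tb + G.tb * G.Ψ₂ + 2 * G.tb * G.Λ := by
  have h := G.edp_thp G.r
  simp only [G.thp_r, map_add, map_sub, Derivation.leibniz, smul_eq_mul, derivation_ofNat,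
    G.edp_Λ, G.edp_Ψ₂, G.edp_tb, G.th_r, G.ed_r, G.P_r, G.Q_r] at h
  linear_combination -h

lemma edp_ed_rb : G.edp (G.ed G.rb) = 2 * (G.rb - G.r) * G.ed G.tb + G.tb * G.ed G.rb
    + 2 * G.rp * G.rb * (G.rb - G.r) + G.r * G.Ψ₂b - G.rb * G.Ψ₂ + 2 * G.Λ * (G.r - G.rb) := by
  have h := G.ed_edp G.rb
  simp only [G.edp_rb, map_sub, Derivation.leibniz, smul_eq_mul, G.thp_rb, G.th_rb, G.ed_r, G.P_rb,
    G.Q_rb] at h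
  linear_combination -h

end TypeIICalculus

lemma update_two (b c v : Fin 2) :
    Function.update ![b, c] 0 v = ![v, c] ∧ Function.update ![b, c] 1 v = ![b, v] := by
  constructor <;> ext i <;> fin_cases i <;> rfl

lemma update_three (b c d v : Fin 2) : Function.update ![b, c, d] 0 v = ![v, c, d] ∧
    Function.update ![b, c, d] 1 v = ![b, v, d] ∧ Function.update ![b, c, d] 2 v = ![b, c, v] := by
  refine ⟨?_, ?_, ?_⟩ <;> ext i <;> fin_cases i <;> rfl

namespace TypeIICalculus

variable {B : Type*} [CommRing B] (G : TypeIICalculus B)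

/-! ### Spinor fields in the GHP calculus -/

/-- The GHP derivative along the tetrad vector `e_{AA'}`. -/
def Θ (A A' : Fin 2) : Derivation ℤ B B :=
  (!![G.th, G.ed; G.edp, G.thp] : Matrix (Fin 2) (Fin 2) (Derivation ℤ B B)) A A'

/-- The off-diagonal connection component `Γ_{AA' C}{}^E` with `E ≠ C`. -/
def γ (A A' C : Fin 2) : B :=
  if C = 0 then (!![0, 0; -G.r, -G.t] : Matrix (Fin 2) (Fin 2) B) A A'
  else (!![-G.tp, -G.rp; -G.sp, -G.kp] : Matrix (Fin 2) (Fin 2) B) A A'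

/-- The off-diagonal component `Γ̄_{AA' C'}{}^{E'}`, `E' ≠ C'`, of the conjugate connection. -/
def γ' (A A' C' : Fin 2) : B :=
  if C' = 0 then (!![0, -G.rb; 0, -G.tb] : Matrix (Fin 2) (Fin 2) B) A A'
  else (!![-G.tpb, -G.spb; -G.rpb, -G.kpb] : Matrix (Fin 2) (Fin 2) B) A A'

/-- The covariant derivative of a spinor field with weighted components. -/
def nabla {r s : ℕ} (T : (Fin r → Fin 2) → (Fin s → Fin 2) → B)
    (K : Fin (r + 1) → Fin 2) (K' : Fin (s + 1) → Fin 2) : B :=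
  G.Θ (K 0) (K' 0) (T (Fin.tail K) (Fin.tail K'))
    - (∑ i : Fin r, G.γ (K 0) (K' 0) (Fin.tail K i) *
        T (Function.update (Fin.tail K) i (1 - Fin.tail K i)) (Fin.tail K'))
    - (∑ i : Fin s, G.γ' (K 0) (K' 0) (Fin.tail K' i) *
        T (Fin.tail K) (Function.update (Fin.tail K') i (1 - Fin.tail K' i)))

/-- The components of `S†χ`. -/
def hDebye (x : B) (K K' : Fin 2 → Fin 2) : B :=
  if K 0 = 1 ∧ K 1 = 1 then
    (!![G.hmbmb x, G.hnmb x; G.hnmb x, G.hnn x] : Matrix (Fin 2) (Fin 2) B) (K' 0) (K' 1)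
  else 0

/-- The spinor `∇_A{}^{A'} ∇_B{}^{B'} h_{CDA'B'}` for `h = S†χ`. -/
def ddh (x : B) (k : Fin 4 → Fin 2) : B :=
  G.nabla (G.nabla (G.hDebye x)) k ![1, 1, 0, 0] - G.nabla (G.nabla (G.hDebye x)) k ![1, 0, 0, 1]
    - G.nabla (G.nabla (G.hDebye x)) k ![0, 1, 1, 0]
    + G.nabla (G.nabla (G.hDebye x)) k ![0, 0, 1, 1]

lemma nabla_two (T : (Fin 2 → Fin 2) → (Fin 2 → Fin 2) → B) (a b c a' b' c' : Fin 2) :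
    G.nabla T ![a, b, c] ![a', b', c'] = G.Θ a a' (T ![b, c] ![b', c'])
      - (G.γ a a' b * T ![1 - b, c] ![b', c'] + G.γ a a' c * T ![b, 1 - c] ![b', c'])
      - (G.γ' a a' b' * T ![b, c] ![1 - b', c'] + G.γ' a a' c' * T ![b, c] ![b', 1 - c']) := by
  simp [nabla, Fin.sum_univ_succ, update_two]

lemma nabla_three (T : (Fin 3 → Fin 2) → (Fin 3 → Fin 2) → B) (a b c d a' b' c' d' : Fin 2) :
    G.nabla T ![a, b, c, d] ![a', b', c', d'] = G.Θ a a' (T ![b, c, d] ![b', c', d'])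
      - (G.γ a a' b * T ![1 - b, c, d] ![b', c', d']
        + G.γ a a' c * T ![b, 1 - c, d] ![b', c', d']
        + G.γ a a' d * T ![b, c, 1 - d] ![b', c', d'])
      - (G.γ' a a' b' * T ![b, c, d] ![1 - b', c', d']
        + G.γ' a a' c' * T ![b, c, d] ![b', 1 - c', d']
        + G.γ' a a' d' * T ![b, c, d] ![b', c', 1 - d']) := by
  simp [nabla, Fin.sum_univ_succ, update_three]
  ring

lemma ddh_zero (x : B) : G.ddh x ![0, 0, 0, 0] = 0 := by
  simp [ddh, nabla_three, nabla_two, hDebye, γ, Θ]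

lemma ddh_one (x : B) : G.ddh x ![1, 0, 0, 0] + G.ddh x ![0, 1, 0, 0] + G.ddh x ![0, 0, 1, 0]
    + G.ddh x ![0, 0, 0, 1] = 0 := by
  simp [ddh, nabla_three, nabla_two, hDebye, γ, γ', Θ]

end TypeIICalculus

namespace TypeIICalculus

variable {B : Type*} [CommRing B] (G : TypeIICalculus B)

set_option maxHeartbeats 4000000 in
theorem ddh_two (x : B) (hQ : G.Q x = 0) :
    G.ddh x ![1, 1, 0, 0] + G.ddh x ![1, 0, 1, 0] + G.ddh x ![1, 0, 0, 1] + G.ddh x ![0, 1, 1, 0]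
      + G.ddh x ![0, 1, 0, 1] + G.ddh x ![0, 0, 1, 1] = 0 := by
  simp [ddh, nabla_three, nabla_two, hDebye, γ, γ', Θ]
  simp only [hnn, hnmb, hmbmb, hQ, map_add, map_sub, map_neg, map_zero, Derivation.leibniz,
    smul_eq_mul, derivation_ofNat, G.th_ed, G.Q_th, G.Q_ed, G.Q_rb, G.Q_tpb, G.th_r, G.ed_r,
    G.th_t, G.ed_t, G.th_rb, G.th_spb]
  ring

set_option maxHeartbeats 4000000 in
theorem ddh_three (x : B) (hP : G.P x = -(4 * x)) (hQ : G.Q x = 0) :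
    G.ddh x ![1, 1, 1, 0] + G.ddh x ![1, 1, 0, 1] + G.ddh x ![1, 0, 1, 1] + G.ddh x ![0, 1, 1, 1] =
      -2 * (G.t * G.th (G.Odag x) - G.r * G.ed (G.Odag x)) := by
  simp [ddh, nabla_three, nabla_two, hDebye, γ, γ', Θ]
  simp only [G.Odag_eq, hnn, hnmb, hmbmb, hP, hQ, map_add, map_sub, map_neg, map_zero,
    Derivation.leibniz, smul_eq_mul, derivation_ofNat, G.th_thp, G.th_ed, G.th_edp, G.ed_edp,
    G.ed_thp, G.P_th, G.P_ed, G.Q_th, G.Q_ed, G.P_r, G.Q_r, G.P_t, G.Q_t, G.Q_tb, G.P_tpb,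
    G.Q_tpb, G.P_spb, G.th_Λ, G.ed_Λ, G.th_r, G.ed_r, G.thp_r, G.th_t, G.ed_t, G.th_rb, G.edp_rb,
    G.thp_rb, G.th_tb, G.ed_rpb, G.th_rp, G.th_rpb, G.th_spb, G.thp_tpb, G.th_Ψ₂, G.ed_Ψ₂,
    G.th_Ψ₂b, G.edp_ed_rb]
  ring

set_option maxHeartbeats 4000000 in
theorem ddh_four (x : B) (hP : G.P x = -(4 * x)) (hQ : G.Q x = 0) :
    4 * G.ddh x ![1, 1, 1, 1] =
    -(-12 * G.Ψ₂ * G.r * G.thp x + 12 * G.Ψ₂ * G.t * G.edp x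
       - (12 * G.Ψ₂ * G.tp - 16 * G.Ψ₃ * G.r + 4 * G.th G.Ψ₃) * G.ed x
       + (12 * G.Ψ₂ * G.rp - 16 * G.Ψ₃ * G.t + 4 * G.ed G.Ψ₃) * G.th x)
    - 24 * G.Ψ₂ ^ 2 * x - 48 * G.Ψ₂ * G.Λ * x
    - (G.Odag (G.Odag x) - 8 * G.r * G.thp (G.Odag x) + 8 * G.t * G.edp (G.Odag x)
      + 16 * G.Ψ₂ * G.Odag x + 20 * G.Λ * G.Odag x) := by
  simp [ddh, nabla_three, nabla_two, hDebye, γ, γ', Θ]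
  simp only [G.Odag_eq, hnn, hnmb, hmbmb, hP, hQ, map_add, map_sub, map_neg, map_zero,
    Derivation.leibniz, smul_eq_mul, derivation_ofNat, G.th_thp, G.th_ed, G.th_edp, G.ed_edp,
    G.edp_thp, G.ed_thp, G.P_th, G.P_ed, G.Q_th, G.Q_ed, G.P_t, G.Q_t, G.th_Λ, G.ed_Λ, G.edp_Λ,
    G.thp_Λ, G.th_r, G.ed_r, G.thp_r, G.th_t, G.ed_t, G.th_rb, G.edp_rb, G.thp_rb, G.th_tb,
    G.edp_tb, G.ed_rpb, G.th_rpb, G.thp_rpb, G.th_spb, G.thp_tpb, G.th_Ψ₂, G.ed_Ψ₂, G.edp_Ψ₂,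
    G.thp_Ψ₂, G.edp_Ψ₂b, G.thp_edp_r]
  ring

end TypeIICalculus

namespace TypeIICalculus

variable {B : Type*} [CommRing B] (G : TypeIICalculus B)

/-! ### The projected Killing vector -/

/-- The components of the Killing spinor, where `c₂ = 1/2`, `c₃ = 1/3` and `fi = Ψ₂^{-1/3}`. -/
def killingSpinor (c₂ c₃ fi : B) (K : Fin 2 → Fin 2) (_ : Fin 0 → Fin 2) : B :=
  (!![0, -(c₂ * fi); -(c₂ * fi), -(c₃ * (fi ^ 4 * G.Ψ₃))] : Matrix (Fin 2) (Fin 2) B) (K 0) (K 1)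

/-- The components of the projected Killing vector. -/
def xi (c₂ c₃ fi : B) (A A' : Fin 2) : B :=
  G.nabla (G.killingSpinor c₂ c₃ fi) ![1, A, 0] ![A']
    - G.nabla (G.killingSpinor c₂ c₃ fi) ![0, A, 1] ![A']

/-- The derivative along the projected Killing vector. -/
def xiTheta (c₂ c₃ fi x : B) : B :=
  G.xi c₂ c₃ fi 0 0 * G.thp x - G.xi c₂ c₃ fi 0 1 * G.edp x - G.xi c₂ c₃ fi 1 0 * G.ed x
    + G.xi c₂ c₃ fi 1 1 * G.th x

lemma nabla_two_zero (T : (Fin 2 → Fin 2) → (Fin 0 → Fin 2) → B) (a b c a' : Fin 2) :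
    G.nabla T ![a, b, c] ![a'] = G.Θ a a' (T ![b, c] ![])
      - (G.γ a a' b * T ![1 - b, c] ![] + G.γ a a' c * T ![b, 1 - c] ![]) := by
  simp [nabla, Fin.sum_univ_succ, update_two, Subsingleton.elim (Fin.tail ![a']) ![]]

lemma derivation_eq_zero_of_mul_eq_one (d : Derivation ℤ B B) {n : ℕ} {c : B}
    (h : (n : B) * c = 1) : d c = 0 := by
  have e := congrArg d h
  simp only [Derivation.leibniz, smul_eq_mul, Derivation.map_natCast, Derivation.map_one_eq_zero]
    at e
  linear_combination c * e - d c * h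

lemma derivation_cubeRoot_inv (d : Derivation ℤ B B) {c₃ f fi : B} (h₃ : 3 * c₃ = 1)
    (hfi : f * fi = 1) (hf : f ^ 3 = G.Ψ₂) : f ^ 4 * d fi = -(c₃ * d G.Ψ₂) := by
  have e := congrArg d hfi
  rw [← hf]
  simp only [Derivation.leibniz, smul_eq_mul, Derivation.leibniz_pow, Derivation.map_one_eq_zero]
    at e ⊢
  simp
  linear_combination f ^ 3 * e - f ^ 2 * d f * hfi + f ^ 2 * d f * h₃

lemma two_mul_xi {c₂ c₃ f fi : B} (h₂ : 2 * c₂ = 1) (h₃ : 3 * c₃ = 1) (hfi : f * fi = 1)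
    (hf : f ^ 3 = G.Ψ₂) :
    2 * (f ^ 4 * G.xi c₂ c₃ fi 0 0) = -(3 * G.Ψ₂ * G.r) ∧
    2 * (f ^ 4 * G.xi c₂ c₃ fi 0 1) = -(3 * G.Ψ₂ * G.t) ∧
    2 * (f ^ 4 * G.xi c₂ c₃ fi 1 0) = 3 * G.Ψ₂ * G.tp - 4 * G.Ψ₃ * G.r + G.th G.Ψ₃ ∧
    2 * (f ^ 4 * G.xi c₂ c₃ fi 1 1) = 3 * G.Ψ₂ * G.rp - 4 * G.Ψ₃ * G.t + G.ed G.Ψ₃ := by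
  have d₂ := fun d => derivation_eq_zero_of_mul_eq_one d (n := 2) (c := c₂) (by exact_mod_cast h₂)
  have d₃ := fun d => derivation_eq_zero_of_mul_eq_one d (n := 3) (c := c₃) (by exact_mod_cast h₃)
  have eth := G.derivation_cubeRoot_inv G.th h₃ hfi hf
  have eed := G.derivation_cubeRoot_inv G.ed h₃ hfi hf
  have eedp := G.derivation_cubeRoot_inv G.edp h₃ hfi hf
  have ethp := G.derivation_cubeRoot_inv G.thp h₃ hfi hf
  rw [G.th_Ψ₂] at eth
  rw [G.ed_Ψ₂] at eed
  rw [G.edp_Ψ₂] at eedp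
  rw [G.thp_Ψ₂] at ethp
  have k₁ : f ^ 4 * fi = G.Ψ₂ := by linear_combination f ^ 3 * hfi + hf
  have k₃ : fi ^ 3 * G.Ψ₂ = 1 := by
    rw [← hf, ← mul_pow, mul_comm, hfi, one_pow]
  have k₄ : f ^ 4 * fi ^ 4 = 1 := by rw [← mul_pow, hfi, one_pow]
  refine ⟨?_, ?_, ?_, ?_⟩ <;> simp [xi, nabla_two_zero, killingSpinor, Θ, γ, d₂, d₃]
  · linear_combination (-2 * G.r * f ^ 4 * fi + f ^ 4 * G.th fi) * h₂ - 2 * G.r * k₁ + eth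
      - G.r * G.Ψ₂ * h₃
  · linear_combination (-2 * G.t * f ^ 4 * fi + f ^ 4 * G.ed fi) * h₂ - 2 * G.t * k₁ + eed
      - G.t * G.Ψ₂ * h₃
  · linear_combination -2 * c₂ * eedp + (-2 * G.r * c₃ * G.Ψ₃ + 2 * c₃ * G.th G.Ψ₃) * k₄
      + 8 * c₃ * G.Ψ₃ * fi ^ 3 * eth - 8 * c₃ * G.Ψ₃ * G.r * k₃ + 4 * G.tp * c₂ * k₁
      - 8 * c₃ * G.Ψ₃ * G.r * fi ^ 3 * G.Ψ₂ * h₃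
      + (c₃ * (G.th G.Ψ₃ + 3 * G.tp * G.Ψ₂ - 2 * G.r * G.Ψ₃) + 2 * G.tp * G.Ψ₂) * h₂
      + (G.th G.Ψ₃ + G.tp * G.Ψ₂ - 4 * G.r * G.Ψ₃) * h₃
  · linear_combination -2 * c₂ * ethp + (-2 * G.t * c₃ * G.Ψ₃ + 2 * c₃ * G.ed G.Ψ₃) * k₄
      + 8 * c₃ * G.Ψ₃ * fi ^ 3 * eed - 8 * c₃ * G.Ψ₃ * G.t * k₃ + 4 * G.rp * c₂ * k₁
      - 8 * c₃ * G.Ψ₃ * G.t * fi ^ 3 * G.Ψ₂ * h₃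
      + (c₃ * (G.ed G.Ψ₃ + 3 * G.rp * G.Ψ₂ - 2 * G.t * G.Ψ₃) + 2 * G.rp * G.Ψ₂) * h₂
      + (G.ed G.Ψ₃ + G.rp * G.Ψ₂ - 4 * G.t * G.Ψ₃) * h₃

/-- The component `Ψ̇₄` in terms of the projected Killing vector. -/
theorem ddh_four_eq {c₂ c₃ f fi : B} (h₂ : 2 * c₂ = 1) (h₃ : 3 * c₃ = 1) (hfi : f * fi = 1)
    (hf : f ^ 3 = G.Ψ₂) (x : B) (hP : G.P x = -(4 * x)) (hQ : G.Q x = 0) :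
    4 * G.ddh x ![1, 1, 1, 1] = -(8 * (f ^ 4 * G.xiTheta c₂ c₃ fi x) + 24 * G.Ψ₂ ^ 2 * x
        + 48 * G.Ψ₂ * G.Λ * x)
      - (G.Odag (G.Odag x) - 8 * G.r * G.thp (G.Odag x) + 8 * G.t * G.edp (G.Odag x)
        + 16 * G.Ψ₂ * G.Odag x + 20 * G.Λ * G.Odag x) := by
  obtain ⟨e₁, e₂, e₃, e₄⟩ := G.two_mul_xi h₂ h₃ hfi hf
  rw [G.ddh_four x hP hQ, xiTheta]
  linear_combination 4 * G.thp x * e₁ - 4 * G.edp x * e₂ - 4 * G.ed x * e₃ + 4 * G.th x * e₄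

end TypeIICalculus

lemma wt_inj {R : Type*} [CommRing R] (p q : ℤ) (f g : R) : wt p q f = wt p q g ↔ f = g :=
  (wt_injective p q).eq_iff

namespace SpinFrame

variable {R : Type*} [CommRing R] [Algebra ℂ R]

/-! ### The GHP calculus of a type II spin frame -/

lemma swap_d (S : SpinFrame R) (A A' : Fin 2) : S.swap.d A A' = S.d A' A := rfl
lemma swap_Γ (S : SpinFrame R) (A A' B C : Fin 2) : S.swap.Γ A A' B C = S.Γ' A' A B C := rfl
lemma swap_Γ' (S : SpinFrame R) (A A' B C : Fin 2) : S.swap.Γ' A A' B C = S.Γ A' A B C := rfl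

variable {S : SpinFrame R} {Lam : R}

lemma IsTypeII.connection (h : S.IsTypeII Lam) :
    (∀ A A', S.Γ A A' 1 1 = -S.Γ A A' 0 0) ∧ (∀ A A', S.Γ' A A' 1 1 = -S.Γ' A A' 0 0) ∧
    S.Γ 0 0 0 1 = 0 ∧ S.Γ 0 1 0 1 = 0 ∧ S.Γ' 0 0 0 1 = 0 ∧ S.Γ' 1 0 0 1 = 0 :=
  ⟨h.isLeviCivita.Γ_one_one, h.isLeviCivita.Γ'_one_one, h.kappa, h.sigma, h.swap_kappa,
    h.swap_sigma⟩

lemma IsTypeII.einsteinCurvature (h : S.IsTypeII Lam) : S.EinsteinCurvature Lam :=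
  h.isEinstein.einsteinCurvature h.isLeviCivita

lemma IsTypeII.weylBianchi (h : S.IsTypeII Lam) : S.WeylBianchi Lam :=
  h.isEinstein.weylBianchi h.isLeviCivita h.Ψ₀_eq_zero h.Ψ₁_eq_zero

lemma curv_lm10 (S : SpinFrame R) (Lam : R) :
    S.curv 0 0 0 1 1 0 = S.Ψ₂ Lam + 2 * Lam := by
  rw [Ψ₂]; ring

lemma curv_bn00 (S : SpinFrame R) : S.curv 1 0 1 1 0 0 = S.Ψ₃ := rfl

attribute [local simp] Θ sgn weightedDerivation_wt wt_mul_wt wt_inj ofNat_eq_wt curv c conn swap_d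
  swap_Γ swap_Γ' sub_mul add_mul

set_option maxHeartbeats 1000000 in
/-- The weighted scalars of a type II spin frame form a GHP calculus. -/
def IsTypeII.calculus (h : S.IsTypeII Lam) : TypeIICalculus (Weighted R) where
  th := S.Θ 0 0
  ed := S.Θ 0 1
  edp := S.Θ 1 0
  thp := S.Θ 1 1
  P := weightedDerivation 0 0 0 (-1) 0
  Q := weightedDerivation 0 0 0 0 (-1)
  r := wt 1 1 (-S.Γ 1 0 0 1)
  t := wt 1 (-1) (-S.Γ 1 1 0 1)
  rb := wt 1 1 (-S.Γ' 0 1 0 1)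
  tb := wt (-1) 1 (-S.Γ' 1 1 0 1)
  rp := wt (-1) (-1) (-S.Γ 0 1 1 0)
  tp := wt (-1) 1 (-S.Γ 0 0 1 0)
  sp := wt (-3) 1 (-S.Γ 1 0 1 0)
  kp := wt (-3) (-1) (-S.Γ 1 1 1 0)
  rpb := wt (-1) (-1) (-S.Γ' 1 0 1 0)
  tpb := wt 1 (-1) (-S.Γ' 0 0 1 0)
  spb := wt 1 (-3) (-S.Γ' 0 1 1 0)
  kpb := wt (-1) (-3) (-S.Γ' 1 1 1 0)
  Ψ₂ := wt 0 0 (S.Ψ₂ Lam)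
  Ψ₃ := wt (-2) 0 S.Ψ₃
  Ψ₂b := wt 0 0 (S.swap.Ψ₂ Lam)
  Ψ₃b := wt 0 (-2) S.swap.Ψ₃
  Λ := wt 0 0 Lam
  th_thp x := by
    induction x using weighted_induction with
    | hadd x y hx hy => simp only [map_add]; linear_combination hx + hy
    | hwt p q f =>
      have e := h.einsteinCurvature.ln00
      have e' := h.swap.einsteinCurvature.ln00
      have t := h.isLeviCivita.torsionFree 0 0 1 1 f
      simp [h.connection] at e e' t
      simp [← add_assoc]
      simp only [← wt_add, ← wt_sub, wt_inj]
      linear_combination t - p * f * e - q * f * e'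
  th_ed x := by
    induction x using weighted_induction with
    | hadd x y hx hy => simp only [map_add]; linear_combination hx + hy
    | hwt p q f =>
      have e := h.Ψ₁_eq_zero
      have e' := h.swap.einsteinCurvature.lb00
      have t := h.isLeviCivita.torsionFree 0 0 0 1 f
      simp [Ψ₁, h.connection] at e e' t
      simp [← add_assoc]
      simp only [← wt_add, ← wt_sub, wt_inj]
      linear_combination t - p * f * e - q * f * e'
  th_edp x := by
    induction x using weighted_induction with
    | hadd x y hx hy => simp only [map_add]; linear_combination hx + hy
    | hwt p q f =>
      have e := h.einsteinCurvature.lb00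
      have e' := h.swap_Ψ₁_eq_zero
      have t := h.isLeviCivita.torsionFree 0 0 1 0 f
      simp [Ψ₁, h.connection] at e e' t
      simp [← add_assoc]
      simp only [← wt_add, ← wt_sub, wt_inj]
      linear_combination t - p * f * e - q * f * e'
  ed_edp x := by
    induction x using weighted_induction with
    | hadd x y hx hy => simp only [map_add]; linear_combination hx + hy
    | hwt p q f =>
      have e := h.einsteinCurvature.mb00
      have e' := h.swap.einsteinCurvature.mb00
      have t := h.isLeviCivita.torsionFree 0 1 1 0 f
      simp [h.connection] at e e' t
      simp [← add_assoc]
      simp only [← wt_add, ← wt_sub, wt_inj]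
      linear_combination t - p * f * e + q * f * e'
  edp_thp x := by
    induction x using weighted_induction with
    | hadd x y hx hy => simp only [map_add]; linear_combination hx + hy
    | hwt p q f =>
      have e := curv_bn00 S
      have e' := h.swap.einsteinCurvature.mn00
      have t := h.isLeviCivita.torsionFree 1 0 1 1 f
      simp [h.connection] at e e' t
      simp [← add_assoc]
      simp only [← wt_add, ← wt_sub, wt_inj]
      linear_combination t - p * f * e - q * f * e'
  ed_thp x := by
    induction x using weighted_induction with
    | hadd x y hx hy => simp only [map_add]; linear_combination hx + hy
    | hwt p q f =>
      have e := h.einsteinCurvature.mn00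
      have e' := curv_bn00 S.swap
      have t := h.isLeviCivita.torsionFree 0 1 1 1 f
      simp [h.connection] at e e' t
      simp [← add_assoc]
      simp only [← wt_add, ← wt_sub, wt_inj]
      linear_combination t - p * f * e - q * f * e'
  P_th x := by
    induction x using weighted_induction with
    | hadd x y hx hy => simp only [map_add]; linear_combination hx + hy
    | hwt p q f =>
      simp
      simp only [← wt_add, wt_inj]
      ring
  P_ed x := by
    induction x using weighted_induction with
    | hadd x y hx hy => simp only [map_add]; linear_combination hx + hy
    | hwt p q f =>
      simp
      simp only [← wt_add, wt_inj]
      ring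
  Q_th x := by
    induction x using weighted_induction with
    | hadd x y hx hy => simp only [map_add]; linear_combination hx + hy
    | hwt p q f =>
      simp
      simp only [← wt_add, wt_inj]
      ring
  Q_ed x := by
    induction x using weighted_induction with
    | hadd x y hx hy => simp only [map_add]; linear_combination hx + hy
    | hwt p q f =>
      simp
      simp only [← wt_sub, wt_inj]
      ring
  P_r := by simp
  Q_r := by simp
  P_t := by simp
  Q_t := by simp [← wt_neg]
  P_rb := by simp
  Q_rb := by simp
  Q_tb := by simp
  P_tpb := by simp
  Q_tpb := by simp [← wt_neg]
  P_spb := by simp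
  th_Λ := by simp [h.isEinstein.const, wt_zero]
  ed_Λ := by simp [h.isEinstein.const, wt_zero]
  edp_Λ := by simp [h.isEinstein.const, wt_zero]
  thp_Λ := by simp [h.isEinstein.const, wt_zero]
  th_r := by
    have e := h.einsteinCurvature.lb01
    simp [h.connection] at e
    simp
    linear_combination -e
  ed_r := by
    have e := h.einsteinCurvature.mb01
    simp [h.connection, h.Ψ₁_eq_zero] at e
    simp [mul_sub]
    simp only [← wt_sub, wt_inj]
    linear_combination -e
  thp_r := by
    have e := h.einsteinCurvature.bn01
    simp [h.connection] at e
    simp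
    simp only [← wt_add, ← wt_sub, wt_inj]
    linear_combination e
  th_t := by
    have e := h.einsteinCurvature.ln01
    simp [h.connection, h.Ψ₁_eq_zero] at e
    simp [mul_sub]
    simp only [← wt_sub, wt_inj]
    linear_combination -e
  ed_t := by
    have e := h.einsteinCurvature.mn01
    simp [h.connection] at e
    simp
    simp only [← wt_sub, wt_inj]
    linear_combination -e
  th_rb := by
    have e := h.swap.einsteinCurvature.lb01
    simp [h.connection] at e
    simp
    linear_combination -e
  edp_rb := by
    have e := h.swap.einsteinCurvature.mb01
    simp [h.connection, h.swap_Ψ₁_eq_zero] at e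
    simp [mul_sub]
    simp only [← wt_sub, wt_inj]
    linear_combination -e
  thp_rb := by
    have e := h.swap.einsteinCurvature.bn01
    simp [h.connection] at e
    simp
    simp only [← wt_add, ← wt_sub, wt_inj]
    linear_combination e
  th_tb := by
    have e := h.swap.einsteinCurvature.ln01
    simp [h.connection, h.swap_Ψ₁_eq_zero] at e
    simp [mul_sub]
    simp only [← wt_sub, wt_inj]
    linear_combination -e
  edp_tb := by
    have e := h.swap.einsteinCurvature.mn01
    simp [h.connection] at e
    simp
    simp only [← wt_sub, wt_inj]
    linear_combination -e
  ed_rpb := by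
    have e := h.swap.einsteinCurvature.mb10
    simp [h.connection] at e
    simp
    simp only [← wt_add, ← wt_sub, wt_inj]
    linear_combination e
  th_rp := by
    have e := curv_lm10 S Lam
    simp [h.connection] at e
    simp
    simp only [← wt_add, ← wt_sub, wt_inj]
    linear_combination -e
  th_rpb := by
    have e := curv_lm10 S.swap Lam
    simp [h.connection] at e
    simp
    simp only [← wt_add, ← wt_sub, wt_inj]
    linear_combination -e
  thp_rpb := by
    have e := h.swap.einsteinCurvature.mn10
    simp [h.connection] at e
    simp
    simp only [← wt_add, ← wt_sub, wt_inj]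
    linear_combination e
  th_spb := by
    have e := h.swap.einsteinCurvature.lb10
    simp [h.connection] at e
    simp
    simp only [← wt_add, ← wt_sub, wt_inj]
    linear_combination -e
  thp_tpb := by
    have e := h.swap.einsteinCurvature.ln10
    simp [h.connection] at e
    simp
    simp only [← wt_add, ← wt_sub, wt_inj]
    linear_combination e
  th_Ψ₂ := by
    have e := h.weylBianchi.d00
    simp [h.connection] at e
    simp
    linear_combination e
  ed_Ψ₂ := by
    have e := h.weylBianchi.d01
    simp [h.connection] at e
    simp
    linear_combination e
  edp_Ψ₂ := by
    have e := h.weylBianchi.d10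
    simp [h.connection] at e
    simp
    simp only [← wt_add, ← wt_sub, wt_inj]
    linear_combination e
  thp_Ψ₂ := by
    have e := h.weylBianchi.d11
    simp [h.connection] at e
    simp
    simp only [← wt_add, ← wt_sub, wt_inj]
    linear_combination e
  th_Ψ₂b := by
    have e := h.swap.weylBianchi.d00
    simp [h.connection] at e
    simp
    linear_combination e
  edp_Ψ₂b := by
    have e := h.swap.weylBianchi.d01
    simp [h.connection] at e
    simp
    linear_combination e

end SpinFrame

section Symmetrization

variable {M : Type*} (T : (Fin 4 → Fin 2) → M → ℂ)

lemma sum_perm_comp (k : Fin 4 → Fin 2) (f : (Fin 4 → Fin 2) → M → ℂ)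
    {s : Finset (Fin 4 → Fin 2)} {n : ℕ}
    (hs : (Finset.univ.image fun σ : Equiv.Perm (Fin 4) => fun i => k (σ i)) = s)
    (hn : ∀ c ∈ s, (Finset.univ.filter fun σ : Equiv.Perm (Fin 4) =>
      (fun i => k (σ i)) = c).card = n) :
    ∑ σ : Equiv.Perm (Fin 4), f (fun i => k (σ i)) = (n : ℂ) • ∑ c ∈ s, f c := by
  rw [Finset.sum_comp f (fun σ : Equiv.Perm (Fin 4) => fun i => k (σ i)), hs, Finset.smul_sum]
  refine Finset.sum_congr rfl fun c hc => ?_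
  rw [hn c hc, Nat.cast_smul_eq_nsmul]

set_option maxRecDepth 100000 in
lemma symm4_zero : symm4 T (dyadIdx 0) = T ![0, 0, 0, 0] := by
  rw [symm4, sum_perm_comp _ T (s := {![0, 0, 0, 0]}) (n := 24) (by decide) (by decide)]
  simp

set_option maxRecDepth 100000 in
lemma symm4_one : symm4 T (dyadIdx 1) =
    (1 / 4 : ℂ) • (T ![1, 0, 0, 0] + T ![0, 1, 0, 0] + T ![0, 0, 1, 0] + T ![0, 0, 0, 1]) := by
  rw [symm4, sum_perm_comp _ T
    (s := {![1, 0, 0, 0], ![0, 1, 0, 0], ![0, 0, 1, 0], ![0, 0, 0, 1]}) (n := 6)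
    (by decide) (by decide), Finset.sum_insert (by decide), Finset.sum_insert (by decide), Finset.sum_insert (by decide),
    Finset.sum_singleton]
  push_cast
  module

set_option maxRecDepth 100000 in
lemma symm4_two : symm4 T (dyadIdx 2) =
    (1 / 6 : ℂ) • (T ![1, 1, 0, 0] + T ![1, 0, 1, 0] + T ![1, 0, 0, 1] + T ![0, 1, 1, 0]
      + T ![0, 1, 0, 1] + T ![0, 0, 1, 1]) := by
  rw [symm4, sum_perm_comp _ T
    (s := {![1, 1, 0, 0], ![1, 0, 1, 0], ![1, 0, 0, 1], ![0, 1, 1, 0],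
      ![0, 1, 0, 1], ![0, 0, 1, 1]}) (n := 4)
    (by decide) (by decide), Finset.sum_insert (by decide), Finset.sum_insert (by decide), Finset.sum_insert (by decide),
    Finset.sum_insert (by decide), Finset.sum_insert (by decide),
    Finset.sum_singleton]
  push_cast
  module

set_option maxRecDepth 100000 in
lemma symm4_three : symm4 T (dyadIdx 3) =
    (1 / 4 : ℂ) • (T ![1, 1, 1, 0] + T ![1, 1, 0, 1] + T ![1, 0, 1, 1] + T ![0, 1, 1, 1]) := by
  rw [symm4, sum_perm_comp _ T
    (s := {![1, 1, 1, 0], ![1, 1, 0, 1], ![1, 0, 1, 1], ![0, 1, 1, 1]}) (n := 6)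
    (by decide) (by decide), Finset.sum_insert (by decide), Finset.sum_insert (by decide), Finset.sum_insert (by decide),
    Finset.sum_singleton]
  push_cast
  module

set_option maxRecDepth 100000 in
lemma symm4_four : symm4 T (dyadIdx 4) = T ![1, 1, 1, 1] := by
  rw [symm4, sum_perm_comp _ T (s := {![1, 1, 1, 1]}) (n := 24) (by decide) (by decide)]
  simp

end Symmetrization

section Curvature

namespace SpinFrame

variable {R : Type*} [CommRing R] [Algebra ℂ R] (S : SpinFrame R)

/-- Twice the spinor whose total symmetrisation is the Weyl spinor. -/
def weylKernel (A B C E : Fin 2) : R :=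
  ∑ F : Fin 2, algebraMap ℂ R (eps F E) * (S.curv A 0 B 1 C F - S.curv A 1 B 0 C F)

variable {S} {Lam : R}

lemma weylKernel_zero : S.weylKernel 0 0 0 0 = 2 * S.Ψ₀ := by
  simp [weylKernel, eps, S.curv_swap 0 1 0 0, Ψ₀]
  ring

lemma weylKernel_one (hE : S.IsEinstein Lam) (hS : S.IsLeviCivita) :
    S.weylKernel 1 0 0 0 + S.weylKernel 0 1 0 0 + S.weylKernel 0 0 1 0 + S.weylKernel 0 0 0 1 =
      8 * S.Ψ₁ := by
  have h := hE.einsteinCurvature hS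
  have e : S.curv 0 0 0 1 0 0 = S.Ψ₁ := rfl
  simp [weylKernel, eps, S.curv_swap 0 1 0 0, S.curv_swap 1 0 0 1, S.curv_swap 1 1 0 0, h.ln01,
    h.mb01, hS.curv_trace, e]
  ring

lemma weylKernel_two (hE : S.IsEinstein Lam) (hS : S.IsLeviCivita) :
    S.weylKernel 1 1 0 0 + S.weylKernel 1 0 1 0 + S.weylKernel 1 0 0 1 + S.weylKernel 0 1 1 0
      + S.weylKernel 0 1 0 1 + S.weylKernel 0 0 1 1 = 12 * S.Ψ₂ Lam := by
  have h := hE.einsteinCurvature hS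
  have e : S.curv 0 0 0 1 1 0 = S.Ψ₂ Lam + 2 * Lam := by rw [Ψ₂]; ring
  simp [weylKernel, eps, S.curv_swap 0 1 0 0, S.curv_swap 1 0 0 1, S.curv_swap 1 1 0 0,
    S.curv_swap 1 1 1 0, h.ln00, h.mb00, h.bn01, hS.curv_trace, e]
  ring

lemma weylKernel_three (hE : S.IsEinstein Lam) (hS : S.IsLeviCivita) :
    S.weylKernel 1 1 1 0 + S.weylKernel 1 1 0 1 + S.weylKernel 1 0 1 1 + S.weylKernel 0 1 1 1 =
      8 * S.Ψ₃ := by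
  have h := hE.einsteinCurvature hS
  have e : S.curv 1 0 1 1 0 0 = S.Ψ₃ := rfl
  simp [weylKernel, eps, S.curv_swap 1 0 0 1, S.curv_swap 1 1 0 0,
    S.curv_swap 1 1 1 0, h.ln10, h.mb10, hS.curv_trace, e]
  ring

end SpinFrame

variable {M : Type*} [TopologicalSpace M] [ChartedSpace (EuclideanSpace ℝ (Fin 4)) M]
  {U : Set M}

lemma smoothAlg_ofNat_apply (n : ℕ) [n.AtLeastTwo] (x : U) :
    (ofNat(n) : smoothAlg U).1 x = ofNat(n) := rfl

variable [IsManifold (𝓡 4) ∞ M] {D : SpinDyad M} {g : LorentzianMetric M}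

namespace SpinDyad.IsNormalizedOn

lemma isLeviCivita (hD : D.IsNormalizedOn g U) (hU : IsOpen U) {x₀ : M}
    (hsrc : U ⊆ (chartAt (EuclideanSpace ℝ (Fin 4)) x₀).source) :
    (hD.spinFrame hU).IsLeviCivita :=
  ⟨hD.spinFrame_trace hU, hD.spinFrame_trace' hU, hD.spinFrame_isTorsionFree hU,
    hD.jacobiator_eq_zero hU hsrc⟩

variable (hD : D.IsNormalizedOn g U) (hU : IsOpen U)

lemma riemann_apply (A A' B B' C C' E E' : Fin 2) (x : U) :
    D.riemann g A A' B B' C C' E E' x = ((hD.spinFrame hU).riem A A' B B' C C' E E').1 x := by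
  have h : ∀ A A' B B' C C' E E', (D.leg A A').deriv (D.omega g B B' C C' E E') x =
      ((hD.spinFrame hU).d A A' ((hD.spinFrame hU).conn B B' C C' E E')).1 x :=
    fun A A' B B' C C' E E' => hD.derivation_eq hU (hD.smooth_leg A A')
      (fun y => (hD.spinFrame_conn_apply hU B B' C C' E E' y).symm) x
  rw [SpinFrame.riem_eq, riemann]
  simp [Fin.sum_univ_two, h, ← hD.spinFrame_conn_apply hU, ← hD.spinFrame_c_apply hU]

lemma ricci_apply (A A' C C' : Fin 2) (x : U) : D.ricci g A A' C C' x =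
    (∑ B : Fin 2, ∑ B' : Fin 2, (hD.spinFrame hU).riem A A' B B' C C' B B').1 x := by
  simp [ricci, Fin.sum_univ_two, hD.riemann_apply hU]

lemma isEinstein {Lam : ℝ} (hE : D.IsEinsteinOn g U Lam) :
    (hD.spinFrame hU).IsEinstein (algebraMap ℂ (smoothAlg U) Lam) where
  const A A' := Derivation.map_algebraMap _ _
  ricci A A' C C' := by
    ext x
    rw [← hD.ricci_apply hU]
    obtain ⟨h1, h2⟩ := hE x x.2
    have h := h1 A A' C C'
    simp [PhiRicci, h2] at h
    simp [smoothAlg_ofNat_apply]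
    linear_combination h

lemma exists_weyl_eq_symm4 (hS : (hD.spinFrame hU).IsLeviCivita) :
    ∃ T, D.weyl g = symm4 T ∧ ∀ (k : Fin 4 → Fin 2) (x : U), T k x =
      (1 / 2) * ((hD.spinFrame hU).weylKernel (k 0) (k 1) (k 2) (k 3)).1 x := by
  refine ⟨_, rfl, fun k x => ?_⟩
  generalize k 0 = A, k 1 = B, k 2 = C, k 3 = E
  fin_cases C <;> fin_cases E <;>
  simp [riemannLow, Fin.sum_univ_two, hD.riemann_apply hU, eps, SpinFrame.weylKernel,
    SpinFrame.riem, hS.curv'_trace] <;> ring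

variable {hD hU} {Lam : smoothAlg U}

lemma Psi_zero_apply (hS : (hD.spinFrame hU).IsLeviCivita) (x : U) :
    D.Psi g 0 x = (hD.spinFrame hU).Ψ₀.1 x := by
  have h := congrArg (fun f => f.1 x) (SpinFrame.weylKernel_zero (S := hD.spinFrame hU))
  obtain ⟨T, hT, hk⟩ := hD.exists_weyl_eq_symm4 hU hS
  rw [Psi, hT, symm4_zero]
  simp [smoothAlg_ofNat_apply, hk] at h ⊢
  linear_combination h / 2

lemma Psi_one_apply (hS : (hD.spinFrame hU).IsLeviCivita) (hE : (hD.spinFrame hU).IsEinstein Lam)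
    (x : U) : D.Psi g 1 x = (hD.spinFrame hU).Ψ₁.1 x := by
  have h := congrArg (fun f => f.1 x) (SpinFrame.weylKernel_one hE hS)
  obtain ⟨T, hT, hk⟩ := hD.exists_weyl_eq_symm4 hU hS
  rw [Psi, hT, symm4_one]
  simp [smoothAlg_ofNat_apply, hk] at h ⊢
  linear_combination h / 8

lemma Psi_two_apply (hS : (hD.spinFrame hU).IsLeviCivita) (hE : (hD.spinFrame hU).IsEinstein Lam)
    (x : U) : D.Psi g 2 x = ((hD.spinFrame hU).Ψ₂ Lam).1 x := by
  have h := congrArg (fun f => f.1 x) (SpinFrame.weylKernel_two hE hS)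
  obtain ⟨T, hT, hk⟩ := hD.exists_weyl_eq_symm4 hU hS
  rw [Psi, hT, symm4_two]
  simp [smoothAlg_ofNat_apply, hk] at h ⊢
  linear_combination h / 12

lemma Psi_three_apply (hS : (hD.spinFrame hU).IsLeviCivita)
    (hE : (hD.spinFrame hU).IsEinstein Lam) (x : U) :
    D.Psi g 3 x = (hD.spinFrame hU).Ψ₃.1 x := by
  have h := congrArg (fun f => f.1 x) (SpinFrame.weylKernel_three hE hS)
  obtain ⟨T, hT, hk⟩ := hD.exists_weyl_eq_symm4 hU hS
  rw [Psi, hT, symm4_three]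
  simp [smoothAlg_ofNat_apply, hk] at h ⊢
  linear_combination h / 8

end SpinDyad.IsNormalizedOn

end Curvature

/-! ### Index weights -/

/-- The weight of a component of a spinor. -/
def indexWeight {r : ℕ} (K : Fin r → Fin 2) : ℤ := ∑ i, sgn (K i)

lemma indexWeight_update {r : ℕ} (K : Fin r → Fin 2) (i : Fin r) :
    indexWeight (Function.update K i (1 - K i)) = indexWeight K - 2 * sgn (K i) := by
  have e : sgn (1 - K i) = sgn (K i) - 2 * sgn (K i) := by
    generalize K i = a
    fin_cases a <;> rfl
  simp only [indexWeight, ← Finset.add_sum_erase Finset.univ _ (Finset.mem_univ i)]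
  rw [Function.update_self, e, Finset.sum_congr rfl fun j hj => by
    rw [Function.update_of_ne (Finset.ne_of_mem_erase hj)]]
  ring

lemma sum_connection {r : ℕ} {Γ : Fin 2 → Fin 2 → ℂ} (hΓ : Γ 0 0 + Γ 1 1 = 0) (K : Fin r → Fin 2)
    (t : (Fin r → Fin 2) → ℂ) :
    ∑ i : Fin r, ∑ C : Fin 2, Γ (K i) C * t (Function.update K i C) =
      indexWeight K * Γ 0 0 * t K
        + ∑ i : Fin r, Γ (K i) (1 - K i) * t (Function.update K i (1 - K i)) := by
  have e : ∀ i, ∑ C : Fin 2, Γ (K i) C * t (Function.update K i C) =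
      sgn (K i) * (Γ 0 0 * t K) + Γ (K i) (1 - K i) * t (Function.update K i (1 - K i)) := by
    intro i
    have hu : Function.update K i (K i) = K := Function.update_eq_self i K
    rcases (show K i = 0 ∨ K i = 1 by omega) with hK | hK <;> rw [hK] at hu ⊢
    · rw [Fin.sum_univ_two, hu]
      simp [sgn]
    · rw [Fin.sum_univ_two, hu]
      simp [sgn]
      linear_combination t K * hΓ
  simp only [e, Finset.sum_add_distrib, ← Finset.sum_mul]
  simp [indexWeight, mul_assoc]

section Transfer

variable {M : Type*} [TopologicalSpace M] [ChartedSpace (EuclideanSpace ℝ (Fin 4)) M]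
  {U : Set M}

/-! ### Functions representing weighted scalars -/

/-- On `U`, the function `f` is the scalar `b`, which is of weight `{p,q}`. -/
def Represents (p q : ℤ) (f : M → ℂ) (b : Weighted (smoothAlg U)) : Prop :=
  ∃ a : smoothAlg U, b = wt p q a ∧ ∀ x : U, f x = a.1 x

namespace Represents

variable {p q p' q' p'' q'' : ℤ} {f f' : M → ℂ} {b b' : Weighted (smoothAlg U)}

lemma eq_of_eq (h : Represents p q f b) (h' : Represents p q f' b') (e : b = b') (x : U) :
    f x = f' x := by
  obtain ⟨a, rfl, ha⟩ := h
  obtain ⟨a', rfl, ha'⟩ := h'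
  rw [ha, ha', wt_injective p q e]

lemma zero : Represents p q (0 : M → ℂ) (0 : Weighted (smoothAlg U)) :=
  ⟨0, (wt_zero p q).symm, fun _ => rfl⟩

lemma add (h : Represents p q f b) (h' : Represents p q f' b') :
    Represents p q (f + f') (b + b') := by
  obtain ⟨a, rfl, ha⟩ := h
  obtain ⟨a', rfl, ha'⟩ := h'
  exact ⟨a + a', (wt_add ..).symm, fun x => by simp [ha, ha']⟩

lemma neg (h : Represents p q f b) : Represents p q (-f) (-b) := by
  obtain ⟨a, rfl, ha⟩ := h
  exact ⟨-a, (wt_neg ..).symm, fun x => by simp [ha]⟩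

lemma sub (h : Represents p q f b) (h' : Represents p q f' b') :
    Represents p q (f - f') (b - b') := by
  rw [sub_eq_add_neg, sub_eq_add_neg]
  exact h.add h'.neg

lemma mul (h : Represents p q f b) (h' : Represents p' q' f' b')
    (hp : p + p' = p'' := by norm_num) (hq : q + q' = q'' := by norm_num) :
    Represents p'' q'' (f * f') (b * b') := by
  obtain ⟨a, rfl, ha⟩ := h
  obtain ⟨a', rfl, ha'⟩ := h'
  exact ⟨a * a', by rw [wt_mul_wt, hp, hq], fun x => by simp [ha, ha']⟩

lemma ofNat (n : ℕ) [n.AtLeastTwo] :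
    Represents 0 0 (ofNat(n) : M → ℂ) (ofNat(n) : Weighted (smoothAlg U)) :=
  ⟨ofNat(n), ofNat_eq_wt n, fun _ => rfl⟩

lemma ofNat_mul (n : ℕ) [n.AtLeastTwo] (h : Represents p q f b) :
    Represents p q (ofNat(n) * f) (ofNat(n) * b) :=
  (ofNat n).mul h (zero_add p) (zero_add q)

lemma const (c : ℂ) : Represents 0 0 (fun _ : M => c) (wt 0 0 (algebraMap ℂ (smoothAlg U) c)) :=
  ⟨_, rfl, fun _ => rfl⟩

lemma const_smul (c : ℂ) (h : Represents p q f b) :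
    Represents p q (c • f) (wt 0 0 (algebraMap ℂ (smoothAlg U) c) * b) :=
  (const c).mul h (zero_add p) (zero_add q)

lemma pow_zero_weight (h : Represents 0 0 f b) (n : ℕ) : Represents 0 0 (f ^ n) (b ^ n) := by
  induction n with
  | zero => exact ⟨1, by rw [pow_zero]; rfl, fun _ => by simp⟩
  | succ n ih => rw [pow_succ, pow_succ]; exact ih.mul h

lemma sum {ι : Type*} (s : Finset ι) {F : ι → M → ℂ} {T : ι → Weighted (smoothAlg U)}
    (h : ∀ i ∈ s, Represents p q (F i) (T i)) : Represents p q (∑ i ∈ s, F i) (∑ i ∈ s, T i) := by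
  classical
  induction s using Finset.induction_on with
  | empty => simpa using zero
  | insert i s hi ih =>
    rw [Finset.sum_insert hi, Finset.sum_insert hi]
    exact (h i (Finset.mem_insert_self i s)).add
      (ih fun j hj => h j (Finset.mem_insert_of_mem hj))

lemma congr (h : Represents p q f b) (e : ∀ x : U, f' x = f x) : Represents p q f' b := by
  obtain ⟨a, hb, ha⟩ := h
  exact ⟨a, hb, fun x => (e x).trans (ha x)⟩

lemma cast (h : Represents p q f b) (hp : p = p') (hq : q = q') : Represents p' q' f b := by
  rwa [← hp, ← hq]

end Represents

lemma SmoothOn.represents {f : M → ℂ} (hf : SmoothOn U f) (p q : ℤ) :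
    Represents p q f (wt p q hf.toAlg) := ⟨_, rfl, fun _ => rfl⟩

variable [IsManifold (𝓡 4) ∞ M] {D : SpinDyad M} {g : LorentzianMetric M}

namespace SpinDyad.IsNormalizedOn

variable (hD : D.IsNormalizedOn g U) (hU : IsOpen U)

lemma represents_Theta {p q p' q' : ℤ} {f : M → ℂ} {b : Weighted (smoothAlg U)}
    (h : Represents p q f b) (A A' : Fin 2) (hp : sgn A + p = p' := by norm_num [sgn])
    (hq : sgn A' + q = q' := by norm_num [sgn]) :
    Represents p' q' (D.Theta g A A' p q f) ((hD.spinFrame hU).Θ A A' b) := by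
  obtain ⟨a, rfl, ha⟩ := h
  subst hp hq
  refine ⟨_, weightedDerivation_wt .., fun x => ?_⟩
  have e := hD.derivation_eq hU (hD.smooth_leg A A') ha x
  simp [Theta, e, ha]
  rfl

variable {Lam : smoothAlg U} (h : (hD.spinFrame hU).IsTypeII Lam)

lemma represents_rho : Represents 1 1 (D.rho g) h.calculus.r := ⟨_, rfl, fun _ => rfl⟩

lemma represents_tau : Represents 1 (-1) (D.tau g) h.calculus.t := ⟨_, rfl, fun _ => rfl⟩

lemma represents_star_rho' : Represents (-1) (-1) (star (D.rho' g)) h.calculus.rpb :=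
  ⟨_, rfl, fun x => star_neg (D.Gam g 0 1 1 0 x)⟩

lemma represents_star_tau : Represents (-1) 1 (star (D.tau g)) h.calculus.tb :=
  ⟨_, rfl, fun x => star_neg (D.Gam g 1 1 0 1 x)⟩

lemma represents_star_tau' : Represents 1 (-1) (star (D.tau' g)) h.calculus.tpb :=
  ⟨_, rfl, fun x => star_neg (D.Gam g 0 0 1 0 x)⟩

lemma represents_star_sigma' : Represents 1 (-3) (star (D.sigma' g)) h.calculus.spb :=
  ⟨_, rfl, fun x => star_neg (D.Gam g 1 0 1 0 x)⟩

lemma represents_Psi_two : Represents 0 0 (D.Psi g 2) h.calculus.Ψ₂ :=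
  ⟨_, rfl, Psi_two_apply h.isLeviCivita h.isEinstein⟩

lemma represents_Psi_three : Represents (-2) 0 (D.Psi g 3) h.calculus.Ψ₃ :=
  ⟨_, rfl, Psi_three_apply h.isLeviCivita h.isEinstein⟩

lemma represents_tho {p q p' q' : ℤ} {f : M → ℂ} {b : Weighted (smoothAlg U)}
    (hf : Represents p q f b) (hp : 1 + p = p' := by norm_num) (hq : 1 + q = q' := by norm_num) :
    Represents p' q' (D.tho g p q f) (h.calculus.th b) :=
  hD.represents_Theta hU hf 0 0 hp hq

lemma represents_edt {p q p' q' : ℤ} {f : M → ℂ} {b : Weighted (smoothAlg U)}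
    (hf : Represents p q f b) (hp : 1 + p = p' := by norm_num) (hq : -1 + q = q' := by norm_num) :
    Represents p' q' (D.edt g p q f) (h.calculus.ed b) :=
  hD.represents_Theta hU hf 0 1 hp hq

lemma represents_edt' {p q p' q' : ℤ} {f : M → ℂ} {b : Weighted (smoothAlg U)}
    (hf : Represents p q f b) (hp : -1 + p = p' := by norm_num) (hq : 1 + q = q' := by norm_num) :
    Represents p' q' (D.edt' g p q f) (h.calculus.edp b) :=
  hD.represents_Theta hU hf 1 0 hp hq

lemma represents_tho' {p q p' q' : ℤ} {f : M → ℂ} {b : Weighted (smoothAlg U)}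
    (hf : Represents p q f b) (hp : -1 + p = p' := by norm_num) (hq : -1 + q = q' := by norm_num) :
    Represents p' q' (D.tho' g p q f) (h.calculus.thp b) :=
  hD.represents_Theta hU hf 1 1 hp hq

variable {χ : M → ℂ} {b : Weighted (smoothAlg U)}

lemma represents_Odag (hχ : Represents (-4) 0 χ b) :
    Represents (-4) 0 (D.Odag g χ) (h.calculus.Odag b) := by
  have hu : Represents (-3) 1 (D.tho g (-4) 0 χ + 3 * D.rho g * χ)
      (h.calculus.th b + 3 * h.calculus.r * b) :=
    (hD.represents_tho hU h hχ).add (((hD.represents_rho hU h).ofNat_mul 3).mul hχ)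
  have hv : Represents (-3) (-1) (D.edt g (-4) 0 χ + 3 * D.tau g * χ)
      (h.calculus.ed b + 3 * h.calculus.t * b) :=
    (hD.represents_edt hU h hχ).add (((hD.represents_tau hU h).ofNat_mul 3).mul hχ)
  exact Represents.ofNat_mul 2
    ((((hD.represents_tho' hU h hu).sub ((hD.represents_star_rho' hU h).mul hu)).sub
      ((hD.represents_edt' hU h hv).sub ((hD.represents_star_tau hU h).mul hv))).sub
      (((hD.represents_Psi_two hU h).ofNat_mul 3).mul hχ))

lemma represents_hnn (hχ : Represents (-4) 0 χ b) :
    Represents (-2) (-2) (D.hnn g χ) (h.calculus.hnn b) := by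
  have he := hD.represents_edt hU h hχ (p' := -3) (q' := -1)
  have ht := hD.represents_tho hU h hχ (p' := -3) (q' := 1)
  exact ((hD.represents_edt hU h he).add
    (((hD.represents_tau hU h).ofNat_mul 2).mul he)).neg.sub
    ((hD.represents_star_sigma' hU h).mul ht)

lemma represents_hnmb (hχ : Represents (-4) 0 χ b) :
    Represents (-2) 0 (D.hnmb g χ) (h.calculus.hnmb b) := by
  have he := hD.represents_edt hU h hχ (p' := -3) (q' := -1)
  have ht := hD.represents_tho hU h hχ (p' := -3) (q' := 1)
  exact ((hD.represents_tho hU h he).add ((hD.represents_rho hU h).mul he)).neg.sub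
    (((hD.represents_tau hU h).add (hD.represents_star_tau' hU h)).mul ht)

lemma represents_hmbmb (hχ : Represents (-4) 0 χ b) :
    Represents (-2) 2 (D.hmbmb g χ) (h.calculus.hmbmb b) := by
  have ht := hD.represents_tho hU h hχ (p' := -3) (q' := 1)
  exact ((hD.represents_tho hU h ht).add
    (((hD.represents_rho hU h).ofNat_mul 2).mul ht)).neg

lemma represents_γ (A A' C : Fin 2) : Represents (sgn A + 2 * sgn C) (sgn A')
    (D.Gam g A A' C (1 - C)) (h.calculus.γ A A' C) := by
  have hκ : Represents 3 1 (D.Gam g 0 0 0 1) (0 : Weighted (smoothAlg U)) :=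
    Represents.zero.congr fun x => congrArg (fun f => f.1 x) h.kappa
  have hσ : Represents 3 (-1) (D.Gam g 0 1 0 1) (0 : Weighted (smoothAlg U)) :=
    Represents.zero.congr fun x => congrArg (fun f => f.1 x) h.sigma
  fin_cases C <;> fin_cases A <;> fin_cases A'
  · exact hκ
  · exact hσ
  · exact ⟨_, (wt_neg 1 1 _).symm, fun x => (neg_neg (D.Gam g 1 0 0 1 x)).symm⟩
  · exact ⟨_, (wt_neg 1 (-1) _).symm, fun x => (neg_neg (D.Gam g 1 1 0 1 x)).symm⟩
  · exact ⟨_, (wt_neg (-1) 1 _).symm, fun x => (neg_neg (D.Gam g 0 0 1 0 x)).symm⟩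
  · exact ⟨_, (wt_neg (-1) (-1) _).symm, fun x => (neg_neg (D.Gam g 0 1 1 0 x)).symm⟩
  · exact ⟨_, (wt_neg (-3) 1 _).symm, fun x => (neg_neg (D.Gam g 1 0 1 0 x)).symm⟩
  · exact ⟨_, (wt_neg (-3) (-1) _).symm, fun x => (neg_neg (D.Gam g 1 1 1 0 x)).symm⟩

lemma represents_γ' (A A' C : Fin 2) : Represents (sgn A) (sgn A' + 2 * sgn C)
    (D.Gam' g A A' C (1 - C)) (h.calculus.γ' A A' C) := by
  have hκ : Represents 1 3 (D.Gam' g 0 0 0 1) (0 : Weighted (smoothAlg U)) :=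
    Represents.zero.congr fun x => congrArg (fun f => f.1 x) h.swap_kappa
  have hσ : Represents (-1) 3 (D.Gam' g 1 0 0 1) (0 : Weighted (smoothAlg U)) :=
    Represents.zero.congr fun x => congrArg (fun f => f.1 x) h.swap_sigma
  fin_cases C <;> fin_cases A <;> fin_cases A'
  · exact hκ
  · exact ⟨_, (wt_neg 1 1 _).symm, fun x => (neg_neg (D.Gam' g 0 1 0 1 x)).symm⟩
  · exact hσ
  · exact ⟨_, (wt_neg (-1) 1 _).symm, fun x => (neg_neg (D.Gam' g 1 1 0 1 x)).symm⟩
  · exact ⟨_, (wt_neg 1 (-1) _).symm, fun x => (neg_neg (D.Gam' g 0 0 1 0 x)).symm⟩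
  · exact ⟨_, (wt_neg 1 (-3) _).symm, fun x => (neg_neg (D.Gam' g 0 1 1 0 x)).symm⟩
  · exact ⟨_, (wt_neg (-1) (-1) _).symm, fun x => (neg_neg (D.Gam' g 1 0 1 0 x)).symm⟩
  · exact ⟨_, (wt_neg (-1) (-3) _).symm, fun x => (neg_neg (D.Gam' g 1 1 1 0 x)).symm⟩

lemma represents_nabla {r s : ℕ} {T : SpinorField M r s}
    {TB : (Fin r → Fin 2) → (Fin s → Fin 2) → Weighted (smoothAlg U)}
    (hT : ∀ K K', Represents (indexWeight K) (indexWeight K') (T K K') (TB K K'))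
    (K : Fin (r + 1) → Fin 2) (K' : Fin (s + 1) → Fin 2) :
    Represents (indexWeight K) (indexWeight K') (D.nabla g T K K')
      (h.calculus.nabla TB K K') := by
  have hK : sgn (K 0) + indexWeight (Fin.tail K) = indexWeight K := by
    simp only [indexWeight, Fin.sum_univ_succ]; rfl
  have hK' : sgn (K' 0) + indexWeight (Fin.tail K') = indexWeight K' := by
    simp only [indexWeight, Fin.sum_univ_succ]; rfl
  have hΘ : h.calculus.Θ (K 0) (K' 0) = (hD.spinFrame hU).Θ (K 0) (K' 0) := by
    generalize K 0 = A, K' 0 = A'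
    fin_cases A <;> fin_cases A' <;> rfl
  have h₁ := hD.represents_Theta hU (hT (Fin.tail K) (Fin.tail K')) (K 0) (K' 0) hK hK'
  rw [← hΘ] at h₁
  have h₂ := Represents.sum Finset.univ fun i _ =>
    (hD.represents_γ hU h (K 0) (K' 0) (Fin.tail K i)).mul
      (hT (Function.update (Fin.tail K) i (1 - Fin.tail K i)) (Fin.tail K'))
      (p'' := indexWeight K) (q'' := indexWeight K') (by rw [indexWeight_update, ← hK]; ring) hK'
  have h₃ := Represents.sum Finset.univ fun i _ =>
    (hD.represents_γ' hU h (K 0) (K' 0) (Fin.tail K' i)).mul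
      (hT (Fin.tail K) (Function.update (Fin.tail K') i (1 - Fin.tail K' i)))
      (p'' := indexWeight K) (q'' := indexWeight K') hK (by rw [indexWeight_update, ← hK']; ring)
  refine ((h₁.sub h₂).sub h₃).congr fun x => ?_
  have t := sum_connection (Γ := fun B C => D.Gam g (K 0) (K' 0) B C x)
    (hD.Gam_trace hU x.2 (K 0) (K' 0)) (Fin.tail K) (fun B => T B (Fin.tail K') x)
  have t' := sum_connection (Γ := fun B C => D.Gam' g (K 0) (K' 0) B C x)
    (congrArg (fun f => f.1 x) (hD.spinFrame_trace' hU (K 0) (K' 0))) (Fin.tail K')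
    (fun B => T (Fin.tail K) B x)
  simp only [nabla, Theta, Pi.sub_apply, Pi.add_apply, Pi.mul_apply, Pi.smul_apply,
    Finset.sum_apply, smul_eq_mul] at t t' ⊢
  rw [t, t']
  ring

end SpinDyad.IsNormalizedOn
end Transfer

section Final

variable {M : Type*} [TopologicalSpace M] [ChartedSpace (EuclideanSpace ℝ (Fin 4)) M]
  {U : Set M}

lemma SmoothOn.inv {φ : M → ℂ} (hφ : SmoothOn U φ) (h0 : ∀ x ∈ U, φ x ≠ 0) :
    SmoothOn U φ⁻¹ := fun x hx =>
  (contDiffAt_inv ℝ (h0 x hx)).contMDiffAt.comp_contMDiffWithinAt x (hφ x hx)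

variable [IsManifold (𝓡 4) ∞ M] {D : SpinDyad M} {g : LorentzianMetric M}

namespace SpinDyad.IsNormalizedOn

/-! ### The type II condition -/

section TypeII

variable (hD : D.IsNormalizedOn g U) (hU : IsOpen U)

lemma swap_Γ_eq (A A' B C : Fin 2) :
    (hD.spinFrame hU).swap.Γ A A' B C = conjAlg ((hD.spinFrame hU).Γ A A' B C) := rfl

lemma swap_Γ'_eq (A A' B C : Fin 2) :
    (hD.spinFrame hU).swap.Γ' A A' B C = conjAlg ((hD.spinFrame hU).Γ' A A' B C) := by
  ext x
  exact (star_star (D.Gam g A' A B C x)).symm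

lemma swap_curv_eq (A A' B B' C E : Fin 2) :
    (hD.spinFrame hU).swap.curv A A' B B' C E =
      conjAlg ((hD.spinFrame hU).curv A A' B B' C E) := by
  have hd : ∀ A A' f, (hD.spinFrame hU).swap.d A A' (conjAlg f) =
      conjAlg ((hD.spinFrame hU).d A A' f) := fun A A' f => (hD.conjAlg_d hU A A' f).symm
  have hc : ∀ A A' B B' C C', (hD.spinFrame hU).swap.c A A' B B' C C' =
      conjAlg ((hD.spinFrame hU).c A A' B B' C C') := by
    intro A A' B B' C C'
    simp only [SpinFrame.c, SpinFrame.conn, hD.swap_Γ_eq hU, hD.swap_Γ'_eq hU, map_sub, map_add,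
      apply_ite conjAlg, map_zero]
  simp only [SpinFrame.curv, hD.swap_Γ_eq hU, hc, hd, map_sub, map_add, map_mul, map_sum]

lemma isTypeII {Lam : ℝ} (hE : D.IsEinsteinOn g U Lam) (hII : D.IsTypeIIOn g U) {x₀ : M}
    (hsrc : U ⊆ (chartAt (EuclideanSpace ℝ (Fin 4)) x₀).source) :
    (hD.spinFrame hU).IsTypeII (algebraMap ℂ (smoothAlg U) Lam) := by
  have hS := hD.isLeviCivita hU hsrc
  have hE' := hD.isEinstein hU hE
  have h₀ : (hD.spinFrame hU).Ψ₀ = 0 := by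
    ext x
    rw [← Psi_zero_apply hS]
    exact (hII x x.2).1
  have h₁ : (hD.spinFrame hU).Ψ₁ = 0 := by
    ext x
    rw [← Psi_one_apply hS hE']
    exact (hII x x.2).2.1
  have hB := hE'.weylBianchi hS h₀ h₁
  have cancel : ∀ a : smoothAlg U,
      3 * (hD.spinFrame hU).Ψ₂ (algebraMap ℂ (smoothAlg U) Lam) * a = 0 → a = 0 := by
    intro a ha
    ext x
    have e := congrArg (fun f => f.1 x) ha
    simp [smoothAlg_ofNat_apply, ← Psi_two_apply hS hE', (hII x x.2).2.2] at e
    simpa using e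
  have hκ := cancel _ hB.kappa
  have hσ := cancel _ hB.sigma
  exact {
    isLeviCivita := hS
    isEinstein := hE'
    Ψ₀_eq_zero := h₀
    Ψ₁_eq_zero := h₁
    kappa := hκ
    sigma := hσ
    swap_Ψ₀_eq_zero := by
      rw [SpinFrame.Ψ₀, hD.swap_curv_eq hU, ← map_neg, ← SpinFrame.Ψ₀, h₀, map_zero]
    swap_Ψ₁_eq_zero := by
      rw [SpinFrame.Ψ₁, hD.swap_curv_eq hU, ← SpinFrame.Ψ₁, h₁, map_zero]
    swap_kappa := by rw [hD.swap_Γ_eq hU, hκ, map_zero]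
    swap_sigma := by rw [hD.swap_Γ_eq hU, hσ, map_zero] }

end TypeII

/-! ### The linearized Weyl spinor -/

variable {hD : D.IsNormalizedOn g U} {hU : IsOpen U} {Lam : smoothAlg U}
  (h : (hD.spinFrame hU).IsTypeII Lam) {χ : M → ℂ} {b : Weighted (smoothAlg U)}

lemma represents_hDebye (hχ : Represents (-4) 0 χ b) (K K' : Fin 2 → Fin 2) :
    Represents (indexWeight K) (indexWeight K') (D.hDebye g χ K K')
      (h.calculus.hDebye b K K') := by
  have hnn := hD.represents_hnn hU h hχ
  have hnmb := hD.represents_hnmb hU h hχ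
  have hmbmb := hD.represents_hmbmb hU h hχ
  rw [indexWeight, indexWeight, Fin.sum_univ_two, Fin.sum_univ_two]
  simp only [SpinDyad.hDebye, TypeIICalculus.hDebye]
  generalize K 0 = A, K 1 = B, K' 0 = A', K' 1 = B'
  fin_cases A <;> fin_cases B <;> try
    exact Represents.zero.congr fun x => by simp [oLow, eps]
  fin_cases A' <;> fin_cases B'
  · exact hmbmb.congr fun x => by simp [oLow, iotaLow, eps]
  · exact hnmb.congr fun x => by simp [oLow, iotaLow, eps]
  · exact hnmb.congr fun x => by simp [oLow, iotaLow, eps]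
  · exact hnn.congr fun x => by simp [oLow, iotaLow, eps]

lemma _root_.Debye.SpinDyad.trace_hDebye (D : SpinDyad M) (g : LorentzianMetric M) (χ : M → ℂ) :
    trace (D.hDebye g χ) = 0 := by
  simp [trace, Fin.sum_univ_two, SpinDyad.hDebye, oLow, eps]

lemma exists_dotPsi_eq_symm4 (hχ : Represents (-4) 0 χ b) :
    ∃ Q, (∀ i, D.dotPsi g χ i = (1 / 2 : ℂ) • symm4 Q (dyadIdx i)) ∧
      ∀ k, Represents (indexWeight k) 0 (Q k) (h.calculus.ddh b k) := by
  refine ⟨fun k => ∑ A' : Fin 2, ∑ X' : Fin 2, ∑ B' : Fin 2, ∑ Y' : Fin 2,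
    (eps A' X' * eps B' Y') • D.nabla g (D.nabla g (D.hDebye g χ)) k ![X', Y', A', B'],
    fun i => ?_, fun k => ?_⟩
  · rw [dotPsi, linWeyl, trace_hDebye, zero_mul, smul_zero, add_zero]
  · have hN := fun K' => hD.represents_nabla hU h
      (hD.represents_nabla hU h (represents_hDebye h hχ)) k K'
    refine ((((hN ![1, 1, 0, 0]).sub (hN ![1, 0, 0, 1])).sub (hN ![0, 1, 1, 0])).add
      (hN ![0, 0, 1, 1])).congr fun x => ?_
    simp [Fin.sum_univ_two, eps]
    ring

/-! ### The projected Killing vector -/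

variable {φ : M → ℂ} {fi : Weighted (smoothAlg U)}

lemma represents_killingSpinor (hφ : Represents 0 0 φ⁻¹ fi) (K : Fin 2 → Fin 2)
    (K' : Fin 0 → Fin 2) :
    Represents (indexWeight K) (indexWeight K') (D.killingSpinor g φ K K')
      (h.calculus.killingSpinor (wt 0 0 (algebraMap ℂ _ (1 / 2))) (wt 0 0 (algebraMap ℂ _ (1 / 3)))
        fi K K') := by
  have h₁ := (hφ.const_smul (1 / 2)).neg
  have h₂ := (((hφ.pow_zero_weight 4).mul (hD.represents_Psi_three hU h)
    (p'' := -2) (q'' := 0)).const_smul (1 / 3)).neg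
  rw [indexWeight, indexWeight, Fin.sum_univ_two, Fin.sum_univ_zero]
  simp only [SpinDyad.killingSpinor, TypeIICalculus.killingSpinor]
  generalize K 0 = A, K 1 = B
  fin_cases A <;> fin_cases B
  · exact Represents.zero.congr fun x => by simp [oLow, eps]
  · exact h₁.congr fun x => by simp [oLow, iotaLow, eps]
  · exact h₁.congr fun x => by simp [oLow, iotaLow, eps]
  · exact h₂.congr fun x => by simp [oLow, iotaLow, eps]

lemma represents_xi (hφ : Represents 0 0 φ⁻¹ fi) (A A' : Fin 2) :
    Represents (sgn A) (sgn A') (D.xi g φ A A')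
      (h.calculus.xi (wt 0 0 (algebraMap ℂ _ (1 / 2))) (wt 0 0 (algebraMap ℂ _ (1 / 3))) fi
        A A') := by
  have hN := fun K => hD.represents_nabla hU h (represents_killingSpinor h hφ) K ![A']
  refine (((hN ![1, A, 0]).cast ?_ ?_).sub ((hN ![0, A, 1]).cast ?_ ?_)).congr fun x => ?_
  · fin_cases A <;> rfl
  · simp [indexWeight]
  · fin_cases A <;> rfl
  · simp [indexWeight]
  · simp [xi, Fin.sum_univ_two, eps]
    ring

lemma represents_xiTheta (hχ : Represents (-4) 0 χ b) (hφ : Represents 0 0 φ⁻¹ fi) :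
    Represents (-4) 0 (D.xiTheta g φ χ)
      (h.calculus.xiTheta (wt 0 0 (algebraMap ℂ _ (1 / 2))) (wt 0 0 (algebraMap ℂ _ (1 / 3))) fi
        b) := by
  have hξ := represents_xi h hφ
  have h₁ := (hξ 0 0).mul (hD.represents_tho' hU h hχ (p' := -5) (q' := -1))
    (p'' := -4) (q'' := 0) rfl rfl
  have h₂ := (hξ 0 1).mul (hD.represents_edt' hU h hχ (p' := -5) (q' := 1))
    (p'' := -4) (q'' := 0) rfl rfl
  have h₃ := (hξ 1 0).mul (hD.represents_edt hU h hχ (p' := -3) (q' := -1))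
    (p'' := -4) (q'' := 0) rfl rfl
  have h₄ := (hξ 1 1).mul (hD.represents_tho hU h hχ (p' := -3) (q' := 1))
    (p'' := -4) (q'' := 0) rfl rfl
  refine (((h₁.sub h₂).sub h₃).add h₄).congr fun x => ?_
  simp [xiTheta, Fin.sum_univ_two, eps, tho, tho', edt, edt']
  ring

/-! ### The curvature components -/

lemma calculus_P (hχ : Represents (-4) 0 χ b) : h.calculus.P b = -(4 * b) := by
  obtain ⟨a, rfl, -⟩ := hχ
  refine (weightedDerivation_wt ..).trans ?_
  rw [ofNat_eq_wt, wt_mul_wt, ← wt_neg]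
  congr 1
  simp
  ring

lemma calculus_Q (hχ : Represents (-4) 0 χ b) : h.calculus.Q b = 0 := by
  obtain ⟨a, rfl, -⟩ := hχ
  refine (weightedDerivation_wt ..).trans ?_
  simp [wt_zero]

lemma dotPsi_eq_zero (h : (hD.spinFrame hU).IsTypeII Lam) (hχ : Represents (-4) 0 χ b) (x : U) :
    D.dotPsi g χ 0 x = 0 ∧ D.dotPsi g χ 1 x = 0 ∧ D.dotPsi g χ 2 x = 0 := by
  obtain ⟨Q, hQ, hk⟩ := exists_dotPsi_eq_symm4 h hχ
  rw [hQ, hQ, hQ, symm4_zero, symm4_one, symm4_two]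
  have e₀ := (hk ![0, 0, 0, 0]).eq_of_eq Represents.zero (h.calculus.ddh_zero b) x
  have e₁ : Represents 2 0 _ _ := (((hk ![1, 0, 0, 0]).add (hk ![0, 1, 0, 0])).add
    (hk ![0, 0, 1, 0])).add (hk ![0, 0, 0, 1])
  have e₂ : Represents 0 0 _ _ := (((((hk ![1, 1, 0, 0]).add (hk ![1, 0, 1, 0])).add
    (hk ![1, 0, 0, 1])).add (hk ![0, 1, 1, 0])).add (hk ![0, 1, 0, 1])).add (hk ![0, 0, 1, 1])
  have e₁' := e₁.eq_of_eq Represents.zero (h.calculus.ddh_one b) x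
  have e₂' := e₂.eq_of_eq Represents.zero (h.calculus.ddh_two b (calculus_Q h hχ)) x
  refine ⟨?_, ?_, ?_⟩
  · rw [Pi.smul_apply, e₀, Pi.zero_apply, smul_zero]
  · rw [Pi.smul_apply, Pi.smul_apply, e₁', Pi.zero_apply, smul_zero, smul_zero]
  · rw [Pi.smul_apply, Pi.smul_apply, e₂', Pi.zero_apply, smul_zero, smul_zero]

lemma dotPsi_three (h : (hD.spinFrame hU).IsTypeII Lam) (hχ : Represents (-4) 0 χ b) (x : U) :
    D.dotPsi g χ 3 x = -(1 / 4) * (D.tau g x * D.tho g (-4) 0 (D.Odag g χ) x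
      - D.rho g x * D.edt g (-4) 0 (D.Odag g χ) x) := by
  obtain ⟨Q, hQ, hk⟩ := exists_dotPsi_eq_symm4 h hχ
  have hO := hD.represents_Odag hU h hχ
  have e : Represents (-2) 0 _ _ := (((hk ![1, 1, 1, 0]).add (hk ![1, 1, 0, 1])).add
    (hk ![1, 0, 1, 1])).add (hk ![0, 1, 1, 1])
  have e' : Represents (-2) 0 _ _ := (((hD.represents_tau hU h).mul
    (hD.represents_tho hU h hO (p' := -3) (q' := 1)) (p'' := -2) (q'' := 0)).sub
    ((hD.represents_rho hU h).mul (hD.represents_edt hU h hO (p' := -3) (q' := -1)))).ofNat_mul 2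
  have t := e.eq_of_eq e'.neg
    ((h.calculus.ddh_three b (calculus_P h hχ) (calculus_Q h hχ)).trans (neg_mul _ _)) x
  rw [hQ, symm4_three, Pi.smul_apply, Pi.smul_apply, t]
  simp
  ring

lemma dotPsi_four {Lam : ℝ}
    (h : (hD.spinFrame hU).IsTypeII (algebraMap ℂ (smoothAlg U) Lam))
    (hχ : Represents (-4) 0 χ b) (hφ : SmoothOn U φ) (hφ0 : ∀ x ∈ U, φ x ≠ 0)
    (hφ3 : ∀ x ∈ U, φ x ^ 3 = D.Psi g 2 x) (x : U) :
    D.dotPsi g χ 4 x = -(φ x ^ 4 * D.xiTheta g φ χ x + 3 * D.Psi g 2 x ^ 2 * χ x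
            + 6 * D.Psi g 2 x * (Lam : ℂ) * χ x)
          - ((1 / 8) * D.Odag g (D.Odag g χ) x
            - D.rho g x * D.tho' g (-4) 0 (D.Odag g χ) x
            + D.tau g x * D.edt' g (-4) 0 (D.Odag g χ) x
            + 2 * D.Psi g 2 x * D.Odag g χ x
            + (5 / 2) * (Lam : ℂ) * D.Odag g χ x) := by
  obtain ⟨Q, hQ, hk⟩ := exists_dotPsi_eq_symm4 h hχ
  have hO := hD.represents_Odag hU h hχ
  have hΨ := hD.represents_Psi_two hU h
  have hΛ : Represents 0 0 (fun _ : M => (Lam : ℂ)) h.calculus.Λ := Represents.const _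
  have hf := hφ.represents 0 0
  have hfi := (hφ.inv hφ0).represents 0 0
  have hffi : wt 0 0 hφ.toAlg * wt 0 0 (hφ.inv hφ0).toAlg = 1 := by
    rw [wt_mul_wt]
    refine congrArg (wt 0 0) (?_ : _ = (1 : smoothAlg U))
    ext y
    exact mul_inv_cancel₀ (hφ0 y y.2)
  have hf3 : wt 0 0 hφ.toAlg ^ 3 = h.calculus.Ψ₂ := by
    obtain ⟨a, ha, ha'⟩ := hf.pow_zero_weight 3
    rw [ha]
    refine congrArg (wt 0 0) (Subtype.ext (funext fun y => ?_))
    rw [← ha' y, ← Psi_two_apply h.isLeviCivita h.isEinstein]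
    exact hφ3 y y.2
  have inv_const : ∀ (n : ℕ) [n.AtLeastTwo], (ofNat(n) : Weighted (smoothAlg U)) *
      wt 0 0 (algebraMap ℂ (smoothAlg U) (1 / ofNat(n))) = 1 := by
    intro n _
    rw [ofNat_eq_wt, wt_mul_wt]
    refine congrArg (wt 0 0) (?_ : _ = (1 : smoothAlg U))
    ext y
    exact mul_one_div_cancel (OfNat.ofNat_ne_zero n)
  have key := h.calculus.ddh_four_eq (inv_const 2) (inv_const 3) hffi hf3 b (calculus_P h hχ)
    (calculus_Q h hχ)
  have r₁ := ((hf.pow_zero_weight 4).mul (represents_xiTheta h hχ hfi)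
    (p'' := -4) (q'' := 0)).ofNat_mul 8
  have r₂ := ((hΨ.pow_zero_weight 2).ofNat_mul 24).mul hχ (p'' := -4) (q'' := 0)
  have r₃ := ((hΨ.ofNat_mul 48).mul hΛ (p'' := 0) (q'' := 0)).mul hχ (p'' := -4) (q'' := 0)
  have r₄ := hD.represents_Odag hU h hO
  have r₅ := ((hD.represents_rho hU h).ofNat_mul 8).mul
    (hD.represents_tho' hU h hO (p' := -5) (q' := -1)) (p'' := -4) (q'' := 0)
  have r₆ := ((hD.represents_tau hU h).ofNat_mul 8).mul
    (hD.represents_edt' hU h hO (p' := -5) (q' := 1)) (p'' := -4) (q'' := 0)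
  have r₇ := (hΨ.ofNat_mul 16).mul hO (p'' := -4) (q'' := 0)
  have r₈ := (hΛ.ofNat_mul 20).mul hO (p'' := -4) (q'' := 0)
  have e : Represents (-4) 0 _ _ := (hk ![1, 1, 1, 1]).ofNat_mul 4
  have t := e.eq_of_eq (((r₁.add r₂).add r₃).neg.sub ((((r₄.sub r₅).add r₆).add r₇).add r₈)) key x
  rw [hQ, symm4_four]
  simp at t ⊢
  linear_combination t / 8

end SpinDyad.IsNormalizedOn
end Final

end Debye

end

theorem debye_metric_curvature_components
    {M : Type*} [TopologicalSpace M] [ChartedSpace (EuclideanSpace ℝ (Fin 4)) M]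
    [IsManifold (𝓡 4) ∞ M]
    (g : Debye.LorentzianMetric M)
    (U : Set M) (hU : IsOpen U)
    (D : Debye.SpinDyad M) (hD : D.IsNormalizedOn g U)
    (Lam : ℝ) (hEinstein : D.IsEinsteinOn g U Lam)
    (hTypeII : D.IsTypeIIOn g U)
    (φ : M → ℂ) (hφ : ContMDiffOn (𝓡 4) 𝓘(ℝ, ℂ) ∞ φ U)
    (hφ_cube : ∀ x ∈ U, φ x ^ 3 = D.Psi g 2 x)
    (χ : M → ℂ) (hχ : ContMDiffOn (𝓡 4) 𝓘(ℝ, ℂ) ∞ χ U) :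
    ∀ x ∈ U,
      D.dotPsi g χ 0 x = 0 ∧
      D.dotPsi g χ 1 x = 0 ∧
      D.dotPsi g χ 2 x = 0 ∧
      D.dotPsi g χ 3 x =
        -(1 / 4) * (D.tau g x * D.tho g (-4) 0 (D.Odag g χ) x
          - D.rho g x * D.edt g (-4) 0 (D.Odag g χ) x) ∧
      D.dotPsi g χ 4 x =
        -(φ x ^ 4 * D.xiTheta g φ χ x + 3 * D.Psi g 2 x ^ 2 * χ x
            + 6 * D.Psi g 2 x * (Lam : ℂ) * χ x)
          - ((1 / 8) * D.Odag g (D.Odag g χ) x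
            - D.rho g x * D.tho' g (-4) 0 (D.Odag g χ) x
            + D.tau g x * D.edt' g (-4) 0 (D.Odag g χ) x
            + 2 * D.Psi g 2 x * D.Odag g χ x
            + (5 / 2) * (Lam : ℂ) * D.Odag g χ x) := by
  intro x hx
  have hx' := mem_chart_source (EuclideanSpace ℝ (Fin 4)) x
  let V := U ∩ (chartAt (EuclideanSpace ℝ (Fin 4)) x).source
  have hVU : V ⊆ U := Set.inter_subset_left
  have hV : IsOpen V := hU.inter (chartAt (EuclideanSpace ℝ (Fin 4)) x).open_source
  have hDV : D.IsNormalizedOn g V :=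
    ⟨hD.contMDiffOn_l.mono hVU, hD.contMDiffOn_n.mono hVU, hD.contMDiffOn_m_re.mono hVU,
      hD.contMDiffOn_m_im.mono hVU, fun y hy => hD.inner_leg y (hVU hy)⟩
  have h := hDV.isTypeII hV (fun y hy => hEinstein y (hVU hy)) (fun y hy => hTypeII y (hVU hy))
    Set.inter_subset_right
  have hχV := Debye.SmoothOn.represents (hχ.mono hVU) (-4) 0
  have hφ0 : ∀ y ∈ V, φ y ≠ 0 := fun y hy h0 => (hTypeII y (hVU hy)).2.2 (by
    rw [← hφ_cube y (hVU hy), h0, zero_pow (by norm_num)])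
  obtain ⟨h₀, h₁, h₂⟩ := Debye.SpinDyad.IsNormalizedOn.dotPsi_eq_zero h hχV ⟨x, hx, hx'⟩
  exact ⟨h₀, h₁, h₂, Debye.SpinDyad.IsNormalizedOn.dotPsi_three h hχV ⟨x, hx, hx'⟩,
    Debye.SpinDyad.IsNormalizedOn.dotPsi_four h hχV (hφ.mono hVU) hφ0
      (fun y hy => hφ_cube y (hVU hy)) ⟨x, hx, hx'⟩⟩
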